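/- arXiv:1903.05491 — 5 statements merged into one kernel-verified Lean document; each statement's English description precedes it below -/
import Mathlib

section
/- Let E ⊆ ℂ be a number field and P ∈ E[X] a quadratic polynomial, irreducible over E, with distinct nonzero roots α, β ∈ ℂ, and assume α is not a root of unity. Then either every pair of integers (n, m) with α^n·β^m = 1 satisfies n = m, or every such pair satisfies n = −m. (Equivalently, Rel_m({α,β}) ⊗ ℚ is one of 0, ℚ·(1,1), or ℚ·(−1,1).) -/
/-- for an irreducible quadratic over a number field `E ⊆ ℂ` with
distinct nonzero roots `α, β`, `α` not a root of unity, every multiplicative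
relation `α^n·β^m = 1` satisfies `n = m`, or every such relation satisfies
`n = −m`. -/
theorem quadratic_multiplicative_relations
    (E : IntermediateField ℚ ℂ) [FiniteDimensional ℚ E]
    (P : Polynomial E) (hdeg : P.natDegree = 2) (hirr : Irreducible P)
    (α β : ℂ) (hα : Polynomial.aeval α P = 0) (hβ : Polynomial.aeval β P = 0)
    (hne : α ≠ β) (hα0 : α ≠ 0) (hβ0 : β ≠ 0)
    (hru : ∀ j : ℕ, 0 < j → α ^ j ≠ 1) :
    (∀ n m : ℤ, α ^ n * β ^ m = 1 → n = m) ∨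
      (∀ n m : ℤ, α ^ n * β ^ m = 1 → n = -m) := by
  have ha : P.coeff 2 ≠ 0 := by
    rw [← hdeg]
    exact Polynomial.leadingCoeff_ne_zero.mpr hirr.ne_zero
  have hc : ∃ c : E, α + β = (algebraMap E ℂ c) := by
    refine ⟨-P.coeff 1 / P.coeff 2, ?_⟩
    rw [Polynomial.aeval_eq_sum_range, hdeg] at hα hβ
    simp only [Finset.sum_range_succ, Finset.sum_range_zero, Algebra.smul_def] at hα hβ
    have ha' : algebraMap E ℂ (P.coeff 2) ≠ 0 := by
      simpa using ha
    rw [map_div₀, map_neg, eq_div_iff ha']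
    apply mul_left_cancel₀ (sub_ne_zero.mpr hne)
    linear_combination hα - hβ
  obtain ⟨c, hc⟩ := hc
  haveI : Fact (Irreducible P) := ⟨hirr⟩
  let fa : AdjoinRoot P →+* ℂ := AdjoinRoot.lift (algebraMap E ℂ) α hα
  let fb : AdjoinRoot P →+* ℂ := AdjoinRoot.lift (algebraMap E ℂ) β hβ
  let x : AdjoinRoot P := AdjoinRoot.root P
  let y : AdjoinRoot P := AdjoinRoot.of P c - x
  have hax : fa x = α := AdjoinRoot.lift_root hα
  have hbx : fb x = β := AdjoinRoot.lift_root hβ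
  have hay : fa y = β := by
    have h : fa (AdjoinRoot.of P c) = algebraMap E ℂ c := AdjoinRoot.lift_of hα
    rw [map_sub, hax, h, ← hc]; ring
  have hby : fb y = α := by
    have h : fb (AdjoinRoot.of P c) = algebraMap E ℂ c := AdjoinRoot.lift_of hβ
    rw [map_sub, hbx, h, ← hc]; ring
  have hsw : ∀ n m : ℤ, α ^ n * β ^ m = 1 → β ^ n * α ^ m = 1 := by
    intro n m h
    have h1 : x ^ n * y ^ m = 1 := by
      apply fa.injective
      rw [map_mul, map_zpow₀, map_zpow₀, hax, hay, h, map_one]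
    have h2 := congrArg fb h1
    rwa [map_mul, map_zpow₀, map_zpow₀, hbx, hby, map_one] at h2
  have hz : ∀ k : ℤ, α ^ k = 1 → k = 0 := by
    intro k hk
    by_contra h0
    apply hru k.natAbs (Int.natAbs_pos.mpr h0)
    rcases Int.natAbs_eq k with h | h
    · rw [h, zpow_natCast] at hk
      exact hk
    · rw [h, zpow_neg, zpow_natCast, inv_eq_one] at hk
      exact hk
  -- general combination of two relations
  have hcomb : ∀ n m k l : ℤ, α ^ n * β ^ m = 1 → α ^ k * β ^ l = 1 → n * l - k * m = 0 := by
    intro n m k l h1 h2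
    apply hz
    have h3 : (α ^ n * β ^ m) ^ l * (α ^ k * β ^ l) ^ (-m) = 1 := by
      rw [h1, h2, one_zpow, one_zpow, one_mul]
    rw [mul_zpow, mul_zpow, ← zpow_mul, ← zpow_mul, ← zpow_mul, ← zpow_mul] at h3
    have h4 : α ^ (n * l - k * m) = α ^ (n * l) * α ^ (k * -m) := by
      rw [← zpow_add₀ hα0]; congr 1; ring
    have h5 : β ^ (m * l) * β ^ (l * -m) = 1 := by
      rw [← zpow_add₀ hβ0, show m * l + l * -m = 0 by ring, zpow_zero]
    rw [h4]
    linear_combination h3 - α ^ (n * l) * α ^ (k * -m) * h5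
  have hpm : ∀ n m : ℤ, α ^ n * β ^ m = 1 → n = m ∨ n = -m := by
    intro n m h
    have := hcomb n m m n h (by rw [mul_comm]; exact hsw n m h)
    exact mul_self_eq_mul_self_iff.mp (by linarith)
  by_contra hcon
  push Not at hcon
  obtain ⟨⟨n, m, h1, h2⟩, ⟨k, l, h3, h4⟩⟩ := hcon
  have e1 : n = -m := (hpm n m h1).resolve_left h2
  have e2 : k = l := (hpm k l h3).resolve_right h4
  have h := hcomb n m k l h1 h3
  subst e1 e2
  have h' : m * k = 0 := by linarith
  rcases mul_eq_zero.mp h' with h | h <;> subst h <;> simp at h2 h4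
end

section
/- Let ℓ be a prime, k a field of characteristic ℓ, n ≥ 2 an integer, and G = SL_n(𝔽_ℓ). Let Std denote the representation of G on k^n obtained from the inclusion SL_n(𝔽_ℓ) ⊆ GL_n(k) (via the prime field 𝔽_ℓ ⊆ k). Then every finite-dimensional irreducible k-linear representation V of G is a composition factor of some tensor power Std^{⊗M} with 0 ≤ M ≤ ℓ·n(n−1)/2; that is, there exist k[G]-submodules W' ⊆ W of (k^n)^{⊗M} (with the diagonal G-action) such that W/W' is isomorphic to V as a k[G]-module. -/
open CategoryTheory MonoidalCategory

/-- The `M`-th tensor power of a representation (an object of `Rep k G`), with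
the diagonal `G`-action. -/
noncomputable def tensorPow {k G : Type} [CommRing k] [Monoid G] (X : Rep k G) : ℕ → Rep k G
  | 0 => 𝟙_ (Rep k G)
  | (M + 1) => tensorPow X M ⊗ X

/-- The standard representation of `SL_n(𝔽_ℓ)` on `k^n`, for `k` a field of
characteristic `ℓ`, obtained from the inclusion `SL_n(𝔽_ℓ) ⊆ GL_n(k)`. -/
noncomputable def stdSL (ℓ n : ℕ) (k : Type) [Field k] [CharP k ℓ] :
    Representation k (Matrix.SpecialLinearGroup (Fin n) (ZMod ℓ)) (Fin n → k) :=
  ((Matrix.toLinAlgEquiv' (R := k) (n := Fin n)).toAlgHom.toRingHom.toMonoidHom).comp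
    ((Units.coeHom (Matrix (Fin n) (Fin n) k)).comp
      ((Matrix.SpecialLinearGroup.toGL).comp
        (Matrix.SpecialLinearGroup.map (ZMod.castHom (dvd_refl ℓ) k))))


section
open Polynomial


lemma mb_exists_kill {F : Type} [Field F] {V : Type} [AddCommGroup V] [Module F V]
    [FiniteDimensional F V] (f : Module.End F V) (p : F[X]) (hp : Irreducible p)
    (hd : p ∣ f.charpoly) : ∃ v, v ≠ 0 ∧ aeval f p v = 0 := by
  by_contra! hcon
  have hinj : Function.Injective (aeval f p) := by
    rw [injective_iff_map_eq_zero]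
    intro v hv
    by_contra h
    exact hcon v h hv
  let K := AlgebraicClosure F
  have hinj' : Function.Injective ((aeval f p).baseChange K) := by
    exact Module.Flat.lTensor_preserves_injective_linearMap (M := K) _ hinj
  obtain ⟨α, hα⟩ := IsAlgClosed.exists_aeval_eq_zero K p hp.degree_pos.ne'
  have hroot : (f.baseChange K).charpoly.IsRoot α := by
    rw [LinearMap.charpoly_baseChange]
    obtain ⟨c, hc⟩ := hd
    rw [hc, IsRoot, eval_map_algebraMap, map_mul, hα, zero_mul]
  rw [← Module.End.hasEigenvalue_iff_isRoot_charpoly] at hroot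
  obtain ⟨w, hw⟩ := hroot.exists_hasEigenvector
  have h1 := Module.End.aeval_apply_of_hasEigenvector (p := p.map (algebraMap F K)) hw
  rw [eval_map_algebraMap, hα, zero_smul] at h1
  have h2 : (aeval f p).baseChange K = aeval (f.baseChange K) (p.map (algebraMap F K)) := by
    rw [aeval_map_algebraMap]
    exact (aeval_algHom_apply (Module.End.baseChangeHom F K V) f p).symm
  rw [← h2] at h1
  exact hw.2 (hinj' (by rw [h1, map_zero]))

lemma mb_charpoly_prod {F : Type} [Field F] (P Q M : Type) [AddCommGroup P] [AddCommGroup Q]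
    [AddCommGroup M] [Module F P] [Module F Q] [Module F M] [Module F[X] P] [Module F[X] Q]
    [Module F[X] M] [IsScalarTower F F[X] P] [IsScalarTower F F[X] Q] [IsScalarTower F F[X] M]
    [FiniteDimensional F P] [FiniteDimensional F Q] [FiniteDimensional F M]
    (e : (P × Q) ≃ₗ[F[X]] M) :
      LinearMap.charpoly (Algebra.lsmul F F M (X : F[X])) =
      LinearMap.charpoly (Algebra.lsmul F F P (X : F[X])) *
      LinearMap.charpoly (Algebra.lsmul F F Q (X : F[X])) ∧
      Module.finrank F M = Module.finrank F P + Module.finrank F Q := by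
  constructor
  · rw [← LinearMap.charpoly_prodMap, ← LinearEquiv.charpoly_conj (e.restrictScalars F)]
    congr 1
    ext x
    simp only [LinearEquiv.conj_apply, LinearMap.comp_apply, Algebra.lsmul_coe]
    have := e.map_smul (X : F[X]) (e.symm x)
    rw [e.apply_symm_apply] at this
    exact this.symm
  · rw [← Module.finrank_prod]
    exact (e.restrictScalars F).finrank_eq.symm

lemma mb_iso_aux {F : Type} [Field F] (d : ℕ) : ∀ (M N : Type) [AddCommGroup M] [AddCommGroup N]
    [Module F M] [Module F N] [Module F[X] M] [Module F[X] N] [IsScalarTower F F[X] M]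
    [IsScalarTower F F[X] N] [FiniteDimensional F M] [FiniteDimensional F N]
    [IsSemisimpleModule F[X] M] [IsSemisimpleModule F[X] N],
    Module.finrank F M = d →
    LinearMap.charpoly (Algebra.lsmul F F M (X : F[X])) = 
      LinearMap.charpoly (Algebra.lsmul F F N (X : F[X])) →
    Nonempty (M ≃ₗ[F[X]] N) := by
  induction d using Nat.strong_induction_on with
  | _ d ih =>
  intro M N _ _ _ _ _ _ _ _ _ _ _ _ hd hch
  have hdim : Module.finrank F N = d := by
    rw [← hd, ← LinearMap.charpoly_natDegree (Algebra.lsmul F F M (X : F[X])), hch,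
      LinearMap.charpoly_natDegree]
  rcases Nat.eq_zero_or_pos d with h0 | hpos
  · subst h0
    have := Module.finrank_zero_iff.mp hd
    have := Module.finrank_zero_iff.mp hdim
    exact ⟨LinearEquiv.ofSubsingleton M N⟩
  obtain ⟨p, hp, hpd⟩ : ∃ p : F[X], Irreducible p ∧ 
      p ∣ LinearMap.charpoly (Algebra.lsmul F F M (X : F[X])) := by
    apply WfDvdMonoid.exists_irreducible_factor
    · intro hu
      have := natDegree_eq_zero_of_isUnit hu
      rw [LinearMap.charpoly_natDegree] at this
      omega
    · exact (LinearMap.charpoly_monic _).ne_zero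
  let P := F[X] ⧸ (Ideal.span {p})
  have hmax : (Ideal.span {p}).IsMaximal := PrincipalIdealRing.isMaximal_of_irreducible hp
  have hP : IsSimpleModule F[X] P := by
    rw [isSimpleModule_iff_isCoatom]
    exact hmax.out
  have key : ∀ (M : Type) [AddCommGroup M] [Module F M] [Module F[X] M] [IsScalarTower F F[X] M]
     [FiniteDimensional F M] [IsSemisimpleModule F[X] M], 
     p ∣ LinearMap.charpoly (Algebra.lsmul F F M (X : F[X])) → 
      ∃ V2 : Submodule F[X] M, Nonempty ((P × V2) ≃ₗ[F[X]] M) := by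
    intro M _ _ _ _ _ _ hpd
    obtain ⟨v, hv, hpv⟩ := mb_exists_kill _ p hp hpd
    have hpv' : p • v = 0 := by
      rw [aeval_algHom_apply, aeval_X_left] at hpv
      exact hpv
    let j0 : F[X] →ₗ[F[X]] M := LinearMap.toSpanSingleton F[X] M v
    have hj0 : Ideal.span {p} ≤ LinearMap.ker j0 := by
      rw [Ideal.span_le]
      rintro x rfl
      simpa [j0] using hpv'
    let j : P →ₗ[F[X]] M := Submodule.liftQ _ j0 hj0
    have hj : Function.Injective j := by
      refine (LinearMap.injective_or_eq_zero j).resolve_right fun h => hv ?_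
      have : j (Submodule.Quotient.mk 1) = v := by
        rw [Submodule.liftQ_apply]; simp [j0]
      rw [← this, h]; rfl
    obtain ⟨V2, h2⟩ := exists_isCompl (LinearMap.range j)
    exact ⟨V2, ⟨((LinearEquiv.ofInjective j hj).prodCongr (LinearEquiv.refl _ _)).trans
      (Submodule.prodEquivOfIsCompl _ _ h2)⟩⟩
  obtain ⟨V2, ⟨e⟩⟩ := key M hpd
  obtain ⟨W2, ⟨e'⟩⟩ := key N (hch ▸ hpd)
  have hPfin : FiniteDimensional F P := 
    Module.Finite.of_injective ((e.toLinearMap ∘ₗ LinearMap.inl F[X] P V2).restrictScalars F) 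
      (e.injective.comp LinearMap.inl_injective)
  have f1 : FiniteDimensional F V2 := Module.Finite.of_injective (V2.subtype.restrictScalars F) 
      V2.injective_subtype
  have f2 : FiniteDimensional F W2 := Module.Finite.of_injective (W2.subtype.restrictScalars F) 
      W2.injective_subtype
  obtain ⟨c1, d1⟩ := mb_charpoly_prod P V2 M e
  obtain ⟨c2, d2⟩ := mb_charpoly_prod P W2 N e'
  have hPpos : 0 < Module.finrank F P := by
    have : Nontrivial P := IsSimpleModule.nontrivial F[X] P
    exact Module.finrank_pos
  rw [c1, c2] at hch
  have hne := (LinearMap.charpoly_monic (Algebra.lsmul F F P (X : F[X]))).ne_zero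
  have hch' := mul_left_cancel₀ hne hch
  obtain ⟨u⟩ := ih (Module.finrank F V2) (by omega) V2 W2 rfl hch'
  exact ⟨e.symm.trans (((LinearEquiv.refl _ P).prodCongr u).trans e')⟩

lemma mb_conj {F : Type} [Field F] {n : ℕ} (A B : Matrix (Fin n) (Fin n) F) 
    (r : F[X]) (hr : Squarefree r) (hA : aeval A r = 0) (hB : aeval B r = 0) 
    (h : A.charpoly = B.charpoly) : ∃ g : GL (Fin n) F, g.1 * A = B * g.1 := by
  let a : Module.End F (Fin n → F) := Matrix.toLinAlgEquiv' A
  let b : Module.End F (Fin n → F) := Matrix.toLinAlgEquiv' B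
  have ha : a.IsSemisimple := Module.End.isSemisimple_of_squarefree_aeval_eq_zero hr (by
    have := aeval_algHom_apply (Matrix.toLinAlgEquiv' (R := F) (n := Fin n)).toAlgHom A r
    rw [hA, map_zero] at this
    exact this)
  have hb : b.IsSemisimple := Module.End.isSemisimple_of_squarefree_aeval_eq_zero hr (by
    have := aeval_algHom_apply (Matrix.toLinAlgEquiv' (R := F) (n := Fin n)).toAlgHom B r
    rw [hB, map_zero] at this
    exact this)
  have ha' : IsSemisimpleModule F[X] (Module.AEval' a) := ha
  have hb' : IsSemisimpleModule F[X] (Module.AEval' b) := hb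
  have hch : ∀ a : Module.End F (Fin n → F),
    LinearMap.charpoly (Algebra.lsmul F F (Module.AEval' a) (X : F[X])) = a.charpoly := by
    intro a
    rw [← LinearEquiv.charpoly_conj (Module.AEval'.of a) a]
    congr 1
    ext x
    rw [LinearEquiv.conj_apply_apply, ← Module.AEval'.X_smul_of, LinearEquiv.apply_symm_apply]
    rfl
  obtain ⟨e⟩ := mb_iso_aux _ (Module.AEval' a) (Module.AEval' b) rfl (by
    rw [hch, hch]
    exact (Matrix.charpoly_toLin' A).trans (h.trans (Matrix.charpoly_toLin' B).symm))
  let u : (Fin n → F) ≃ₗ[F] (Fin n → F) := (Module.AEval'.of a).trans ((e.restrictScalars F).trans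
    (Module.AEval'.of b).symm)
  have hu : ∀ x, u (a x) = b (u x) := by
    intro x
    change (Module.AEval'.of b).symm (e (Module.AEval'.of a (a x))) =
      b ((Module.AEval'.of b).symm (e (Module.AEval'.of a x)))
    rw [← Module.AEval'.X_smul_of, map_smul, Module.AEval'.of_symm_X_smul]
  have hu' : u.toLinearMap * a = b * u.toLinearMap := LinearMap.ext hu
  let φ := (Matrix.toLinAlgEquiv' (R := F) (n := Fin n)).symm
  refine ⟨⟨φ u.toLinearMap, φ u.symm.toLinearMap, ?_, ?_⟩, ?_⟩
  · rw [← map_mul, ← map_one φ]; exact congrArg φ (LinearMap.ext u.apply_symm_apply)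
  · rw [← map_mul, ← map_one φ]; exact congrArg φ (LinearMap.ext u.symm_apply_apply)
  · have := congrArg φ hu'
    rw [map_mul, map_mul] at this
    simpa [φ, a, b] using this

lemma mb_zmod_charpoly_pow {ℓ n : ℕ} [Fact ℓ.Prime] (A : Matrix (Fin n) (Fin n) (ZMod ℓ)) (m : ℕ) :
    (A ^ ℓ ^ m).charpoly = A.charpoly := by
  induction m with
  | zero => simp
  | succ m ih => rw [pow_succ, pow_mul, ZMod.charpoly_pow_card, ih]

lemma mb_conj_pow {ℓ n : ℕ} [Fact ℓ.Prime] : ∃ m : ℕ, ∀ A B : GL (Fin n) (ZMod ℓ),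
    A.1.charpoly = B.1.charpoly → ∃ g : GL (Fin n) (ZMod ℓ), g * A ^ ℓ ^ m = B ^ ℓ ^ m * g := by
  have hp : ℓ.Prime := Fact.out
  obtain ⟨m, N, hN, hc⟩ := Nat.exists_eq_pow_mul_and_not_dvd
    (Nat.card_pos (α := GL (Fin n) (ZMod ℓ))).ne' ℓ hp.ne_one
  refine ⟨m, fun A B h => ?_⟩
  have hN0 : (N : ZMod ℓ) ≠ 0 := by
    rwa [Ne, ZMod.natCast_eq_zero_iff]
  have hk : ∀ A : GL (Fin n) (ZMod ℓ), aeval (A.1 ^ ℓ ^ m) (X ^ N - 1 : (ZMod ℓ)[X]) = 0 := by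
    intro A
    have : A ^ (ℓ ^ m * N) = 1 := by rw [← hc]; exact pow_card_eq_one'
    have := congrArg Units.val this
    simpa [pow_mul, sub_eq_zero] using this
  obtain ⟨g, hg⟩ := mb_conj (A.1 ^ ℓ ^ m) (B.1 ^ ℓ ^ m) (X ^ N - 1)
    (X_pow_sub_one_separable_iff.mpr hN0).squarefree (hk A) (hk B) (by
      rw [mb_zmod_charpoly_pow, mb_zmod_charpoly_pow, h])
  exact ⟨g, Units.ext (by simpa using hg)⟩

lemma mb_trace_pow {K : Type} [Field K] {p : ℕ} [Fact p.Prime] [CharP K p] {d : ℕ}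
    (M : Matrix (Fin d) (Fin d) K) : (M ^ p).trace = M.trace ^ p := by
  cases isEmpty_or_nonempty (Fin d)
  · simp [Matrix.trace, (Fact.out : p.Prime).ne_zero]
  have h : (M ^ p).charpoly = M.charpoly.map (frobenius K p) := by
    apply expand_injective (R := K) (Fact.out : p.Prime).pos
    rw [← Polynomial.map_expand, Polynomial.map_frobenius_expand]
    unfold Matrix.charpoly
    rw [AlgHom.map_det, ← Matrix.coe_detMonoidHom, ← map_pow]
    apply congr_arg
    refine matPolyEquiv.injective ?_
    rw [map_pow, Matrix.matPolyEquiv_charmatrix, sub_pow_char_of_commute, ← C_pow]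
    · exact (id (matPolyEquiv_eq_X_pow_sub_C p M) :)
    · exact (C M).commute_X
  rw [Matrix.trace_eq_neg_charpoly_coeff, Matrix.trace_eq_neg_charpoly_coeff, h, coeff_map,
    frobenius_def, neg_pow, neg_one_pow_char, neg_one_mul]

lemma mb_trace_pow' {K : Type} [Field K] {p : ℕ} [Fact p.Prime] [CharP K p] {S : Type}
    [AddCommGroup S] [Module K S] [FiniteDimensional K S]
    (f : Module.End K S) (m : ℕ) :
    LinearMap.trace K S (f ^ p ^ m) = (LinearMap.trace K S f) ^ p ^ m := by
  induction m with
  | zero => simp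
  | succ m ih =>
    have b := Module.finBasis K S
    rw [pow_succ, pow_mul, pow_mul, ← ih, LinearMap.trace_eq_matrix_trace K b,
      LinearMap.trace_eq_matrix_trace K b, ← mb_trace_pow]
    congr 1
    exact map_pow (LinearMap.toMatrixAlgEquiv b) _ _

/-- traces of representations of `GL_n(ZMod ℓ)` only depend on the characteristic polynomial. -/
lemma mb_trace_eq {K : Type} [Field K] {ℓ n : ℕ} [Fact ℓ.Prime] [CharP K ℓ] {S : Type}
    [AddCommGroup S] [Module K S] [FiniteDimensional K S]
    (σ : GL (Fin n) (ZMod ℓ) →* Module.End K S) (A B : GL (Fin n) (ZMod ℓ))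
    (h : A.1.charpoly = B.1.charpoly) :
    LinearMap.trace K S (σ A) = LinearMap.trace K S (σ B) := by
  obtain ⟨m, hm⟩ := mb_conj_pow (ℓ := ℓ) (n := n)
  obtain ⟨g, hg⟩ := hm A B h
  apply iterateFrobenius_inj K ℓ m
  rw [iterateFrobenius_def, iterateFrobenius_def, ← mb_trace_pow', ← mb_trace_pow', ← map_pow,
    ← map_pow]
  have h1 : A ^ ℓ ^ m = g⁻¹ * (B ^ ℓ ^ m * g) := by rw [← hg]; group
  rw [h1, map_mul, LinearMap.trace_mul_comm, ← map_mul, mul_assoc, mul_inv_cancel, mul_one]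

/-- span of monomials of degree at most `B` in the matrix entries, as functions on `SL_n`. -/
def mbQ (ℓ n : ℕ) (K : Type) [Field K] [CharP K ℓ] (B : ℕ) :
    Submodule K (Matrix.SpecialLinearGroup (Fin n) (ZMod ℓ) → K) :=
  Submodule.span K {φ | ∃ l : List (Fin n × Fin n), l.length ≤ B ∧
    φ = fun g => (l.map fun rc => (ZMod.castHom (dvd_refl ℓ) K (g.1 rc.1 rc.2))).prod}

section
variable {ℓ n : ℕ} {K : Type} [Field K] [CharP K ℓ]

lemma mbQ_mono {a b : ℕ} (h : a ≤ b) : mbQ ℓ n K a ≤ mbQ ℓ n K b := by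
  apply Submodule.span_mono
  rintro φ ⟨l, hl, rfl⟩
  exact ⟨l, hl.trans h, rfl⟩

lemma mbQ_mul {a b : ℕ} {φ ψ} (h : φ ∈ mbQ ℓ n K a) (h' : ψ ∈ mbQ ℓ n K b) :
    φ * ψ ∈ mbQ ℓ n K (a + b) := by
  have := Submodule.mul_mem_mul h h'
  rw [mbQ, mbQ, Submodule.span_mul_span] at this
  refine Submodule.span_mono ?_ this
  rintro _ ⟨_, ⟨l, hl, rfl⟩, _, ⟨l', hl', rfl⟩, rfl⟩
  refine ⟨l ++ l', by simp; omega, ?_⟩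
  ext g
  simp

lemma mbQ_one (a : ℕ) : (1 : Matrix.SpecialLinearGroup (Fin n) (ZMod ℓ) → K) ∈ mbQ ℓ n K a :=
  Submodule.subset_span ⟨[], by simp, by ext; simp⟩

lemma mbQ_const (a : ℕ) (c : K) : (fun _ => c) ∈ mbQ ℓ n K a := by
  convert (mbQ ℓ n K a).smul_mem c (mbQ_one a)
  simp

lemma mbQ_pow {a : ℕ} {φ : Matrix.SpecialLinearGroup (Fin n) (ZMod ℓ) → K} (h : φ ∈ mbQ ℓ n K a) (m : ℕ) : φ ^ m ∈ mbQ ℓ n K (a * m) := by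
  induction m with
  | zero => simpa using mbQ_one _
  | succ m ih => rw [pow_succ, mul_add, mul_one]; exact mbQ_mul ih h

lemma mbQ_prod {ι : Type} (s : Finset ι) (a : ι → ℕ) (φ : ι → Matrix.SpecialLinearGroup (Fin n) (ZMod ℓ) → K)
    (h : ∀ i ∈ s, φ i ∈ mbQ ℓ n K (a i)) : ∏ i ∈ s, φ i ∈ mbQ ℓ n K (∑ i ∈ s, a i) := by
  classical
  induction s using Finset.induction_on with
  | empty => simpa using mbQ_one _
  | insert i s hi ih =>
    rw [Finset.prod_insert hi, Finset.sum_insert hi]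
    exact mbQ_mul (h _ (by simp)) (ih fun j hj => h j (by simp [hj]))

lemma mbQ_entry (h : Matrix (Fin n) (Fin n) (ZMod ℓ)) (i j : Fin n) :
    (fun g : Matrix.SpecialLinearGroup (Fin n) (ZMod ℓ) =>
      ZMod.castHom (dvd_refl ℓ) K ((h * g.1) i j)) ∈ mbQ ℓ n K 1 := by
  have : (fun g : Matrix.SpecialLinearGroup (Fin n) (ZMod ℓ) =>
      ZMod.castHom (dvd_refl ℓ) K ((h * g.1) i j)) = ∑ k, (ZMod.castHom (dvd_refl ℓ) K (h i k)) •
      fun g : Matrix.SpecialLinearGroup (Fin n) (ZMod ℓ) => ZMod.castHom (dvd_refl ℓ) K (g.1 k j) := by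
    ext g
    rw [Matrix.mul_apply, map_sum, Finset.sum_apply]
    simp
  rw [this]
  refine Submodule.sum_mem _ fun k _ => Submodule.smul_mem _ _ (Submodule.subset_span ?_)
  exact ⟨[(k, j)], by simp, by simp⟩

lemma mbQ_coeff (h : Matrix (Fin n) (Fin n) (ZMod ℓ)) (i j : ℕ) (hij : i + j = n) :
    (fun g : Matrix.SpecialLinearGroup (Fin n) (ZMod ℓ) =>
      ZMod.castHom (dvd_refl ℓ) K ((h * g.1).charpoly.coeff i)) ∈ mbQ ℓ n K j := by
  have hom := Matrix.charpoly.univ_coeff_isHomogeneous ℤ (Fin n) i j (by simpa using hij)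
  set P := (Matrix.charpoly.univ ℤ (Fin n)).coeff i with hP
  have hev : (fun g : Matrix.SpecialLinearGroup (Fin n) (ZMod ℓ) =>
      ZMod.castHom (dvd_refl ℓ) K ((h * g.1).charpoly.coeff i)) =
      ∑ d ∈ P.support, ((P.coeff d : ℤ) : K) • ∏ x ∈ d.support, (fun g :
        Matrix.SpecialLinearGroup (Fin n) (ZMod ℓ) =>
        ZMod.castHom (dvd_refl ℓ) K ((h * g.1) x.1 x.2)) ^ (d x) := by
    ext g
    have := Matrix.charpoly.univ_coeff_eval₂Hom (Fin n) (Int.castRingHom (ZMod ℓ))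
      (fun x => (h * g.1) x.1 x.2) i
    have h2 : Matrix.of (Function.curry fun x : Fin n × Fin n => (h * g.1) x.1 x.2) = h * g.1 := rfl
    rw [h2, ← hP] at this
    rw [← this, MvPolynomial.coe_eval₂Hom, MvPolynomial.eval₂_eq, map_sum, Finset.sum_apply]
    refine Finset.sum_congr rfl fun d _ => ?_
    rw [map_mul, map_prod, Pi.smul_apply, Finset.prod_apply, smul_eq_mul]
    simp only [map_pow, Pi.pow_apply, eq_intCast, map_intCast]
  rw [hev]
  refine Submodule.sum_mem _ fun d hd => Submodule.smul_mem _ _ ?_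
  have := mbQ_prod (K := K) d.support (fun x => 1 * d x) _
    (fun x _ => mbQ_pow (mbQ_entry h x.1 x.2) (d x))
  have hdeg : ∑ x ∈ d.support, d x = j := by
    have := hom (MvPolynomial.mem_support_iff.mp hd)
    rw [Finsupp.weight_apply] at this
    simpa [Finsupp.sum] using this
  simpa only [one_mul, hdeg] using this

lemma mbQ_classfun [Fact ℓ.Prime] (χ : GL (Fin n) (ZMod ℓ) → K)
    (hχ : ∀ A B : GL (Fin n) (ZMod ℓ), A.1.charpoly = B.1.charpoly → χ A = χ B)
    (h : GL (Fin n) (ZMod ℓ)) :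
    (fun g : Matrix.SpecialLinearGroup (Fin n) (ZMod ℓ) => χ (h * g.toGL))
      ∈ mbQ ℓ n K (ℓ * (n * (n - 1) / 2)) := by
  classical
  have hp : ℓ.Prime := Fact.out
  let cv : Matrix (Fin n) (Fin n) (ZMod ℓ) → Fin n → ZMod ℓ := fun A i => A.charpoly.coeff i
  have hcv : ∀ A B : Matrix (Fin n) (Fin n) (ZMod ℓ), cv A = cv B → A.charpoly = B.charpoly := by
    intro A B hAB
    ext i
    have hd : ∀ A : Matrix (Fin n) (Fin n) (ZMod ℓ), A.charpoly.natDegree = n := fun A => by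
      rw [Matrix.charpoly_natDegree_eq_dim, Fintype.card_fin]
    rcases lt_trichotomy i n with hi | hi | hi
    · exact congrFun hAB ⟨i, hi⟩
    · have h1 := (Matrix.charpoly_monic A).coeff_natDegree
      have h2 := (Matrix.charpoly_monic B).coeff_natDegree
      rw [hd] at h1 h2
      rw [hi, h1, h2]
    · rw [coeff_eq_zero_of_natDegree_lt (by rwa [hd]), coeff_eq_zero_of_natDegree_lt (by rwa [hd])]
  let φ : (Fin n → ZMod ℓ) → K := fun c =>
    if hc : ∃ A : GL (Fin n) (ZMod ℓ), cv A.1 = c then χ hc.choose else 0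
  have hφ : ∀ A : GL (Fin n) (ZMod ℓ), χ A = φ (cv A.1) := by
    intro A
    have hc : ∃ A' : GL (Fin n) (ZMod ℓ), cv A'.1 = cv A.1 := ⟨A, rfl⟩
    simp only [φ, dif_pos hc]
    exact (hχ _ _ (hcv _ _ hc.choose_spec)).symm
  let γ := ZMod.castHom (dvd_refl ℓ) K
  let f : Fin n → Matrix.SpecialLinearGroup (Fin n) (ZMod ℓ) → K := fun i g =>
    γ ((h.1 * g.1).charpoly.coeff i)
  have key : (fun g : Matrix.SpecialLinearGroup (Fin n) (ZMod ℓ) => χ (h * g.toGL)) =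
      ∑ c : Fin n → ZMod ℓ, φ c • ∏ i, (1 - (f i - fun _ => γ (c i)) ^ (ℓ - 1)) := by
    ext g
    rw [hφ, Finset.sum_apply, Finset.sum_eq_single (cv (h.1 * g.1))]
    · have h1 : ∀ i, f i g - γ (cv (h.1 * g.1) i) = 0 := fun i => sub_self _
      have h2 : (0 : K) ^ (ℓ - 1) = 0 := zero_pow (by have := hp.two_le; omega)
      simp [h1, h2, Finset.prod_apply]
    · intro c _ hc
      obtain ⟨i, hi⟩ := Function.ne_iff.mp hc
      have h1 : (f i g - γ (c i)) ^ (ℓ - 1) = 1 := by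
        rw [← map_sub, ← map_pow, ZMod.pow_card_sub_one_eq_one, map_one]
        exact sub_ne_zero.mpr hi.symm
      rw [Pi.smul_apply, Finset.prod_apply, Finset.prod_eq_zero (Finset.mem_univ i), smul_zero]
      simp [h1]
    · simp
  rw [key]
  refine Submodule.sum_mem _ fun c _ => Submodule.smul_mem _ _ ?_
  let a : Fin n → ℕ := fun i => if i.1 = 0 then 0 else n - i.1
  have hf : ∀ i, f i ∈ mbQ ℓ n K (a i) := by
    intro i
    by_cases hi : i.1 = 0
    · have : f i = fun _ => γ ((-1) ^ n * h.1.det) := by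
        ext g
        simp only [f, hi]
        congr 1
        have := Matrix.det_eq_sign_charpoly_coeff (h.1 * g.1)
        rw [Matrix.det_mul, g.2, mul_one, Fintype.card_fin] at this
        rw [this, ← mul_assoc, ← mul_pow]
        simp
      rw [this]
      exact mbQ_const _ _
    · simp only [a, if_neg hi]
      exact mbQ_coeff h.1 i (n - i) (by omega)
  have := mbQ_prod (K := K) Finset.univ (fun i => a i * (ℓ - 1))
    (fun i => (1 - (f i - fun _ => γ (c i)) ^ (ℓ - 1))) (fun i _ =>
      Submodule.sub_mem _ (mbQ_one _) (mbQ_pow (Submodule.sub_mem _ (hf i) (mbQ_const _ _)) _))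
  refine mbQ_mono ?_ this
  rw [← Finset.sum_mul, mul_comm]
  refine Nat.mul_le_mul (Nat.sub_le _ _) ?_
  rw [← Finset.sum_range_id_mul_two, Nat.mul_div_cancel _ two_pos]
  have h3 : ∑ i, a i = ∑ i ∈ Finset.range n, (if i = 0 then 0 else n - i) :=
    Fin.sum_univ_eq_sum_range (fun i => if i = 0 then 0 else n - i) n
  rw [h3]
  cases n with
  | zero => simp
  | succ m =>
    rw [Finset.sum_range_succ', Finset.sum_range_succ', ← Finset.sum_range_reflect (fun i => i + 1)]
    simp only [if_true, add_zero]
    refine Finset.sum_le_sum fun i hi => ?_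
    have := Finset.mem_range.mp hi
    simp only [Nat.add_eq_zero_iff, one_ne_zero, and_false, if_false]
    omega
end


lemma mb_trace_nondeg {K A S : Type} [Field K] [IsAlgClosed K] [Ring A] [Algebra K A]
    [AddCommGroup S] [Module K S] [Module A S] [IsScalarTower K A S] [IsSimpleModule A S]
    [FiniteDimensional K S] (a : A)
    (h : ∀ b : A, LinearMap.trace K S (Algebra.lsmul K K S (b * a)) = 0) (s : S) : a • s = 0 := by
  classical
  by_contra hs
  obtain ⟨f, hf⟩ : ∃ f : Module.Dual K S, f (a • s) ≠ 0 := by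
    by_contra! hc
    exact hs ((Module.forall_dual_apply_eq_zero_iff K _).mp hc)
  let u : Module.End K S := f.smulRight s
  let U : Module.End (Module.End A S) S :=
    { toFun := u
      map_add' := u.map_add
      map_smul' := by
        intro φ x
        obtain ⟨t, rfl⟩ := (IsSimpleModule.algebraMap_end_bijective_of_isAlgClosed (A := A) (V := S) K).2 φ
        exact u.map_smul t x }
  let bs := Module.finBasis K S
  obtain ⟨b, hb⟩ := jacobson_density (R := A) U (Finset.univ.image bs)
  have hu : Algebra.lsmul K K S b = u := by
    refine bs.ext fun i => ?_
    exact (hb (bs i) (by simp)).symm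
  have := h b
  rw [map_mul, hu] at this
  have h2 : u * Algebra.lsmul K K S a = (f ∘ₗ (Algebra.lsmul K K S a)).smulRight s := by
    ext x; rfl
  rw [h2, LinearMap.trace_smulRight] at this
  exact hf this

set_option maxHeartbeats 2000000 in
lemma mb_exists_rep {k K G H V : Type} [Field k] [Field K] [IsAlgClosed K] [Algebra k K] [Group G]
    [Group H] [Fintype G] [Finite H] (ι : G →* H) (hι : Function.Injective ι) [AddCommGroup V]
    [Module k V] (ρ : Representation k G V) (v : V) (hv : v ≠ 0) (c : G → k)
    (hc : ∑ g, c g • ρ g v = v) :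
    ∃ (S : Type) (_ : AddCommGroup S) (_ : Module K S) (_ : FiniteDimensional K S)
      (σ : H →* Module.End K S) (h : H),
      ∑ g, algebraMap k K (c g) * LinearMap.trace K S (σ (h * ι g)) ≠ 0 := by
  classical
  obtain ⟨f, hf⟩ : ∃ f : Module.Dual k V, f v ≠ 0 := by
    by_contra! hc
    exact hv ((Module.forall_dual_apply_eq_zero_iff k _).mp hc)
  let F' : H → K := fun h => if hh : ∃ g, ι g = h then algebraMap k K (f (ρ hh.choose v)) else 0
  have hF : ∀ g, F' (ι g) = algebraMap k K (f (ρ g v)) := by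
    intro g
    have hh : ∃ g', ι g' = ι g := ⟨g, rfl⟩
    simp only [F', dif_pos hh]
    rw [hι hh.choose_spec]
  have hF0 : ∀ h, (¬ ∃ g, ι g = h) → F' h = 0 := fun h hh => by simp only [F', dif_neg hh]
  let fb : MonoidAlgebra K H →ₗ[K] K :=
    Finsupp.linearCombination K F' ∘ₗ (MonoidAlgebra.coeffLinearEquiv K).toLinearMap
  have hfb : ∀ h r, fb (MonoidAlgebra.single h r) = r * F' h := by
    intro h r
    simp [fb]
  let N : Ideal (MonoidAlgebra K H) :=
    { carrier := {x | ∀ y, fb (y * x) = 0}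
      add_mem' := fun {a b} ha hb y => by rw [mul_add, map_add, ha, hb, add_zero]
      zero_mem' := fun y => by rw [mul_zero, map_zero]
      smul_mem' := fun r x hx y => by rw [smul_eq_mul, ← mul_assoc]; exact hx _ }
  let ib : MonoidAlgebra K H := ∑ g, MonoidAlgebra.single (ι g) (algebraMap k K (c g))
  have hib : 1 - ib ∈ N := by
    intro y
    induction y using MonoidAlgebra.induction_linear with
    | zero => simp
    | add a b ha hb => rw [add_mul, map_add, ha, hb, add_zero]
    | single h r =>
      rw [mul_sub, mul_one, map_sub, hfb, Finset.mul_sum, map_sum]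
      simp only [MonoidAlgebra.single_mul_single, hfb]
      by_cases hh : ∃ g, ι g = h
      · obtain ⟨g0, rfl⟩ := hh
        simp only [← map_mul, hF, mul_assoc]
        rw [← Finset.mul_sum]
        rw [← map_sum, ← mul_sub, ← map_sub]
        have : f (ρ g0 v) = ∑ g, c g * f (ρ (g0 * g) v) := by
          conv_lhs => rw [← hc]
          simp [map_sum]
        rw [this, sub_self, map_zero, mul_zero]
      · rw [hF0 h hh, mul_zero, zero_sub, neg_eq_zero]
        refine Finset.sum_eq_zero fun g _ => ?_
        rw [hF0, mul_zero]
        rintro ⟨g', hg'⟩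
        exact hh ⟨g' * g⁻¹, by rw [map_mul, map_inv, hg', mul_inv_cancel_right]⟩
  have hN : N ≠ ⊤ := by
    rw [Ne, Ideal.eq_top_iff_one]
    intro h1
    have := h1 1
    rw [mul_one, MonoidAlgebra.one_def, hfb, one_mul, ← map_one ι, hF, map_one] at this
    exact hf (by simpa using this)
  obtain ⟨m, hm, hNm⟩ := Ideal.exists_le_maximal N hN
  have hs : IsSimpleModule (MonoidAlgebra K H) (MonoidAlgebra K H ⧸ m) := by
    rw [isSimpleModule_iff_isCoatom]
    exact hm.out
  have : FiniteDimensional K (MonoidAlgebra K H) :=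
    Module.Finite.equiv (MonoidAlgebra.coeffLinearEquiv K (M := H)).symm
  have : FiniteDimensional K (MonoidAlgebra K H ⧸ m) :=
    Module.Finite.of_surjective (m.mkQ.restrictScalars K) (Submodule.mkQ_surjective _)
  refine ⟨MonoidAlgebra K H ⧸ m, inferInstance, inferInstance, this,
    ((MonoidHomClass.toMonoidHom (Algebra.lsmul K K (MonoidAlgebra K H ⧸ m) :
      MonoidAlgebra K H →ₐ[K] _)).comp (MonoidAlgebra.of K H)), ?_⟩
  by_contra! hcon
  have key := mb_trace_nondeg (K := K) (S := MonoidAlgebra K H ⧸ m) ib (by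
    intro y
    induction y using MonoidAlgebra.induction_linear with
    | zero => simp
    | add a b ha hb => rw [add_mul, map_add, map_add, ha, hb, add_zero]
    | single h r =>
      have := hcon h
      rw [Finset.mul_sum, map_sum, map_sum]
      rw [← mul_zero r, ← this, Finset.mul_sum]
      refine Finset.sum_congr rfl fun g _ => ?_
      rw [MonoidAlgebra.single_mul_single]
      have h3 : MonoidAlgebra.single (h * ι g) (r * algebraMap k K (c g)) =
        (r * algebraMap k K (c g)) • MonoidAlgebra.of K H (h * ι g) := by simp
      rw [h3, map_smul, map_smul, smul_eq_mul, mul_assoc]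
      rfl) (Submodule.Quotient.mk 1)
  rw [← Submodule.Quotient.mk_smul, smul_eq_mul, mul_one, Submodule.Quotient.mk_eq_zero] at key
  exact hm.ne_top ((Ideal.eq_top_iff_one _).mpr (by simpa using add_mem (hNm hib) key))


/-- `V` is a composition factor (subquotient) of `T`. -/
def mbFactor {k G V T : Type} [Field k] [Group G] [AddCommGroup V] [Module k V] [AddCommGroup T]
    [Module k T] (ρ : Representation k G V) (τ : Representation k G T) : Prop :=
  ∃ (W' W : Submodule k T) (hW : ∀ g x, x ∈ W → τ g x ∈ W) (_ : ∀ g x, x ∈ W' → τ g x ∈ W')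
    (_ : W' ≤ W) (e : (W ⧸ Submodule.comap W.subtype W') ≃ₗ[k] V),
    ∀ (g) (x : W), e (Submodule.Quotient.mk (⟨τ g x, hW g x x.2⟩ : W)) =
      ρ g (e (Submodule.Quotient.mk x))

section
variable {k G V : Type} [Field k] [Group G] [AddCommGroup V] [Module k V]

lemma mb_irr (ρ : Representation k G V)
    (hirr : ∀ W : Submodule k V, (∀ g x, x ∈ W → ρ g x ∈ W) → W = ⊥ ∨ W = ⊤)
    (L : Ideal (MonoidAlgebra k G)) (v : V) (h : ∃ a ∈ L, ρ.asAlgebraHom a v ≠ 0) (w : V) :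
    ∃ a ∈ L, ρ.asAlgebraHom a v = w := by
  let W : Submodule k V := (L.restrictScalars k).map
    ((LinearMap.applyₗ v) ∘ₗ ρ.asAlgebraHom.toLinearMap)
  have hW : W = ⊤ := by
    refine (hirr W ?_).resolve_left ?_
    · rintro g _ ⟨a, ha, rfl⟩
      refine ⟨MonoidAlgebra.single g 1 * a, L.mul_mem_left _ ha, ?_⟩
      simp
    · intro hb
      obtain ⟨a, ha, ha'⟩ := h
      have : ρ.asAlgebraHom a v ∈ W := ⟨a, ha, rfl⟩
      rw [hb] at this
      exact ha' this
  have : w ∈ W := by rw [hW]; trivial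
  obtain ⟨a, ha, h'⟩ := this
  exact ⟨a, ha, h'⟩

lemma mb_factor_of {T : Type} [AddCommGroup T] [Module k T] (ρ : Representation k G V)
    (τ : Representation k G T)
    (hirr : ∀ W : Submodule k V, (∀ g x, x ∈ W → ρ g x ∈ W) → W = ⊥ ∨ W = ⊤)
    (L : Ideal (MonoidAlgebra k G)) (v : V) (h : ∃ a ∈ L, ρ.asAlgebraHom a v ≠ 0) (t : T)
    (ht : ∀ a ∈ L, τ.asAlgebraHom a t = 0 → ρ.asAlgebraHom a v = 0) : mbFactor ρ τ := by
  let L' := L.restrictScalars k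
  let φ : L' →ₗ[k] T := ((LinearMap.applyₗ t) ∘ₗ τ.asAlgebraHom.toLinearMap) ∘ₗ L'.subtype
  let ψ : L' →ₗ[k] V := ((LinearMap.applyₗ v) ∘ₗ ρ.asAlgebraHom.toLinearMap) ∘ₗ L'.subtype
  have hker : LinearMap.ker φ ≤ LinearMap.ker ψ := fun a ha => ht a.1 a.2 ha
  let W := LinearMap.range φ
  let f : W →ₗ[k] V := ((LinearMap.ker φ).liftQ ψ hker) ∘ₗ φ.quotKerEquivRange.symm.toLinearMap
  have hf : ∀ a : L', f ⟨φ a, LinearMap.mem_range_self φ a⟩ = ψ a := by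
    intro a
    have : φ.quotKerEquivRange.symm ⟨φ a, LinearMap.mem_range_self φ a⟩ = Submodule.Quotient.mk a := by
      rw [LinearEquiv.symm_apply_eq]
      rfl
    simp only [f, LinearMap.comp_apply, LinearEquiv.coe_coe]
    rw [this]
    rfl
  have hsurj : Function.Surjective f := by
    intro w
    obtain ⟨a, ha, h'⟩ := mb_irr ρ hirr L v h w
    exact ⟨_, (hf ⟨a, ha⟩).trans h'⟩
  let g1 : G → L' → L' := fun g a => ⟨MonoidAlgebra.single g 1 * a.1, L.mul_mem_left _ a.2⟩
  have hg1 : ∀ g a, φ (g1 g a) = τ g (φ a) := fun g a => by simp [φ, g1]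
  have hg2 : ∀ g a, ψ (g1 g a) = ρ g (ψ a) := fun g a => by simp [ψ, g1]
  have hW : ∀ g x, x ∈ W → τ g x ∈ W := by
    rintro g _ ⟨a, rfl⟩
    exact ⟨g1 g a, hg1 g a⟩
  have hfeq : ∀ g (x : W), f ⟨τ g x, hW g x x.2⟩ = ρ g (f x) := by
    rintro g ⟨_, a, rfl⟩
    rw [hf a, ← hg2, ← hf]
    congr 2
    exact (hg1 g a).symm
  refine ⟨(LinearMap.ker f).map W.subtype, W, hW, ?_, Submodule.map_subtype_le _ _,
    (Submodule.quotEquivOfEq _ _ (Submodule.comap_map_eq_of_injective W.injective_subtype _)).trans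
      (f.quotKerEquivOfSurjective hsurj), ?_⟩
  · rintro g _ ⟨x, hx, rfl⟩
    refine ⟨⟨τ g x, hW g x x.2⟩, ?_, rfl⟩
    have hx' : f x = 0 := hx
    change f _ = 0
    rw [hfeq, hx', map_zero]
  · intro g x
    exact hfeq g x

lemma mb_ideal_step {T : Type} [AddCommGroup T] [Module k T] [FiniteDimensional k T]
    (ρ : Representation k G V) (τ : Representation k G T)
    (hirr : ∀ W : Submodule k V, (∀ g x, x ∈ W → ρ g x ∈ W) → W = ⊥ ∨ W = ⊤)
    (hnot : ¬ mbFactor ρ τ)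
    (L : Ideal (MonoidAlgebra k G)) (v : V) (h : ∃ a ∈ L, ρ.asAlgebraHom a v ≠ 0) :
    ∃ L' : Ideal (MonoidAlgebra k G), L' ≤ L ∧ (∃ a ∈ L', ρ.asAlgebraHom a v ≠ 0) ∧
      ∀ a ∈ L', τ.asAlgebraHom a = 0 := by
  classical
  let b := Module.finBasis k T
  have key : ∀ s : Finset (Fin (Module.finrank k T)), ∃ L' : Ideal (MonoidAlgebra k G), L' ≤ L ∧
      (∃ a ∈ L', ρ.asAlgebraHom a v ≠ 0) ∧ ∀ a ∈ L', ∀ i ∈ s, τ.asAlgebraHom a (b i) = 0 := by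
    intro s
    induction s using Finset.induction_on with
    | empty => exact ⟨L, le_rfl, h, by simp⟩
    | insert i s hi ih =>
      obtain ⟨L', hle, h', hk⟩ := ih
      let L'' : Ideal (MonoidAlgebra k G) :=
        { carrier := {a | a ∈ L' ∧ τ.asAlgebraHom a (b i) = 0}
          add_mem' := fun {x y} hx hy => ⟨add_mem hx.1 hy.1, by
            rw [map_add, LinearMap.add_apply, hx.2, hy.2, add_zero]⟩
          zero_mem' := ⟨zero_mem _, by simp⟩
          smul_mem' := fun c x hx => ⟨L'.mul_mem_left _ hx.1, by
            rw [smul_eq_mul, map_mul, Module.End.mul_apply, hx.2, map_zero]⟩ }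
      refine ⟨L'', fun a ha => hle ha.1, ?_, ?_⟩
      · by_contra! hc
        exact hnot (mb_factor_of ρ τ hirr L' v h' (b i) fun a ha hat => hc a ⟨ha, hat⟩)
      · intro a ha j hj
        rcases Finset.mem_insert.mp hj with rfl | hj
        · exact ha.2
        · exact hk a ha.1 j hj
  obtain ⟨L', hle, h', hk⟩ := key Finset.univ
  exact ⟨L', hle, h', fun a ha => b.ext fun i => hk a ha i (Finset.mem_univ _)⟩

lemma mb_ideal_all (T : ℕ → Rep k G) [∀ M, FiniteDimensional k (T M)]
    (ρ : Representation k G V)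
    (hirr : ∀ W : Submodule k V, (∀ g x, x ∈ W → ρ g x ∈ W) → W = ⊥ ∨ W = ⊤)
    (v : V) (hv : v ≠ 0) (B : ℕ) (hnot : ∀ M < B, ¬ mbFactor ρ (T M).ρ) :
    ∃ a : MonoidAlgebra k G, ρ.asAlgebraHom a v = v ∧ ∀ M < B, (T M).ρ.asAlgebraHom a = 0 := by
  have key : ∃ L : Ideal (MonoidAlgebra k G), (∃ a ∈ L, ρ.asAlgebraHom a v ≠ 0) ∧
      ∀ a ∈ L, ∀ M < B, (T M).ρ.asAlgebraHom a = 0 := by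
    induction B with
    | zero => exact ⟨⊤, ⟨1, trivial, by simpa using hv⟩, by simp⟩
    | succ B ih =>
      obtain ⟨L, h, hk⟩ := ih fun M hM => hnot M (by omega)
      obtain ⟨L', hle, h', hk'⟩ := mb_ideal_step ρ (T B).ρ hirr (hnot B (by omega)) L v h
      refine ⟨L', h', fun a ha M hM => ?_⟩
      rcases Nat.lt_succ_iff_lt_or_eq.mp hM with hM | rfl
      · exact hk a (hle ha) M hM
      · exact hk' a ha
  obtain ⟨L, h, hk⟩ := key
  obtain ⟨a, ha, h'⟩ := mb_irr ρ hirr L v h v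
  exact ⟨a, h', hk a ha⟩

lemma mb_asAlg [Fintype G] (ρ : Representation k G V) (a : MonoidAlgebra k G) :
    ρ.asAlgebraHom a = ∑ g, a.coeff g • ρ g := by
  induction a using MonoidAlgebra.induction_linear with
  | zero => simp
  | add a b ha hb => rw [map_add, ha, hb, ← Finset.sum_add_distrib]; simp [add_smul]
  | single g r =>
    classical
    rw [Representation.asAlgebraHom_single, Finset.sum_eq_single g]
    · simp
    · intro b _ hb
      simp [Finsupp.single_eq_of_ne hb]
    · simp
end

instance mb_fin {k G : Type} [Field k] [Group G] (X : Rep k G) [FiniteDimensional k X] (M : ℕ) :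
    FiniteDimensional k (tensorPow X M) := by
  induction M with
  | zero => exact inferInstanceAs (FiniteDimensional k k)
  | succ M ih => exact inferInstanceAs (FiniteDimensional k (TensorProduct k (tensorPow X M) X))

lemma mb_std_apply (ℓ n : ℕ) (k : Type) [Field k] [CharP k ℓ]
    (g : Matrix.SpecialLinearGroup (Fin n) (ZMod ℓ)) (i j : Fin n) :
    stdSL ℓ n k g (Pi.single j 1) i = ZMod.castHom (dvd_refl ℓ) k (g.1 i j) := by
  simp [stdSL]

lemma mb_coeffs (ℓ n : ℕ) (k : Type) [Field k] [CharP k ℓ] (l : List (Fin n × Fin n)) :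
    ∃ (t : tensorPow (Rep.of (stdSL ℓ n k)) l.length)
      (f : Module.Dual k (tensorPow (Rep.of (stdSL ℓ n k)) l.length)), ∀ g,
      f ((tensorPow (Rep.of (stdSL ℓ n k)) l.length).ρ g t) =
        (l.map fun rc => (ZMod.castHom (dvd_refl ℓ) k (g.1 rc.1 rc.2))).prod := by
  induction l with
  | nil =>
    refine ⟨(1 : k), (LinearMap.id : k →ₗ[k] k), fun g => ?_⟩
    rfl
  | cons x l ih =>
    obtain ⟨t, f, h⟩ := ih
    refine ⟨TensorProduct.tmul k t (Pi.single x.2 1 : Fin n → k),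
      (LinearMap.mul' k k) ∘ₗ TensorProduct.map f (LinearMap.proj x.1), fun g => ?_⟩
    change (f ((tensorPow (Rep.of (stdSL ℓ n k)) l.length).ρ g t)) *
      (stdSL ℓ n k g (Pi.single x.2 1) x.1) = _
    rw [h, mb_std_apply, List.map_cons, List.prod_cons, mul_comm]

end

/-- modular Burnside for `SL_n`: every finite-dimensional
irreducible `k`-linear representation of `G = SL_n(𝔽_ℓ)` (with `char k = ℓ`) is
a composition factor of `Std^{⊗M}` for some `0 ≤ M ≤ ℓ·n(n−1)/2`: there are
`k[G]`-submodules `W' ⊆ W` of `(k^n)^{⊗M}` (i.e. `k`-submodules stable under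
the diagonal `G`-action) with `W/W'` isomorphic to `V` as a `k[G]`-module. -/
theorem modular_burnside_SL (ℓ : ℕ) (hℓ : ℓ.Prime) (k : Type) [Field k] [CharP k ℓ]
    (n : ℕ) (hn : 2 ≤ n)
    (V : Type) [AddCommGroup V] [Module k V] [FiniteDimensional k V] [Nontrivial V]
    (ρ : Representation k (Matrix.SpecialLinearGroup (Fin n) (ZMod ℓ)) V)
    (hirr : ∀ W : Submodule k V, (∀ g x, x ∈ W → ρ g x ∈ W) → W = ⊥ ∨ W = ⊤) :
    ∃ M, M ≤ ℓ * (n * (n - 1) / 2) ∧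
      ∃ (W' W : Submodule k ((tensorPow (Rep.of (stdSL ℓ n k)) M) : Type))
        (hW : ∀ g x, x ∈ W → (tensorPow (Rep.of (stdSL ℓ n k)) M).ρ g x ∈ W)
        (_ : ∀ g x, x ∈ W' → (tensorPow (Rep.of (stdSL ℓ n k)) M).ρ g x ∈ W')
        (_ : W' ≤ W)
        (e : (W ⧸ Submodule.comap W.subtype W') ≃ₗ[k] V),
        ∀ (g) (x : W),
          e (Submodule.Quotient.mk
              (⟨(tensorPow (Rep.of (stdSL ℓ n k)) M).ρ g x, hW g x x.2⟩ : W)) =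
            ρ g (e (Submodule.Quotient.mk x)) := by
  classical
  have : Fact ℓ.Prime := ⟨hℓ⟩
  by_contra hcon
  have hnot : ∀ M < ℓ * (n * (n - 1) / 2) + 1,
      ¬ mbFactor ρ (tensorPow (Rep.of (stdSL ℓ n k)) M).ρ :=
    fun M hM hf => hcon ⟨M, by omega, hf⟩
  obtain ⟨v, hv⟩ := exists_ne (0 : V)
  have hfd : FiniteDimensional k (Rep.of (stdSL ℓ n k)) :=
    inferInstanceAs (FiniteDimensional k (Fin n → k))
  obtain ⟨a, ha, hk⟩ := mb_ideal_all (tensorPow (Rep.of (stdSL ℓ n k))) ρ hirr v hv _ hnot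
  let K := AlgebraicClosure k
  have hK : CharP K ℓ := charP_of_injective_algebraMap (algebraMap k K).injective ℓ
  have hι : Function.Injective (Matrix.SpecialLinearGroup.toGL (n := Fin n) (R := ZMod ℓ)) := by
    intro x y hxy
    exact Subtype.ext (congrArg Units.val hxy)
  obtain ⟨S, _, _, _, σ, h, hne⟩ := mb_exists_rep (K := K) Matrix.SpecialLinearGroup.toGL hι ρ v hv
    (fun g => a.coeff g) (by
      rw [mb_asAlg, LinearMap.sum_apply] at ha
      simpa using ha)
  apply hne
  have hQ := mbQ_classfun (K := K) (fun A => LinearMap.trace K S (σ A)) (mb_trace_eq σ) h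
  have hall : ∀ φ ∈ mbQ ℓ n K (ℓ * (n * (n - 1) / 2)),
      ∑ g, algebraMap k K (a.coeff g) * φ g = 0 := by
    intro φ hφ
    induction hφ using Submodule.span_induction with
    | mem φ hφ =>
      obtain ⟨l, hl, rfl⟩ := hφ
      obtain ⟨t, f, hf⟩ := mb_coeffs ℓ n k l
      have h0 := hk l.length (by omega)
      rw [mb_asAlg] at h0
      have h1 := congrArg (fun u => f (u t)) h0
      simp only [LinearMap.sum_apply, LinearMap.smul_apply, map_sum, map_smul, hf, smul_eq_mul,
        LinearMap.zero_apply, map_zero] at h1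
      have h2 := congrArg (algebraMap k K) h1
      rw [map_zero, map_sum] at h2
      rw [← h2]
      refine Finset.sum_congr rfl fun g _ => ?_
      rw [map_mul, map_list_prod, List.map_map]
      refine congrArg _ (congrArg List.prod (List.map_congr_left fun rc _ => ?_))
      have hr : (algebraMap k K).comp (ZMod.castHom (dvd_refl ℓ) k) =
        ZMod.castHom (dvd_refl ℓ) K := Subsingleton.elim _ _
      exact (congrArg (fun r => r (g.1 rc.1 rc.2)) hr).symm
    | zero => simp
    | add x y _ _ hx hy => simp [mul_add, Finset.sum_add_distrib, hx, hy]
    | smul c x _ hx =>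
      have : ∀ g, algebraMap k K (a.coeff g) * (c • x) g = c * (algebraMap k K (a.coeff g) * x g) :=
        fun g => by rw [Pi.smul_apply, smul_eq_mul]; ring
      simp only [this, ← Finset.mul_sum, hx, mul_zero]
  exact hall _ hQ
end

section
/- Let ℓ be a prime, k a field of characteristic ℓ, g ≥ 1 an integer, and G = Sp_{2g}(𝔽_ℓ) the symplectic group of 2g × 2g matrices over 𝔽_ℓ. Let Std denote the representation of G on k^{2g} obtained from the inclusion Sp_{2g}(𝔽_ℓ) ⊆ GL_{2g}(k) (via the prime field 𝔽_ℓ ⊆ k). Then every finite-dimensional irreducible k-linear representation V of G is a composition factor of some tensor power Std^{⊗M} with 0 ≤ M ≤ ℓ·g(g+1)/2; that is, there exist k[G]-submodules W' ⊆ W of (k^{2g})^{⊗M} (with the diagonal G-action) such that W/W' is isomorphic to V as a k[G]-module. -/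
open CategoryTheory MonoidalCategory

/-- The standard representation of `Sp_{2g}(𝔽_ℓ)` on `k^{2g}`, for `k` a field of
characteristic `ℓ`, obtained from the inclusion `Sp_{2g}(𝔽_ℓ) ⊆ GL_{2g}(k)`
(the `2g` coordinates being indexed by `Fin g ⊕ Fin g`). -/
noncomputable def stdSp (ℓ g : ℕ) (k : Type) [Field k] [CharP k ℓ] :
    Representation k (Matrix.symplecticGroup (Fin g) (ZMod ℓ)) ((Fin g ⊕ Fin g) → k) :=
  ((Matrix.toLinAlgEquiv' (R := k) (n := Fin g ⊕ Fin g)).toAlgHom.toRingHom.toMonoidHom).comp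
    ((((ZMod.castHom (dvd_refl ℓ) k).mapMatrix
        (m := Fin g ⊕ Fin g)).toMonoidHom).comp
      (Matrix.symplecticGroup (Fin g) (ZMod ℓ)).subtype)


namespace SpB
open Matrix

section basics
variable {g : ℕ} {F : Type} [Field F]

abbrev Ix (g : ℕ) := Fin g ⊕ Fin g

def wt : Ix g → ℤ
  | Sum.inl i => (g : ℤ) - (i : ℕ)
  | Sum.inr i => ((i : ℕ) : ℤ) - g

def sg (F : Type) [Field F] : Ix g → F
  | Sum.inl _ => -1
  | Sum.inr _ => 1

@[simp] lemma wt_swap (a : Ix g) : wt a.swap = - wt a := by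
  cases a <;> simp [wt]

lemma wt_ne_zero (a : Ix g) : wt a ≠ 0 := by
  rcases a with i | i <;> simp only [wt] <;> have := i.2 <;> omega

lemma wt_inj {a b : Ix g} (h : wt a = wt b) : a = b := by
  rcases a with i | i <;> rcases b with j | j <;> simp only [wt] at h <;>
    have := i.2 <;> have := j.2
  · congr 1; ext; omega
  · omega
  · omega
  · congr 1; ext; omega

lemma wt_le (a : Ix g) : wt a ≤ g := by
  rcases a with i | i <;> simp only [wt] <;> have := i.2 <;> omega

lemma le_wt (a : Ix g) : -(g : ℤ) ≤ wt a := by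
  rcases a with i | i <;> simp only [wt] <;> have := i.2 <;> omega

@[simp] lemma sg_swap (a : Ix g) : sg F a.swap = - sg F a := by
  cases a <;> simp [sg]

@[simp] lemma sg_sq (a : Ix g) : sg F a * sg F a = 1 := by
  cases a <;> simp [sg]

lemma sg_ne (a : Ix g) : sg F a ≠ 0 := by
  cases a <;> simp [sg]

@[simp] lemma swap_ne (a : Ix g) : a.swap ≠ a := by
  cases a <;> simp

@[simp] lemma ne_swap (a : Ix g) : a ≠ a.swap := by
  cases a <;> simp

lemma swap_eq_iff {a b : Ix g} : a.swap = b ↔ a = b.swap := by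
  constructor
  · rintro rfl; simp
  · rintro rfl; simp

lemma J_app (a b : Ix g) : J (Fin g) F a b = if b = a.swap then sg F a else 0 := by
  rcases a with i | i <;> rcases b with j | j <;>
    simp [J, sg, Matrix.one_apply, eq_comm, apply_ite]

lemma mul_J_mul (A B : Matrix (Ix g) (Ix g) F) (a b : Ix g) :
    (A * J (Fin g) F * B) a b = ∑ c, A a c * sg F c * B c.swap b := by
  rw [Matrix.mul_assoc, Matrix.mul_apply]
  refine Finset.sum_congr rfl fun c _ => ?_
  rw [Matrix.mul_apply, mul_assoc]
  simp [J_app]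

lemma mem_sp_iff {A : Matrix (Ix g) (Ix g) F} : A ∈ symplecticGroup (Fin g) F ↔
    ∀ a b, ∑ c, A a c * sg F c * A b c.swap = if b = a.swap then sg F a else 0 := by
  rw [SymplecticGroup.mem_iff, ← Matrix.ext_iff]
  simp only [mul_J_mul, J_app, Matrix.transpose_apply]

lemma mem_sp_iff' {A : Matrix (Ix g) (Ix g) F} : A ∈ symplecticGroup (Fin g) F ↔
    ∀ a b, ∑ c, A c a * sg F c * A c.swap b = if b = a.swap then sg F a else 0 := by
  rw [SymplecticGroup.mem_iff', ← Matrix.ext_iff]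
  simp only [mul_J_mul, J_app, Matrix.transpose_apply]

abbrev Sp (g : ℕ) (F : Type) [Field F] := symplecticGroup (Fin g) F

lemma inv_app (A : Sp g F) (a b : Ix g) :
    (A⁻¹ : Sp g F).1 a b = sg F a * sg F b * A.1 b.swap a.swap := by
  rw [SymplecticGroup.coe_inv]
  have : (-J (Fin g) F * (A.1)ᵀ * J (Fin g) F) a b = - (J (Fin g) F * ((A.1)ᵀ * J (Fin g) F)) a b := by
    simp [Matrix.mul_assoc]
  rw [this, Matrix.mul_apply]
  simp only [J_app, Matrix.mul_apply, Matrix.transpose_apply]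
  simp only [ite_mul, zero_mul, Finset.sum_ite_eq', Finset.mem_univ, if_true, mul_ite, mul_zero]
  have : ∀ x : Ix g, (b = x.swap) = (x = b.swap) := fun x =>
    propext ⟨by rintro rfl; simp, by rintro rfl; simp⟩
  simp only [this, Finset.sum_ite_eq', Finset.mem_univ, if_true, sg_swap]
  ring

lemma mul_app (A B : Sp g F) (a b : Ix g) : (A * B).1 a b = ∑ c, A.1 a c * B.1 c b := by
  rw [← Matrix.mul_apply]; rfl

lemma one_app (a b : Ix g) : (1 : Sp g F).1 a b = if a = b then 1 else 0 := by
  simp [Matrix.one_apply]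

/-- unipotent triangular subgroups -/
def UU (g : ℕ) (F : Type) [Field F] (ε : ℤˣ) : Subgroup (Sp g F) where
  carrier := {A | ∀ a b, (ε : ℤ) * wt a ≤ ε * wt b → A.1 a b = if a = b then 1 else 0}
  mul_mem' := by
    intro A B hA hB a b hab
    rw [mul_app]
    rw [Finset.sum_eq_single a]
    · rw [hA a a le_rfl, hB a b hab]; simp
    · intro c _ hc
      by_cases h : (ε : ℤ) * wt a ≤ ε * wt c
      · rw [hA a c h, if_neg (Ne.symm hc), zero_mul]
      · rw [hB c b (by omega), if_neg, mul_zero]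
        rintro rfl; exact h hab
    · simp
  one_mem' := by
    intro a b _; exact one_app a b
  inv_mem' := by
    intro A hA a b hab
    rw [inv_app, hA b.swap a.swap (by simp only [wt_swap]; linarith)]
    by_cases h : a = b
    · subst h; simp
    · rw [if_neg h, if_neg, mul_zero]
      intro h'; exact h (Sum.swap_leftInverse.injective h').symm

lemma mem_UU {ε : ℤˣ} {A : Sp g F} : A ∈ UU g F ε ↔
    ∀ a b, (ε : ℤ) * wt a ≤ ε * wt b → A.1 a b = if a = b then 1 else 0 := Iff.rfl

lemma UU_pow (ε : ℤˣ) (A : Sp g F) (hA : A ∈ UU g F ε) (n : ℕ) (a b : Ix g)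
    (h : (ε : ℤ) * wt a < ε * wt b + n) : ((A.1 - 1) ^ n) a b = 0 := by
  induction n generalizing a with
  | zero =>
    simp only [pow_zero, Matrix.one_apply]
    rw [if_neg]; rintro rfl; simp at h
  | succ n ih =>
    rw [pow_succ', Matrix.mul_apply]
    refine Finset.sum_eq_zero fun c _ => ?_
    by_cases hc : (ε : ℤ) * wt a ≤ ε * wt c
    · simp [hA a c hc, Matrix.one_apply]
    · rw [ih, mul_zero]; push_cast at h; omega

lemma UU_isPGroup (p : ℕ) [Fact p.Prime] [CharP F p] (ε : ℤˣ) : IsPGroup p (UU g F ε) := by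
  rintro ⟨A, hA⟩
  obtain ⟨m, hm⟩ : ∃ m, 2 * g + 1 ≤ p ^ m :=
    ⟨2 * g + 1, (Nat.lt_pow_self (Fact.out (p := p.Prime)).one_lt).le⟩
  refine ⟨m, ?_⟩
  have h0 : (A.1 - 1) ^ (p ^ m) = 0 := by
    have : (A.1 - 1) ^ (2 * g + 1) = 0 := by
      ext a b
      refine UU_pow ε A hA _ a b ?_
      have h1 := wt_le a; have h2 := wt_le b; have h3 := le_wt a; have h4 := le_wt b
      rcases Int.units_eq_one_or ε with rfl | rfl <;> push_cast <;> omega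
    rw [← Nat.sub_add_cancel hm, pow_add, this, mul_zero]
  rcases isEmpty_or_nonempty (Fin g) with hE | hE
  · ext a; exact (IsEmpty.false a).elim
  have : CharP (Matrix (Ix g) (Ix g) F) p := Matrix.charP p
  have h1 := sub_pow_char_pow_of_commute (p := p) (n := m) (Commute.one_right A.1)
  rw [h0, one_pow] at h1
  apply Subtype.ext; apply Subtype.ext
  simpa using (sub_eq_zero.mp h1.symm)

end basics
end SpB


namespace SpB
open Matrix

section bruhat
variable {g : ℕ} {F : Type} [Field F]

lemma form_self (w : Ix g → F) : ∑ x, w x * sg F x * w x.swap = 0 := by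
  rw [Fintype.sum_sum_type, ← Finset.sum_add_distrib]
  refine Finset.sum_eq_zero fun i _ => ?_
  simp [sg]; ring

lemma form_antisymm (w v : Ix g → F) :
    ∑ x, w x * sg F x * v x.swap = - ∑ x, v x * sg F x * w x.swap := by
  rw [Fintype.sum_sum_type, Fintype.sum_sum_type]
  simp only [sg, Sum.swap_inl, Sum.swap_inr]
  rw [neg_add, ← Finset.sum_neg_distrib, ← Finset.sum_neg_distrib, add_comm]
  congr 1 <;> refine Finset.sum_congr rfl fun i _ => by ring

/-- Eichler transformation sending `e_b` to `w` (`w b = 1`). -/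
def Sm (b : Ix g) (w : Ix g → F) : Matrix (Ix g) (Ix g) F := fun a c =>
  if c = b then w a
  else (if a = c then 1 else 0) +
    (if a = b.swap then (if c = b.swap then 0 else sg F b * sg F c * w c.swap) else 0)

lemma Sm_mem (b : Ix g) (w : Ix g → F) (hw : w b = 1) : Sm b w ∈ symplecticGroup (Fin g) F := by
  rw [mem_sp_iff']
  -- pairing of w against column c ≠ b
  have key : ∀ c, c ≠ b → ∀ v : Ix g → F,
      ∑ x, v x * sg F x * Sm b w x.swap c =
        - sg F c * v c.swap + (if c = b.swap then 0 else sg F c * w c.swap * v b) := by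
    intro c hc v
    have e1 : ∀ x : Ix g, (x.swap = c) = (x = c.swap) := fun x => propext swap_eq_iff
    have e2 : ∀ x : Ix g, (x.swap = b.swap) = (x = b) := fun x =>
      propext ⟨fun h => Sum.swap_leftInverse.injective h, by rintro rfl; rfl⟩
    simp only [Sm, if_neg hc, mul_add, Finset.sum_add_distrib, e1, e2, mul_ite, mul_one, mul_zero,
      Finset.sum_ite_eq', Finset.mem_univ, if_true, sg_swap]
    congr 1
    · ring
    · split_ifs
      · rfl
      · linear_combination (sg F c * w c.swap * v b) * sg_sq (F := F) b
  have hcol : ∀ x, Sm b w x b = w x := fun x => by simp [Sm]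
  have keyb : ∀ c, c ≠ b → ∑ x, w x * sg F x * Sm b w x.swap c =
      if c = b.swap then sg F b else 0 := by
    intro c hc
    rw [key c hc, hw]
    split_ifs with h
    · subst h; simp [hw]
    · ring
  intro a c
  by_cases hc : c = b
  · subst hc
    by_cases ha : a = c
    · subst ha
      simp only [hcol, form_self]; simp
    · simp only [hcol]
      rw [form_antisymm, keyb a ha]
      by_cases h : a = c.swap
      · subst h; simp
      · rw [if_neg h, if_neg]; · simp
        rintro rfl; simp at h
  · by_cases ha : a = b
    · subst ha
      simp only [hcol]; rw [keyb c hc]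
    · rw [key c hc]
      simp only [Sm, if_neg ha]
      have hb : (b : Ix g) ≠ a := fun h => ha h.symm
      simp only [if_neg hb, ne_swap, if_false]
      by_cases hcb : c = b.swap
      · subst hcb
        simp only [Sum.swap_swap, if_neg hb, ne_swap, if_false, if_true]
        rw [if_neg]; · simp
        intro h; exact hb (Sum.swap_leftInverse.injective h)
      · have h1 : c.swap ≠ b.swap := fun h => hc (Sum.swap_leftInverse.injective h)
        simp only [if_neg h1, if_neg hcb]
        by_cases hca : c = a.swap
        · subst hca; simp
        · have : c.swap ≠ a := by rintro rfl; simp at hca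
          simp [this, hca]

/-- topmost clearing -/
lemma exists_clear (w : Ix g → F) (b : Ix g) (hb : w b ≠ 0) (htop : ∀ a, wt b < wt a → w a = 0) :
    ∃ u : Sp g F, u ∈ UU g F (-1) ∧ (∀ a, ∑ c, u.1 a c * w c = if a = b then w b else 0) ∧
      (∀ c, u.1 b c = if b = c then 1 else 0) ∧
      (∀ a, a ≠ b → a ≠ b.swap → w a.swap = 0 → w a = 0 →
        (∀ c, u.1 a c = if a = c then 1 else 0) ∧ (∀ c, u.1 c a = if c = a then 1 else 0)) := by
  set w' : Ix g → F := fun a => (w b)⁻¹ * w a with hw'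
  have hwb : w' b = 1 := by simp [hw', hb]
  let S : Sp g F := ⟨Sm b w', Sm_mem b w' hwb⟩
  have hS : ∀ a c, S.1 a c = Sm b w' a c := fun _ _ => rfl
  have hz : ∀ a, w a = 0 → w' a = 0 := fun a h => by simp [hw', h]
  have hrowb : ∀ c, S.1 b c = if b = c then 1 else 0 := by
    intro c
    rw [hS, Sm]
    by_cases h : c = b
    · subst h; simp [hwb]
    · simp [h]
  have htriv : ∀ a, a ≠ b → a ≠ b.swap → w a.swap = 0 → w a = 0 →
        (∀ c, S.1 a c = if a = c then 1 else 0) ∧ (∀ c, S.1 c a = if c = a then 1 else 0) := by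
    intro a h1 h2 h3 h4
    refine ⟨fun c => ?_, fun c => ?_⟩
    · rw [hS, Sm]
      by_cases h : c = b
      · subst h; simp [hz _ h4, h1]
      · simp [h, h2]
    · rw [hS, Sm]; simp [h1, h2, hz _ h3]
  have hSU : S ∈ UU g F (-1) := by
    intro a c hac
    push_cast at hac
    rw [hS, Sm]
    by_cases h : c = b
    · subst h
      by_cases h' : a = c
      · subst h'; simp [hwb]
      · have : wt a ≠ wt c := fun e => h' (wt_inj e)
        simp [h', hz _ (htop a (by omega))]
    · rw [if_neg h]
      by_cases h' : a = b.swap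
      · rw [if_pos h']
        split_ifs with h3 h4 h4
        · simp
        · exact absurd (h3.symm.trans h') h4
        · simp
        · have := (wt_inj (a := c) (b := b.swap)).mt h4
          rw [h'] at hac
          simp at hac this
          rw [hz, mul_zero, zero_add]
          apply htop; simp; omega
      · simp [h']
  have hSw : ∀ a, ∑ c, (S⁻¹).1 a c * w c = if a = b then w b else 0 := by
    intro a
    have h1 : ∀ c, w c = w b * S.1 c b := by
      intro c; rw [hS, Sm]; simp [hw', hb]
    calc ∑ c, (S⁻¹).1 a c * w c = w b * ∑ c, (S⁻¹).1 a c * S.1 c b := by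
          rw [Finset.mul_sum]; refine Finset.sum_congr rfl fun c _ => ?_
          rw [h1 c]; ring
      _ = w b * (S⁻¹ * S).1 a b := by rw [mul_app]
      _ = _ := by rw [inv_mul_cancel, one_app]; simp
  have rowinv : ∀ (A : Sp g F) a, (∀ c, A.1 a c = if a = c then 1 else 0) →
      ∀ c, (A⁻¹).1 a c = if a = c then 1 else 0 := by
    intro A a h c
    rw [← one_app (F := F), ← mul_inv_cancel A, mul_app]
    simp [h]
  have colinv : ∀ (A : Sp g F) a, (∀ c, A.1 c a = if c = a then 1 else 0) →
      ∀ c, (A⁻¹).1 c a = if c = a then 1 else 0 := by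
    intro A a h c
    rw [← one_app (F := F), ← inv_mul_cancel A, mul_app]
    simp [h]
  exact ⟨S⁻¹, inv_mem hSU, hSw, rowinv S b hrowb, fun a h1 h2 h3 h4 =>
    ⟨rowinv S a (htriv a h1 h2 h3 h4).1, colinv S a (htriv a h1 h2 h3 h4).2⟩⟩

def Clean (A : Matrix (Ix g) (Ix g) F) (a c : Ix g) : Prop :=
  A a c ≠ 0 ∧ (∀ x, x ≠ a → A x c = 0) ∧ (∀ y, y ≠ c → A a y = 0)

lemma Clean.swap {A : Sp g F} {a c : Ix g} (h : Clean A.1 a c) : Clean A.1 a.swap c.swap := by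
  obtain ⟨h0, h1, h2⟩ := h
  have k1 : ∀ y, A.1 a c * sg F a * A.1 a.swap y = if y = c.swap then sg F c else 0 := by
    intro y
    rw [← mem_sp_iff'.1 A.2 c y, Finset.sum_eq_single a]
    · intro x _ hx; simp [h1 x hx]
    · simp
  have k2 : ∀ y, A.1 a c * sg F c * A.1 y c.swap = if y = a.swap then sg F a else 0 := by
    intro y
    rw [← mem_sp_iff.1 A.2 a y, Finset.sum_eq_single c]
    · intro x _ hx; simp [h2 x hx]
    · simp
  refine ⟨?_, ?_, ?_⟩
  · intro h; have := k1 c.swap; rw [h] at this; simp at this; exact sg_ne c this.symm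
  · intro x hx; have := k2 x; rw [if_neg hx] at this; simpa [h0, sg_ne] using this
  · intro x hx; have := k1 x; rw [if_neg hx] at this; simpa [h0, sg_ne] using this

lemma exists_top (w : Ix g → F) (h : w ≠ 0) : ∃ b, w b ≠ 0 ∧ ∀ a, wt b < wt a → w a = 0 := by
  classical
  obtain ⟨c, hc⟩ := Function.ne_iff.mp h
  obtain ⟨b, hb, hmax⟩ := Finset.exists_max_image (Finset.univ.filter fun a => w a ≠ 0) wt
    ⟨c, by simpa using hc⟩
  refine ⟨b, by simpa using hb, fun a ha => ?_⟩
  by_contra h'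
  have := hmax a (by simpa using h')
  omega

lemma col_ne_zero (A : Sp g F) (b : Ix g) : (fun a => A.1 a b) ≠ 0 := by
  intro h
  have := one_app (F := F) b b
  rw [← inv_mul_cancel A, mul_app] at this
  have h' : ∀ c, A.1 c b = 0 := fun c => congrFun h c
  simp [h'] at this

def trSp (A : Sp g F) : Sp g F := ⟨A.1ᵀ, SymplecticGroup.transpose_mem A.2⟩

lemma trSp_mem {ε : ℤˣ} {A : Sp g F} (h : A ∈ UU g F ε) : trSp A ∈ UU g F (-ε) := by
  intro a b hab
  have := h b a (by push_cast at hab; linarith)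
  simp only [trSp, Matrix.transpose_apply, this, eq_comm]

lemma bruhat_aux (A : Sp g F) (j : ℕ) (hj : j ≤ g) : ∃ u ∈ UU g F (-1), ∃ v ∈ UU g F 1,
    ∀ i : Fin g, (i : ℕ) < j → ∃ a, Clean (u * A * v).1 a (Sum.inl i) := by
  induction j with
  | zero => exact ⟨1, one_mem _, 1, one_mem _, fun i h => absurd h (by simp)⟩
  | succ j ih =>
    obtain ⟨u, hu, v, hv, hcl⟩ := ih (by omega)
    set B := u * A * v with hB
    let c : Ix g := Sum.inl ⟨j, hj⟩
    obtain ⟨b, hb, htop⟩ := exists_top _ (col_ne_zero B c)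
    -- cleaned columns
    have hclean0 : ∀ i : Fin g, (i : ℕ) < j → ∀ a, Clean B.1 a (Sum.inl i) →
        B.1 a c = 0 ∧ B.1 a.swap c = 0 := by
      intro i hi a ha
      refine ⟨ha.2.2 c ?_, ha.swap.2.2 c ?_⟩
      · intro h; have := Sum.inl.inj h; simp [← this] at hi
      · simp [c]
    obtain ⟨u', hu', h1, h2, h3⟩ := exists_clear (fun a => B.1 a c) b hb htop
    have hfix : ∀ i : Fin g, (i : ℕ) < j → ∀ a, Clean B.1 a (Sum.inl i) →
        Clean (u' * B).1 a (Sum.inl i) := by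
      intro i hi a ha
      obtain ⟨z1, z2⟩ := hclean0 i hi a ha
      obtain ⟨r1, r2⟩ := h3 a (by rintro rfl; exact hb z1)
        (by rintro rfl; simp at z2; exact hb z2) z2 z1
      refine ⟨?_, ?_, ?_⟩
      · rw [mul_app]; simpa [r1] using ha.1
      · intro x hx; rw [mul_app, Finset.sum_eq_single a]
        · simp [r2, hx]
        · intro y _ hy; rw [ha.2.1 y hy, mul_zero]
        · simp
      · intro y hy; rw [mul_app]; simpa [r1] using ha.2.2 y hy
    set C := u' * B with hC
    have hCc : ∀ a, C.1 a c = if a = b then B.1 b c else 0 := by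
      intro a; rw [hC, mul_app]; exact h1 a
    have hrow0 : ∀ i : Fin g, (i : ℕ) < j → C.1 b (Sum.inl i) = 0 ∧ C.1 b (Sum.inr i) = 0 := by
      intro i hi
      obtain ⟨a, ha⟩ := hcl i hi
      have hne : a ≠ b := by rintro rfl; exact hb (hclean0 i hi _ ha).1
      have hne' : a.swap ≠ b := by rintro rfl; exact hb (hclean0 i hi _ ha).2
      have := hfix i hi a ha
      exact ⟨this.2.1 b hne.symm, this.swap.2.1 b hne'.symm⟩
    obtain ⟨v', hv', k1, k2, k3⟩ := exists_clear (fun a => C.1 b a) c (by simp [hCc, hb]) (by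
      intro a ha
      rcases a with i | i
      · apply (hrow0 i _).1; simp only [c, wt] at ha; omega
      · simp only [c, wt] at ha; omega)
    have hD : ∀ x y, (C * trSp v').1 x y = ∑ z, C.1 x z * v'.1 y z := by
      intro x y; rw [mul_app]; rfl
    refine ⟨u' * u, mul_mem hu' hu, v * trSp v', mul_mem hv (by simpa using trSp_mem hv'), ?_⟩
    have : u' * u * A * (v * trSp v') = C * trSp v' := by
      rw [hC, hB]; simp only [mul_assoc]
    rw [this]
    intro i hi
    by_cases hij : (i : ℕ) = j
    · have hic : (Sum.inl i : Ix g) = c := by simp only [c]; congr 1; ext; exact hij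
      rw [hic]
      refine ⟨b, ?_, ?_, ?_⟩
      · rw [hD]; simpa [k2, hCc] using hb
      · intro x hx; rw [hD]; simp [k2, hCc, hx]
      · intro y hy; rw [hD]
        have := k1 y
        rw [if_neg hy] at this
        rw [← this]; exact Finset.sum_congr rfl fun _ _ => mul_comm _ _
    · have hi' : (i : ℕ) < j := by omega
      obtain ⟨a, ha⟩ := hcl i hi'
      have hne : a ≠ b := by rintro rfl; exact hb (hclean0 i hi' _ ha).1
      have hc := hfix i hi' a ha
      obtain ⟨r1, r2⟩ := k3 (Sum.inl i) (by intro h; apply hij; simp [Sum.inl.inj h]) (by simp [c])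
        (hrow0 i hi').2 (hrow0 i hi').1
      refine ⟨a, ?_, ?_, ?_⟩
      · rw [hD]; simpa [r1] using hc.1
      · intro x hx; rw [hD]; simpa [r1] using hc.2.1 x hx
      · intro y hy; rw [hD, Finset.sum_eq_single (Sum.inl i)]
        · simp [r2, hy]
        · intro z _ hz; rw [hc.2.2 z hz, zero_mul]
        · simp

def Mono (σ : Equiv.Perm (Ix g)) (A : Sp g F) : Prop := ∀ a b, A.1 a b ≠ 0 ↔ a = σ b

lemma bruhat (A : Sp g F) : ∃ u ∈ UU g F (-1), ∃ v ∈ UU g F 1, ∃ n : Sp g F, (∃ σ, Mono σ n) ∧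
    A = u * n * v := by
  obtain ⟨u, hu, v, hv, h⟩ := bruhat_aux A g le_rfl
  refine ⟨u⁻¹, inv_mem hu, v⁻¹, inv_mem hv, u * A * v, ?_, by group⟩
  have h' : ∀ c : Ix g, ∃ a, Clean (u * A * v).1 a c := by
    rintro (i | i)
    · exact h i i.2
    · obtain ⟨a, ha⟩ := h i i.2
      exact ⟨a.swap, ha.swap⟩
  choose f hf using h'
  have hinj : Function.Injective f := by
    intro x y hxy
    by_contra hne
    have := (hf x).2.2 y (Ne.symm hne)
    rw [hxy] at this
    exact (hf y).1 this
  refine ⟨Equiv.ofBijective f (Finite.injective_iff_bijective.mp hinj), fun a b => ⟨fun hab => ?_, ?_⟩⟩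
  · by_contra hne
    exact hab ((hf b).2.1 a hne)
  · rintro rfl; exact (hf b).1

end bruhat
end SpB


namespace SpB
open Matrix

section roots
variable {g : ℕ} {F : Type} [Field F]

def pp (i : Fin g) : Ix g := Sum.inl i
def qq (i : Fin g) : Ix g := if h : (i : ℕ) + 1 < g then Sum.inl ⟨i + 1, h⟩ else Sum.inr i

lemma pq_wt (i : Fin g) : (wt (qq i) = wt (pp i) - 1 ∧ 1 ≤ wt (qq i)) ∨
    (wt (qq i) = -1 ∧ wt (pp i) = 1) := by
  unfold qq pp
  have := i.2
  split_ifs with h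
  · left; simp only [wt]; push_cast; omega
  · right; simp only [wt]; omega

lemma pq_ne (i : Fin g) : pp i ≠ qq i := by
  intro h
  have := pq_wt i
  rw [h] at this; omega

lemma swap_inj {a b : Ix g} : a.swap = b.swap ↔ a = b :=
  Sum.swap_leftInverse.injective.eq_iff

lemma pq_between (i : Fin g) (c : Ix g) (h1 : wt (qq i) ≤ wt c) (h2 : wt c ≤ wt (pp i)) :
    c = pp i ∨ c = qq i := by
  have h0 := wt_ne_zero c
  by_cases h : wt c = wt (pp i)
  · exact Or.inl (wt_inj h)
  · right; apply wt_inj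
    rcases pq_wt i with h3 | h3 <;> omega

/-- embedding of 2x2 matrices at the simple root `i` -/
def io (i : Fin g) (a b c d : F) : Matrix (Ix g) (Ix g) F := fun u v =>
  if v = pp i then (if u = pp i then a else if u = qq i then c else 0)
  else if v = qq i then (if u = pp i then b else if u = qq i then d else 0)
  else if v = (qq i).swap then
    (if u = (qq i).swap then a else if u = (pp i).swap then -c else 0)
  else if v = (pp i).swap then
    (if u = (qq i).swap then -b else if u = (pp i).swap then d else 0)
  else if u = v then 1 else 0

lemma sum_two (f : Ix g → F) (p q : Ix g) (h : p ≠ q) (a c : F) :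
    ∑ w, f w * (if w = p then a else if w = q then c else 0) = f p * a + f q * c := by
  rw [← Finset.sum_subset (Finset.subset_univ {p, q}), Finset.sum_pair h]
  · simp [h.symm]
  · intro x _ hx
    simp at hx
    simp [hx.1, hx.2]

lemma io_mul (i : Fin g) (a b c d a' b' c' d' : F) :
    io i a b c d * io i a' b' c' d' =
      io i (a * a' + b * c') (a * b' + b * d') (c * a' + d * c') (c * b' + d * d') := by
  have hpq := pq_ne i
  have hqp := hpq.symm
  ext u v
  rw [Matrix.mul_apply]
  by_cases h1 : v = pp i
  · simp only [io, h1, if_true]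
    rw [sum_two _ _ _ hpq]
    simp only [if_true, if_neg hqp]
    split_ifs <;> ring
  by_cases h2 : v = qq i
  · simp only [io, h2, if_true, if_neg hqp]
    rw [sum_two _ _ _ hpq]
    simp only [if_true, if_neg hqp]
    split_ifs <;> ring
  by_cases h3 : v = (qq i).swap
  · have hs1 : (qq i).swap ≠ pp i := fun h => h1 (h3.trans h)
    have hs2 : (pp i).swap ≠ qq i := fun h => hs1 (by rw [← h]; simp)
    have hs3 : (pp i).swap ≠ (qq i).swap := fun h => hpq (swap_inj.mp h)
    simp only [io, h3, if_true, if_neg hs1, swap_ne, if_false]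
    rw [sum_two _ _ _ hs3.symm]
    simp only [if_neg hs1, if_neg hs2, if_neg hs3, swap_ne, if_false, if_true]
    split_ifs <;> ring
  by_cases h4 : v = (pp i).swap
  · have hs2 : (pp i).swap ≠ qq i := fun h => h2 (h4.trans h)
    have hs1 : (qq i).swap ≠ pp i := fun h => hs2 (by rw [← h]; simp)
    have hs3 : (pp i).swap ≠ (qq i).swap := fun h => hpq (swap_inj.mp h)
    simp only [io, h4, if_true, if_neg hs2, if_neg hs3, swap_ne, if_false]
    rw [sum_two _ _ _ hs3.symm]
    simp only [if_neg hs1, if_neg hs2, if_neg hs3, swap_ne, if_false, if_true]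
    split_ifs <;> ring
  · simp only [io, h1, h2, h3, h4, if_false, mul_ite, mul_one, mul_zero, Finset.sum_ite_eq',
      Finset.mem_univ, if_true]

lemma io_transpose (i : Fin g) (a b c d : F) : (io i a b c d)ᵀ = io i a c b d := by
  have hpq := pq_ne i
  have hqp := hpq.symm
  have hs3 : (pp i).swap ≠ (qq i).swap := fun h => hpq (swap_inj.mp h)
  ext u v
  rw [Matrix.transpose_apply]
  by_cases hl : (qq i).swap = pp i
  · have hl' : (pp i).swap = qq i := by rw [← hl]; simp
    simp only [io, hl, hl']
    by_cases h1 : v = pp i <;> by_cases h2 : v = qq i <;> by_cases h3 : u = pp i <;>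
      by_cases h4 : u = qq i <;> simp_all [eq_comm]
  · have hl' : (pp i).swap ≠ qq i := fun h => hl (by rw [← h]; simp)
    have A : ∀ w : Ix g, w = pp i ∨ w = qq i ∨ w = (qq i).swap ∨ w = (pp i).swap ∨
        (w ≠ pp i ∧ w ≠ qq i ∧ w ≠ (qq i).swap ∧ w ≠ (pp i).swap) := fun w => by tauto
    have e1 := hl'.symm
    have e2 : pp i ≠ (qq i).swap := fun h => hl h.symm
    have e3 := hs3.symm
    rcases A u with h | h | h | h | ⟨h, h', h'', h'''⟩ <;>
      rcases A v with k | k | k | k | ⟨k, k', k'', k'''⟩ <;>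
      simp only [io, *, if_true, if_false, swap_ne, ne_swap] <;> simp_all [eq_comm]

lemma io_one (i : Fin g) : io i (1 : F) 0 0 1 = 1 := by
  ext u v
  simp only [io, Matrix.one_apply]
  split_ifs <;> simp_all

lemma io_x_mem (i : Fin g) (t : F) : io i 1 t 0 1 ∈ symplecticGroup (Fin g) F := by
  have hpq := pq_ne i
  have hqp := hpq.symm
  have hs3 : (pp i).swap ≠ (qq i).swap := fun h => hpq (swap_inj.mp h)
  have e3 := hs3.symm
  have : io i 1 t 0 1 = Sm (qq i) (fun u => if u = pp i then t else if u = qq i then 1 else 0) := by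
    have es : ∀ (x y : Ix g), (x.swap = y) = (x = y.swap) := fun x y => propext swap_eq_iff
    by_cases hl : (qq i).swap = pp i
    · have hl' : (pp i).swap = qq i := by rw [← hl]; simp
      ext u v
      simp only [io, Sm, es, hl, hl']
      by_cases h1 : v = pp i <;> by_cases h2 : v = qq i <;> by_cases h3 : u = pp i <;>
        by_cases h4 : u = qq i <;> simp_all
    · have hl' : (pp i).swap ≠ qq i := fun h => hl (by rw [← h]; simp)
      have hsg : sg F (qq i) = sg F (pp i) := by
        unfold qq pp at *
        split_ifs at * with h
        · rfl
        · simp at hl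
      have A : ∀ w : Ix g, w = pp i ∨ w = qq i ∨ w = (qq i).swap ∨ w = (pp i).swap ∨
        (w ≠ pp i ∧ w ≠ qq i ∧ w ≠ (qq i).swap ∧ w ≠ (pp i).swap) := fun w => by tauto
      have e1 := hl'.symm
      have e2 : pp i ≠ (qq i).swap := fun h => hl h.symm
      ext u v
      rcases A u with h | h | h | h | ⟨h, h', h'', h'''⟩ <;>
      rcases A v with k | k | k | k | ⟨k, k', k'', k'''⟩ <;>
      simp only [io, Sm, *, if_true, if_false, ne_swap] <;> simp_all [eq_comm]
  rw [this]
  exact Sm_mem _ _ (by simp [hqp])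

def xr (i : Fin g) (t : F) : Sp g F := ⟨io i 1 t 0 1, io_x_mem i t⟩
def yr (i : Fin g) (t : F) : Sp g F := ⟨io i 1 0 t 1, by
  rw [← io_transpose]; exact SymplecticGroup.transpose_mem (io_x_mem i t)⟩
def sr (F : Type) [Field F] (i : Fin g) : Sp g F := xr i 1 * yr i (-1) * xr i 1
def hr (i : Fin g) (t : F) : Sp g F := yr i (-(-t)⁻¹) * xr i (-t) * sr F i * xr i ((-t)⁻¹)

lemma sr_coe (i : Fin g) : (sr F i).1 = io i 0 1 (-1) 0 := by
  show io i 1 1 0 1 * io i 1 0 (-1) 1 * io i 1 1 0 1 = _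
  rw [io_mul, io_mul]; simp

lemma hr_coe (i : Fin g) (t : F) (ht : t ≠ 0) : (hr i t).1 = io i t 0 0 t⁻¹ := by
  show io i 1 0 (-(-t)⁻¹) 1 * io i 1 (-t) 0 1 * (sr F i).1 * io i 1 ((-t)⁻¹) 0 1 = _
  rw [sr_coe, io_mul, io_mul, io_mul]
  congr 1 <;> field_simp <;> ring

lemma xr_mul (i : Fin g) (t r : F) : xr i t * xr i r = xr i (t + r) := by
  apply Subtype.ext
  show io i 1 t 0 1 * io i 1 r 0 1 = io i 1 (t + r) 0 1
  rw [io_mul]; simp [add_comm]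

lemma xr_zero (i : Fin g) : xr i (0 : F) = 1 := Subtype.ext (io_one i)

lemma yr_mul (i : Fin g) (t r : F) : yr i t * yr i r = yr i (t + r) := by
  apply Subtype.ext
  show io i 1 0 t 1 * io i 1 0 r 1 = io i 1 0 (t + r) 1
  rw [io_mul]; simp

lemma yr_zero (i : Fin g) : yr i (0 : F) = 1 := Subtype.ext (io_one i)

lemma rank_one (i : Fin g) (t : F) :
    xr i t * sr F i = yr i t⁻¹ * hr i (-t) * xr i (-t⁻¹) := by
  unfold hr
  have h1 : yr i t⁻¹ * yr i (-(- -t)⁻¹) = 1 := by rw [yr_mul, neg_neg]; simp [yr_zero]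
  have h2 : xr i ((- -t)⁻¹) * xr i (-t⁻¹) = 1 := by rw [xr_mul, neg_neg]; simp [xr_zero]
  calc xr i t * sr F i = xr i (- -t) * sr F i := by rw [neg_neg]
    _ = (yr i t⁻¹ * yr i (-(- -t)⁻¹)) * xr i (- -t) * sr F i * (xr i ((- -t)⁻¹) * xr i (-t⁻¹)) := by
      rw [h1, h2]; simp
    _ = _ := by simp only [mul_assoc]

lemma xr_ne (i : Fin g) (t : F) (a b : Ix g) (hab : a ≠ b) (h : (xr i t).1 a b ≠ 0) :
    (a = pp i ∧ b = qq i) ∨ (a = (qq i).swap ∧ b = (pp i).swap) := by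
  have : io i 1 t 0 1 a b ≠ 0 := h
  unfold io at this
  split_ifs at this <;> simp_all

lemma xr_diag (i : Fin g) (t : F) (a : Ix g) : (xr i t).1 a a = 1 := by
  show io i 1 t 0 1 a a = 1
  unfold io
  have hpq := pq_ne i
  split_ifs <;> simp_all

lemma xr_pq (i : Fin g) (t : F) : (xr i t).1 (pp i) (qq i) = t := by
  show io i 1 t 0 1 _ _ = t
  unfold io
  rw [if_neg (pq_ne i).symm]; simp

lemma yr_app (i : Fin g) (t : F) (a b : Ix g) : (yr i t).1 a b = (xr i t).1 b a := by
  show io i 1 0 t 1 a b = io i 1 t 0 1 b a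
  rw [← io_transpose]; rfl

lemma xr_mem (i : Fin g) (t : F) : xr i t ∈ UU g F 1 := by
  intro a b hab
  by_cases h : a = b
  · subst h; simp [xr_diag]
  · rw [if_neg h]; by_contra h'
    have := pq_wt i
    rcases xr_ne i t a b h h' with ⟨rfl, rfl⟩ | ⟨rfl, rfl⟩ <;> simp at hab <;> omega

lemma yr_mem (i : Fin g) (t : F) : yr i t ∈ UU g F (-1) := by
  intro a b hab
  rw [yr_app, xr_mem i t b a (by push_cast at hab; simp; linarith)]
  simp [eq_comm]

def pif (i : Fin g) (b : Ix g) : Ix g :=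
  if b = pp i then qq i else if b = qq i then pp i else if b = (qq i).swap then (pp i).swap
  else if b = (pp i).swap then (qq i).swap else b

lemma pif_invol (i : Fin g) : Function.Involutive (pif i) := by
  intro b
  have hpq := pq_ne i
  have hqp := hpq.symm
  have hs3 : (pp i).swap ≠ (qq i).swap := fun h => hpq (swap_inj.mp h)
  by_cases h1 : b = pp i
  · subst h1; simp [pif]
  by_cases h2 : b = qq i
  · subst h2; simp [pif]
  by_cases h3 : b = (qq i).swap
  · have hs1 : (qq i).swap ≠ pp i := fun h => h1 (h3.trans h)
    have hs2 : (pp i).swap ≠ qq i := fun h => hs1 (by rw [← h]; simp)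
    rw [h3]; simp [pif, hs1, hs2, hs3]
  by_cases h4 : b = (pp i).swap
  · have hs2 : (pp i).swap ≠ qq i := fun h => h2 (h4.trans h)
    have hs1 : (qq i).swap ≠ pp i := fun h => hs2 (by rw [← h]; simp)
    rw [h4]; simp [pif, hs1, hs2, hs3]
  simp [pif, h1, h2, h3, h4]

def pie (i : Fin g) : Equiv.Perm (Ix g) := (pif_invol i).toPerm

lemma pie_p (i : Fin g) : pie i (pp i) = qq i := by
  show pif i _ = _
  simp [pif]

lemma pie_q (i : Fin g) : pie i (qq i) = pp i := by
  show pif i _ = _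
  simp [pif]

lemma pie_pie (i : Fin g) (b : Ix g) : pie i (pie i b) = b := pif_invol i b

lemma sr_mono (i : Fin g) : Mono (pie i) (sr F i) := by
  intro a b
  rw [sr_coe]
  show _ ↔ a = pif i b
  unfold io pif
  have hpq := pq_ne i
  have hqp := hpq.symm
  have hs3 : (pp i).swap ≠ (qq i).swap := fun h => hpq (swap_inj.mp h)
  have hs4 := hs3.symm
  split_ifs <;> simp_all

lemma hr_app (i : Fin g) (t : F) (ht : t ≠ 0) (a b : Ix g) : (hr i t).1 a b =
    if a = b then (if a = pp i then t else if a = qq i then t⁻¹ else if a = (qq i).swap then t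
      else if a = (pp i).swap then t⁻¹ else 1) else 0 := by
  rw [hr_coe i t ht]
  unfold io
  have hpq := pq_ne i
  have hqp := hpq.symm
  split_ifs <;> simp_all

end roots
end SpB


namespace SpB
open Matrix

section conj
variable {g : ℕ} {F : Type} [Field F]

lemma Mono.clean {σ : Equiv.Perm (Ix g)} {n : Sp g F} (h : Mono σ n) (b : Ix g) :
    Clean n.1 (σ b) b := by
  refine ⟨(h _ _).2 rfl, fun x hx => ?_, fun y hy => ?_⟩
  · by_contra h'; exact hx ((h _ _).1 h')
  · by_contra h'; exact hy (σ.injective ((h _ _).1 h')).symm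

lemma Mono.swap {σ : Equiv.Perm (Ix g)} {n : Sp g F} (h : Mono σ n) (b : Ix g) :
    σ b.swap = (σ b).swap := ((h _ _).1 (h.clean b).swap.1).symm

lemma Mono.wt_swap {σ : Equiv.Perm (Ix g)} {n : Sp g F} (h : Mono σ n) (b : Ix g) :
    wt (σ b.swap) = - wt (σ b) := by rw [h.swap, SpB.wt_swap]

lemma Mono.mul_left {σ : Equiv.Perm (Ix g)} {n : Sp g F} (h : Mono σ n) (A : Sp g F) (a b : Ix g) :
    (n * A).1 (σ a) b = n.1 (σ a) a * A.1 a b := by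
  rw [mul_app, Finset.sum_eq_single a]
  · intro c _ hc; rw [(h.clean a).2.2 c hc, zero_mul]
  · simp

lemma Mono.mul_right {σ : Equiv.Perm (Ix g)} {n : Sp g F} (h : Mono σ n) (A : Sp g F) (a b : Ix g) :
    (A * n).1 a b = A.1 a (σ b) * n.1 (σ b) b := by
  rw [mul_app, Finset.sum_eq_single (σ b)]
  · intro c _ hc; rw [(h.clean b).2.1 c hc, mul_zero]
  · simp

lemma Mono.mul {σ τ : Equiv.Perm (Ix g)} {A B : Sp g F} (hA : Mono σ A) (hB : Mono τ B) :
    Mono (σ * τ) (A * B) := by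
  intro a b
  rw [hB.mul_right, ne_eq, mul_eq_zero, not_or, ← ne_eq, ← ne_eq, hA a]
  simp [(hB.clean b).1]

lemma Mono.inv {σ : Equiv.Perm (Ix g)} {A : Sp g F} (hA : Mono σ A) : Mono σ⁻¹ A⁻¹ := by
  intro a b
  rw [inv_app]
  simp only [ne_eq, mul_eq_zero, sg_ne, false_or]
  rw [← ne_eq, hA, hA.swap, swap_inj, Equiv.Perm.eq_inv_iff_eq, eq_comm]

lemma Mono.conj_mem {σ : Equiv.Perm (Ix g)} {n : Sp g F} (h : Mono σ n) (A : Sp g F) (ε : ℤˣ)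
    (h1 : ∀ a, A.1 a a = 1)
    (h2 : ∀ a b, a ≠ b → A.1 a b ≠ 0 → (ε : ℤ) * wt (σ b) < ε * wt (σ a)) :
    n * A * n⁻¹ ∈ UU g F ε := by
  have key : ∀ a b, (n * A * n⁻¹).1 (σ a) (σ b) * n.1 (σ b) b = n.1 (σ a) a * A.1 a b := by
    intro a b
    rw [← h.mul_left, ← h.mul_right]; simp
  intro a b hab
  obtain ⟨a, rfl⟩ := σ.surjective a
  obtain ⟨b, rfl⟩ := σ.surjective b
  have k := key a b
  by_cases hab' : a = b
  · subst hab'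
    rw [h1, mul_comm] at k
    simpa using mul_left_cancel₀ (h.clean a).1 k
  · have : A.1 a b = 0 := by
      by_contra h'; have := h2 a b hab' h'; omega
    rw [this, mul_zero] at k
    rw [if_neg (by simpa using hab')]
    exact (mul_eq_zero.mp k).resolve_right (h.clean b).1

/-- positivity of `n α_i` -/
def Pos (σ : Equiv.Perm (Ix g)) (i : Fin g) : Prop := wt (σ (qq i)) < wt (σ (pp i))

lemma Mono.conj_y {σ : Equiv.Perm (Ix g)} {n : Sp g F} (h : Mono σ n) (i : Fin g) (t : F)
    (hp : Pos σ i) : n * yr i t * n⁻¹ ∈ UU g F (-1) := by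
  refine h.conj_mem _ _ (fun a => by rw [yr_app, xr_diag]) fun a b hab hne => ?_
  rw [yr_app] at hne
  unfold Pos at hp
  rcases xr_ne i t b a hab.symm hne with ⟨rfl, rfl⟩ | ⟨rfl, rfl⟩
  · push_cast; omega
  · rw [h.wt_swap, h.wt_swap]; push_cast; omega

lemma Mono.conj_x {σ : Equiv.Perm (Ix g)} {n : Sp g F} (h : Mono σ n) (i : Fin g) (t : F)
    (hp : ¬ Pos σ i) : n * xr i t * n⁻¹ ∈ UU g F (-1) := by
  refine h.conj_mem _ _ (fun a => by rw [xr_diag]) fun a b hab hne => ?_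
  unfold Pos at hp
  have : wt (σ (qq i)) ≠ wt (σ (pp i)) := fun e => pq_ne i (σ.injective (wt_inj e)).symm
  rcases xr_ne i t a b hab hne with ⟨rfl, rfl⟩ | ⟨rfl, rfl⟩
  · push_cast; omega
  · rw [h.wt_swap, h.wt_swap]; push_cast; omega

lemma wt_cases (i : Fin g) (a : Ix g) : (a = pp i ∧ pie i a = qq i) ∨ (a = qq i ∧ pie i a = pp i) ∨
    (a = (qq i).swap ∧ pie i a = (pp i).swap) ∨ (a = (pp i).swap ∧ pie i a = (qq i).swap) ∨
    (pie i a = a ∧ (wt (pp i) < wt a ∨ wt a < wt (qq i)) ∧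
      (- wt (qq i) < wt a ∨ wt a < - wt (pp i))) := by
  have hsw : ∀ a, pie i a.swap = (pie i a).swap := (sr_mono (F := ℚ) i).swap
  by_cases h1 : a = pp i
  · subst h1; simp [pie_p]
  by_cases h2 : a = qq i
  · subst h2; simp [pie_q]
  by_cases h3 : a = (qq i).swap
  · subst h3; simp [hsw, pie_q]
  by_cases h4 : a = (pp i).swap
  · subst h4; simp [hsw, pie_p]
  right; right; right; right
  refine ⟨?_, ?_, ?_⟩
  · show pif i a = a
    simp [pif, h1, h2, h3, h4]
  · by_contra h; push Not at h
    rcases pq_between i a h.2 h.1 with h | h <;> contradiction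
  · by_contra h; push Not at h
    rcases pq_between i a.swap (by simp; omega) (by simp; omega) with h | h
    · exact h4 (swap_eq_iff.mp h)
    · exact h3 (swap_eq_iff.mp h)

lemma pie_order (i : Fin g) (a b : Ix g) (h : wt b < wt a) (h' : wt (pie i a) ≤ wt (pie i b)) :
    (a = pp i ∧ b = qq i) ∨ (a = (qq i).swap ∧ b = (pp i).swap) := by
  have hw := pq_wt i
  rcases wt_cases i a with ⟨ha, ha'⟩ | ⟨ha, ha'⟩ | ⟨ha, ha'⟩ | ⟨ha, ha'⟩ | ⟨ha, ha', ha''⟩ <;>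
    rcases wt_cases i b with ⟨hb, hb'⟩ | ⟨hb, hb'⟩ | ⟨hb, hb'⟩ | ⟨hb, hb'⟩ | ⟨hb, hb', hb''⟩ <;>
    first
    | exact Or.inl ⟨ha, hb⟩
    | exact Or.inr ⟨ha, hb⟩
    | (have e1 := congrArg wt ha
       have e2 := congrArg wt hb
       try have e3 := congrArg wt ha'
       try have e4 := congrArg wt hb'
       try simp only [SpB.wt_swap] at e1
       try simp only [SpB.wt_swap] at e2
       try simp only [SpB.wt_swap] at e3
       try simp only [SpB.wt_swap] at e4
       first
       | (exfalso; omega)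
       | (refine Or.inl ⟨wt_inj ?_, wt_inj ?_⟩ <;> omega))

lemma UU_pq_mul (i : Fin g) {u v : Sp g F} (hu : u ∈ UU g F 1) (hv : v ∈ UU g F 1) :
    (u * v).1 (pp i) (qq i) = u.1 (pp i) (qq i) + v.1 (pp i) (qq i) := by
  rw [mul_app, ← Finset.sum_subset (Finset.subset_univ {pp i, qq i}), Finset.sum_pair (pq_ne i),
    hu _ _ le_rfl, hv _ _ le_rfl]
  · simp [add_comm]
  · intro c _ hc
    simp only [Finset.mem_insert, Finset.mem_singleton, not_or] at hc
    by_cases h : wt (pp i) ≤ wt c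
    · rw [hu _ _ (by simpa using h), if_neg (Ne.symm hc.1), zero_mul]
    · by_cases h' : wt c ≤ wt (qq i)
      · rw [hv _ _ (by simpa using h'), if_neg hc.2, mul_zero]
      · rcases pq_between i c (by omega) (by omega) with h | h
        · exact absurd h hc.1
        · exact absurd h hc.2

lemma conj_s_mem (i : Fin g) {u : Sp g F} (hu : u ∈ UU g F 1) (h0 : u.1 (pp i) (qq i) = 0) :
    (sr F i)⁻¹ * u * sr F i ∈ UU g F 1 := by
  have h1 : u.1 (qq i).swap (pp i).swap = 0 := by
    have e := UU_pq_mul i (inv_mem hu) hu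
    rw [inv_mul_cancel, one_app, if_neg (pq_ne i), h0, add_zero, inv_app] at e
    simpa [sg_ne] using e.symm
  have hm := (sr_mono (F := F) i).inv
  have hpi : (pie i)⁻¹ = pie i := by
    ext b; rw [Equiv.Perm.inv_eq_iff_eq, pie_pie]
  rw [hpi] at hm
  have := hm.conj_mem u 1 (fun a => by simpa using hu a a le_rfl) (by
    intro a b hab hne
    by_contra hlt
    have h2 : wt b < wt a := by
      by_contra h3
      exact hne (by rw [hu a b (by simpa using h3), if_neg hab])
    rcases pie_order i a b h2 (by simpa using hlt) with ⟨rfl, rfl⟩ | ⟨rfl, rfl⟩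
    · exact hne h0
    · exact hne h1)
  simpa using this

lemma hecke_mem (i : Fin g) {u : Sp g F} (hu : u ∈ UU g F 1) (t : F) :
    (sr F i)⁻¹ * (xr i (-(t + u.1 (pp i) (qq i))) * u * xr i t) * sr F i ∈ UU g F 1 := by
  apply conj_s_mem i (mul_mem (mul_mem (xr_mem _ _) hu) (xr_mem _ _))
  rw [UU_pq_mul i (mul_mem (xr_mem _ _) hu) (xr_mem _ _), UU_pq_mul i (xr_mem _ _) hu, xr_pq, xr_pq]
  ring

/-- diagonal torus -/
lemma Mono.one_app {d : Sp g F} (h : Mono 1 d) (a b : Ix g) (hab : a ≠ b) : d.1 a b = 0 := by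
  by_contra h'; exact hab ((h a b).1 h')

lemma diag_swap {d : Sp g F} (h : Mono 1 d) (a : Ix g) : d.1 a.swap a.swap = (d.1 a a)⁻¹ := by
  have := mem_sp_iff'.1 d.2 a a.swap
  rw [Finset.sum_eq_single a, if_pos rfl] at this
  · have h1 : d.1 a a ≠ 0 := (h.clean a).1
    have h2 := sg_ne (F := F) a
    field_simp
    apply mul_right_cancel₀ h2
    linear_combination this
  · intro b _ hb; rw [h.one_app b a hb]; simp
  · simp

lemma torus_x (i : Fin g) {d : Sp g F} (h : Mono 1 d) (t : F) :
    d * xr i t = xr i (d.1 (pp i) (pp i) * (d.1 (qq i) (qq i))⁻¹ * t) * d := by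
  apply Subtype.ext; ext a b
  have e1 := h.mul_left (xr i t) a b
  have e2 := h.mul_right (xr i (d.1 (pp i) (pp i) * (d.1 (qq i) (qq i))⁻¹ * t)) a b
  simp only [Equiv.Perm.one_apply] at e1 e2
  rw [e1, e2]
  have hp : d.1 (pp i) (pp i) ≠ 0 := (h.clean _).1
  have hq : d.1 (qq i) (qq i) ≠ 0 := (h.clean _).1
  by_cases hab : a = b
  · subst hab; simp [xr_diag]
  have hall : ∀ (r : F), (xr i r).1 a b = r * (xr i 1).1 a b := by
    intro r
    show io i 1 r 0 1 a b = r * io i 1 1 0 1 a b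
    unfold io
    split_ifs <;> simp_all
  rw [hall t, hall (_ * t)]
  by_cases h0 : (xr i (1 : F)).1 a b = 0
  · rw [h0]; ring
  rcases xr_ne i 1 a b hab h0 with ⟨rfl, rfl⟩ | ⟨rfl, rfl⟩
  · field_simp
  · rw [diag_swap h, diag_swap h]; field_simp

lemma torus_s (i : Fin g) {d : Sp g F} (h : Mono 1 d) : Mono 1 ((sr F i)⁻¹ * d * sr F i) := by
  have := ((sr_mono (F := F) i).inv.mul h).mul (sr_mono i)
  simpa using this

lemma torus_U {d : Sp g F} (h : Mono 1 d) {ε : ℤˣ} {u : Sp g F} (hu : u ∈ UU g F ε) :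
    d * u * d⁻¹ ∈ UU g F ε := by
  refine h.conj_mem u ε (fun a => by simpa using hu a a le_rfl) fun a b hab hne => ?_
  by_contra h'
  exact hne (by rw [hu a b (by simpa using h'), if_neg hab])

lemma hr_mono (i : Fin g) (t : F) (ht : t ≠ 0) : Mono 1 (hr i t) := by
  intro a b
  rw [hr_app i t ht]
  split_ifs <;> simp_all

/-- potential -/
def Phi (σ : Equiv.Perm (Ix g)) : ℤ := ∑ b, wt b * wt (σ b)

lemma Phi_lt {σ : Equiv.Perm (Ix g)} {n : Sp g F} (h : Mono σ n) (i : Fin g) (hp : Pos σ i) :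
    Phi (σ * pie i) < Phi σ := by
  have e1 : Phi (σ * pie i) = ∑ b, wt (pie i b) * wt (σ b) := by
    unfold Phi
    rw [← Equiv.sum_comp (pie i)]
    simp [pie_pie]
  have e2 : Phi σ = ∑ b, wt (pie i b) * wt (σ (pie i b)) := by
    unfold Phi
    rw [← Equiv.sum_comp (pie i)]
  have e3 : 0 < ∑ b, (wt b - wt (pie i b)) * (wt (σ b) - wt (σ (pie i b))) := by
    have hw := pq_wt i
    have hwp : 0 < wt (pp i) - wt (qq i) := by omega
    have hlt : 0 < wt (σ (pp i)) - wt (σ (qq i)) := by unfold Pos at hp; omega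
    have hm := mul_pos hwp hlt
    apply Finset.sum_pos'
    · intro b _
      rcases wt_cases i b with ⟨hb, hb'⟩ | ⟨hb, hb'⟩ | ⟨hb, hb'⟩ | ⟨hb, hb'⟩ | ⟨hb, hb', hb''⟩
      · rw [hb', hb]; exact hm.le
      · rw [hb', hb]; nlinarith
      · rw [hb', hb, h.wt_swap, h.wt_swap, SpB.wt_swap, SpB.wt_swap]; nlinarith
      · rw [hb', hb, h.wt_swap, h.wt_swap, SpB.wt_swap, SpB.wt_swap]; nlinarith
      · rw [hb]; simp
    · exact ⟨pp i, Finset.mem_univ _, by rw [pie_p]; exact hm⟩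
  have e4 : ∑ b, (wt b - wt (pie i b)) * (wt (σ b) - wt (σ (pie i b))) =
      Phi σ - Phi (σ * pie i) + Phi σ - Phi (σ * pie i) := by
    have : ∑ b, (wt b - wt (pie i b)) * (wt (σ b) - wt (σ (pie i b))) =
      Phi σ - Phi (σ * pie i) + ∑ b, wt (pie i b) * wt (σ (pie i b)) -
        ∑ b, wt (pie i b) * wt (σ b) := by
      unfold Phi
      rw [← Finset.sum_sub_distrib, ← Finset.sum_add_distrib, ← Finset.sum_sub_distrib]
      refine Finset.sum_congr rfl fun b _ => ?_
      simp only [Equiv.Perm.mul_apply]; ring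
    rw [this, ← e1, ← e2]
  omega

lemma Pos_pie (σ : Equiv.Perm (Ix g)) (i : Fin g) : Pos (σ * pie i) i ↔ ¬ Pos σ i := by
  unfold Pos
  simp only [Equiv.Perm.mul_apply, pie_p, pie_q]
  have : wt (σ (qq i)) ≠ wt (σ (pp i)) := fun e => pq_ne i (σ.injective (wt_inj e)).symm
  omega

lemma all_pos {σ : Equiv.Perm (Ix g)} {n : Sp g F} (h : Mono σ n) (hp : ∀ i, Pos σ i) : σ = 1 := by
  have hlow : ∀ k : ℕ, ∀ i : Fin g, (i : ℕ) + k + 1 = g → (k : ℤ) + 1 ≤ wt (σ (Sum.inl i)) := by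
    intro k
    induction k with
    | zero =>
      intro i hi
      have := hp i
      unfold Pos pp qq at this
      rw [dif_neg (by omega)] at this
      have h2 := h.wt_swap (Sum.inl i)
      simp only [Sum.swap_inl] at h2
      push_cast; omega
    | succ k ih =>
      intro i hi
      have := hp i
      unfold Pos pp qq at this
      rw [dif_pos (by omega)] at this
      have := ih ⟨i + 1, by omega⟩ (by simp; omega)
      push_cast; omega
  have hup : ∀ k : ℕ, ∀ hk : k < g, wt (σ (Sum.inl ⟨k, hk⟩)) ≤ g - k := by
    intro k
    induction k with
    | zero => intro hk; have := wt_le (σ (Sum.inl ⟨0, hk⟩)); simpa using this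
    | succ k ih =>
      intro hk
      have := hp ⟨k, by omega⟩
      unfold Pos pp qq at this
      rw [dif_pos (by simpa using hk)] at this
      have := ih (by omega)
      simp only at *
      push_cast; omega
  have hl : ∀ i, σ (Sum.inl i) = Sum.inl i := by
    intro i
    apply wt_inj
    have h1 := hlow (g - 1 - i) i (by omega)
    have h2 := hup i i.2
    show wt (σ (Sum.inl i)) = (g : ℤ) - (i : ℕ)
    have := i.2
    have h3 : σ (Sum.inl ⟨i, i.2⟩) = σ (Sum.inl i) := rfl
    rw [h3] at h2
    omega
  ext b
  rcases b with i | i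
  · simp [hl]
  · have := h.swap (Sum.inl i)
    simp only [hl, Sum.swap_inl] at this
    simp [this]

end conj
end SpB


namespace SpB
open Matrix

section minors
variable {g : ℕ} {F : Type} [Field F]

def ii (j : ℕ) (hj : j ≤ g) (a : Fin j) : Ix g := Sum.inl (Fin.castLE hj a)

lemma ii_inj (j : ℕ) (hj : j ≤ g) : Function.Injective (ii j hj) := fun a b h => by
  simpa [ii] using h

lemma wt_ii (j : ℕ) (hj : j ≤ g) (a : Fin j) : wt (ii j hj a) = g - (a : ℕ) := rfl

lemma exists_ii (j : ℕ) (hj : j ≤ g) (c : Ix g) (h : (g : ℤ) - j < wt c) : ∃ a, ii j hj a = c := by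
  refine ⟨⟨(g - wt c).toNat, ?_⟩, wt_inj ?_⟩
  · have := wt_le c; omega
  · rw [wt_ii]; have := wt_le c; simp only; omega

/-- leading minors -/
def mn (j : ℕ) (hj : j ≤ g) (A : Sp g F) : F := (A.1.submatrix (ii j hj) (ii j hj)).det

lemma mn_mul_right (j : ℕ) (hj : j ≤ g) (A P : Sp g F)
    (h : ∀ c b, wt c ≤ (g : ℤ) - j → P.1 c (ii j hj b) = 0) :
    mn j hj (A * P) = mn j hj A * mn j hj P := by
  unfold mn
  rw [← det_mul]
  congr 1
  ext a b
  rw [submatrix_apply, mul_app, Matrix.mul_apply]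
  symm
  apply Fintype.sum_of_injective _ (ii_inj j hj)
  · intro c hc
    rw [h, mul_zero]
    by_contra h'
    exact hc (exists_ii j hj c (by omega))
  · intro a; rfl

lemma mn_mul_left (j : ℕ) (hj : j ≤ g) (A P : Sp g F)
    (h : ∀ c b, wt c ≤ (g : ℤ) - j → P.1 (ii j hj b) c = 0) :
    mn j hj (P * A) = mn j hj P * mn j hj A := by
  unfold mn
  rw [← det_mul]
  congr 1
  ext a b
  rw [submatrix_apply, mul_app, Matrix.mul_apply]
  symm
  apply Fintype.sum_of_injective _ (ii_inj j hj)
  · intro c hc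
    rw [h, zero_mul]
    by_contra h'
    exact hc (exists_ii j hj c (by omega))
  · intro a; rfl

lemma mn_U (j : ℕ) (hj : j ≤ g) {u : Sp g F} (hu : u ∈ UU g F 1) : mn j hj u = 1 := by
  unfold mn
  rw [det_of_upperTriangular]
  · apply Finset.prod_eq_one
    intro a _
    rw [submatrix_apply, hu _ _ le_rfl, if_pos rfl]
  · intro a b hab
    simp only [id] at hab
    rw [submatrix_apply, hu, if_neg]
    · intro h; exact absurd (ii_inj j hj h) hab.ne'
    · rw [wt_ii, wt_ii]; have : (b : ℕ) < a := hab
      push_cast; omega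

lemma mn_Um (j : ℕ) (hj : j ≤ g) {u : Sp g F} (hu : u ∈ UU g F (-1)) : mn j hj u = 1 := by
  unfold mn
  rw [det_of_lowerTriangular]
  · apply Finset.prod_eq_one
    intro a _
    rw [submatrix_apply, hu _ _ le_rfl, if_pos rfl]
  · intro a b hab
    have hab : a < b := hab
    rw [submatrix_apply, hu, if_neg]
    · intro h; exact absurd (ii_inj j hj h) hab.ne
    · rw [wt_ii, wt_ii]; have : (a : ℕ) < b := hab
      push_cast; omega

lemma mn_mul_U (j : ℕ) (hj : j ≤ g) (A : Sp g F) {u : Sp g F} (hu : u ∈ UU g F 1) :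
    mn j hj (A * u) = mn j hj A := by
  rw [mn_mul_right, mn_U j hj hu, mul_one]
  intro c b hc
  have := b.2
  rw [hu, if_neg]
  · rintro rfl; rw [wt_ii] at hc; omega
  · rw [wt_ii]; push_cast; omega

lemma mn_Um_mul (j : ℕ) (hj : j ≤ g) (A : Sp g F) {u : Sp g F} (hu : u ∈ UU g F (-1)) :
    mn j hj (u * A) = mn j hj A := by
  rw [mn_mul_left, mn_Um j hj hu, one_mul]
  intro c b hc
  have := b.2
  rw [hu, if_neg]
  · rintro rfl; rw [wt_ii] at hc; omega
  · rw [wt_ii]; push_cast; omega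

lemma wt_pp (i : Fin g) : wt (pp i) = (g : ℤ) - (i : ℕ) := rfl

lemma mn_mul_y (j : ℕ) (hj : j ≤ g) (A : Sp g F) (i : Fin g) (t : F) (hij : j ≠ i + 1) :
    mn j hj (A * yr i t) = mn j hj A := by
  rw [mn_mul_right, mn_Um j hj (yr_mem _ _), mul_one]
  intro c b hc
  have hb := b.2
  have hi := i.2
  have hw := wt_ii j hj b
  by_contra hne
  have h1 := wt_pp i
  have h2 := pq_wt i
  rw [yr_app] at hne
  rcases xr_ne i t _ _ (by intro h; rw [← h] at hc; omega) hne with ⟨e1, e2⟩ | ⟨e1, e2⟩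
  · rw [e1] at hw; rw [e2] at hc; omega
  · rw [e1, wt_swap] at hw; rw [e2, wt_swap] at hc; omega

lemma mn_mul_s (j : ℕ) (hj : j ≤ g) (A : Sp g F) (i : Fin g) (hij : j ≠ i + 1) :
    mn j hj (A * sr F i) = mn j hj A := by
  unfold sr
  rw [← mul_assoc, ← mul_assoc, mn_mul_U j hj _ (xr_mem _ _), mn_mul_y j hj _ _ _ hij,
    mn_mul_U j hj _ (xr_mem _ _)]

lemma mn_not_pos {σ : Equiv.Perm (Ix g)} {n : Sp g F} (h : Mono σ n) (i : Fin g)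
    (hp : ¬ Pos σ i) : mn (i + 1) i.2 n = 0 := by
  by_cases hc : ∃ b, wt (σ (ii (i + 1) i.2 b)) ≤ (g : ℤ) - (i + 1 : ℕ)
  · obtain ⟨b, hb⟩ := hc
    unfold mn
    apply det_eq_zero_of_column_eq_zero b
    intro a
    rw [submatrix_apply]
    by_contra h'
    rw [← (h _ _).1 h', wt_ii] at hb
    have := a.2
    omega
  · push Not at hc
    exfalso; apply hp
    unfold Pos
    have h1 := hc ⟨i, by omega⟩
    have e1 : ii (i + 1) i.2 ⟨i, by omega⟩ = pp i := rfl
    rw [e1] at h1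
    by_contra hle
    have hinj : Function.Injective (fun b => (⟨(g - wt (σ (ii (i + 1) i.2 b))).toNat, by
        have := hc b; have := wt_le (σ (ii (i + 1) i.2 b)); omega⟩ : Fin (i + 1))) := by
      intro a b hab
      simp only [Fin.mk.injEq] at hab
      have h3 := wt_le (σ (ii (i + 1) i.2 a))
      have h4 := wt_le (σ (ii (i + 1) i.2 b))
      exact ii_inj _ _ (σ.injective (wt_inj (by omega)))
    have hsurj := Finite.surjective_of_injective hinj
    obtain ⟨b, hb⟩ := hsurj ⟨(g - wt (σ (qq i))).toNat, by
      have := wt_le (σ (qq i)); omega⟩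
    simp only [Fin.mk.injEq] at hb
    have h3 := wt_le (σ (ii (i + 1) i.2 b))
    have h4 := wt_le (σ (qq i))
    have e := σ.injective (wt_inj (a := σ (ii (i + 1) i.2 b)) (b := σ (qq i)) (by omega))
    have e2 := congrArg wt e
    rw [wt_ii] at e2
    have := wt_pp i
    have := pq_wt i
    have := b.2
    have := i.2
    omega

lemma mn_diag (j : ℕ) (hj : j ≤ g) {d : Sp g F} (h : Mono 1 d) :
    mn j hj d = ∏ b, d.1 (ii j hj b) (ii j hj b) := by
  unfold mn
  rw [det_of_upperTriangular]
  · rfl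
  · intro a b hab
    have hab : b < a := hab
    exact h.one_app _ _ fun h => hab.ne' (ii_inj j hj h)

/-- highest weight function -/
def fl (lam : Fin g → ℕ) (A : Sp g F) : F := ∏ i : Fin g, mn (i + 1) i.2 A ^ lam i

lemma fl_U (lam : Fin g → ℕ) (A : Sp g F) {u v : Sp g F} (hu : u ∈ UU g F (-1))
    (hv : v ∈ UU g F 1) : fl lam (u * A * v) = fl lam A := by
  unfold fl
  refine Finset.prod_congr rfl fun i _ => ?_
  rw [mn_mul_U _ _ _ hv, mn_Um_mul _ _ _ hu]

lemma fl_s (lam : Fin g → ℕ) (A : Sp g F) (i : Fin g) (h : lam i = 0) :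
    fl lam (A * sr F i) = fl lam A := by
  unfold fl
  refine Finset.prod_congr rfl fun j _ => ?_
  by_cases hij : j = i
  · subst hij; rw [h]; simp
  · rw [mn_mul_s]; intro h'; apply hij; ext; omega

lemma fl_zero (lam : Fin g → ℕ) {σ : Equiv.Perm (Ix g)} {n : Sp g F} (h : Mono σ n) (i : Fin g)
    (hp : ¬ Pos σ i) (hl : lam i ≠ 0) : fl lam n = 0 := by
  unfold fl
  apply Finset.prod_eq_zero (Finset.mem_univ i)
  rw [mn_not_pos h i hp, zero_pow hl]

lemma fl_diag (lam : Fin g → ℕ) {d : Sp g F} (h : Mono 1 d) :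
    fl lam d = ∏ b : Fin g, d.1 (Sum.inl b) (Sum.inl b) ^ (∑ i ∈ Finset.univ.filter (b ≤ ·), lam i) := by
  unfold fl
  simp_rw [mn_diag _ _ h]
  have : ∀ i : Fin g, ∏ b : Fin (i + 1), d.1 (ii (i + 1) i.2 b) (ii (i + 1) i.2 b) =
      ∏ b : Fin g, if b ≤ i then d.1 (Sum.inl b) (Sum.inl b) else 1 := by
    intro i
    apply Fintype.prod_of_injective (Fin.castLE i.2) (Fin.castLE_injective _)
    · intro b hb
      rw [if_neg]
      intro hbi
      exact hb ⟨⟨b, by have : (b : ℕ) ≤ i := hbi; omega⟩, rfl⟩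
    · intro b
      rw [if_pos]
      · rfl
      · have := b.2
        show (b : ℕ) ≤ i
        omega
  simp_rw [this, ← Finset.prod_pow]
  rw [Finset.prod_comm]
  refine Finset.prod_congr rfl fun b _ => ?_
  rw [← Finset.prod_pow_eq_pow_sum, Finset.prod_filter]
  refine Finset.prod_congr rfl fun i _ => ?_
  split_ifs <;> simp

end minors
end SpB


namespace SpB
open Matrix

section fixed
variable {p : ℕ} [Fact p.Prime] {k : Type} [Field k] [CharP k p] {G : Type} [Group G] [Finite G]
  {V : Type} [AddCommGroup V] [Module k V]

lemma fixed_vec (hG : IsPGroup p G) [Nontrivial V] (ρ : Representation k G V) :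
    ∃ v : V, v ≠ 0 ∧ ∀ h, ρ h v = v := by
  classical
  have := Fintype.ofFinite G
  obtain ⟨x, hx⟩ := exists_ne (0 : V)
  let Φ : (G → ZMod p) →+ V :=
    { toFun := fun c => ∑ h, (ZMod.castHom (dvd_refl p) k (c h)) • ρ h x
      map_zero' := by simp
      map_add' := by
        intro a b
        simp only [Pi.add_apply, map_add, add_smul, Finset.sum_add_distrib] }
  have hΦ : ∀ h c, ρ h (Φ c) = Φ (fun y => c (h⁻¹ * y)) := by
    intro h c
    show ρ h (∑ y, (ZMod.castHom (dvd_refl p) k (c y)) • ρ y x) =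
      ∑ y, (ZMod.castHom (dvd_refl p) k (c (h⁻¹ * y))) • ρ y x
    rw [map_sum, ← Equiv.sum_comp (Equiv.mulLeft h)
      (fun y => (ZMod.castHom (dvd_refl p) k (c (h⁻¹ * y))) • ρ y x)]
    refine Finset.sum_congr rfl fun y _ => ?_
    simp
  have hx1 : Φ (Pi.single 1 1) = x := by
    show ∑ y, (ZMod.castHom (dvd_refl p) k ((Pi.single (1 : G) (1 : ZMod p) : G → ZMod p) y)) •
      ρ y x = x
    rw [Finset.sum_eq_single 1]
    · simp
    · intro y _ hy; simp [hy]
    · simp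
  let R := Φ.range
  have hfin : Finite R := by
    have : (R : Set V).Finite := by
      show (Set.range Φ).Finite
      exact Set.finite_range _
    exact this
  let act : MulAction G R :=
    { smul := fun h r => ⟨ρ h r.1, by
        obtain ⟨c, hc⟩ := r.2
        rw [← hc, hΦ]; exact ⟨_, rfl⟩⟩
      one_smul := fun r => Subtype.ext (by show ρ 1 r.1 = r.1; simp)
      mul_smul := fun a b r => Subtype.ext (by show ρ (a * b) r.1 = ρ a (ρ b r.1); simp) }
  have hcard : p ∣ Nat.card R := by
    have hxR : x ∈ R := ⟨_, hx1⟩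
    have ho : addOrderOf (⟨x, hxR⟩ : R) = p := by
      apply addOrderOf_eq_prime
      · apply Subtype.ext
        show p • x = 0
        rw [← Nat.cast_smul_eq_nsmul k, CharP.cast_eq_zero, zero_smul]
      · intro h; exact hx (congrArg Subtype.val h)
    rw [← ho]
    exact addOrderOf_dvd_natCard _
  obtain ⟨b, hb, hb0⟩ := hG.exists_fixed_point_of_prime_dvd_card_of_fixed_point R hcard (a := (0 : R))
    (fun h => Subtype.ext (by show ρ h 0 = 0; simp))
  refine ⟨b.1, fun h => hb0 (Subtype.ext h.symm), fun h => ?_⟩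
  exact congrArg Subtype.val (hb h)

end fixed

section torus
variable {g : ℕ} {F : Type} [Field F]

def tor (z : Fin g → Fˣ) : Sp g F :=
  ⟨diagonal (Sum.elim (fun b => (z b : F)) (fun b => ((z b)⁻¹ : Fˣ))), by
    rw [mem_sp_iff]
    intro a b
    simp only [diagonal_apply]
    rw [Finset.sum_eq_single a]
    · rcases a with a | a <;> rcases b with b | b <;> simp [eq_comm, sg] <;>
      · by_cases h : a = b <;> simp [h]
    · intro c _ hc; simp [hc.symm]
    · simp⟩

lemma tor_app (z : Fin g → Fˣ) (b : Fin g) : (tor z).1 (Sum.inl b) (Sum.inl b) = z b := by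
  simp [tor]

lemma tor_mul (z w : Fin g → Fˣ) : tor (z * w) = tor z * tor w := by
  apply Subtype.ext
  show diagonal _ = diagonal _ * diagonal _
  rw [diagonal_mul_diagonal]
  congr 1
  ext b
  rcases b with b | b <;> simp [mul_comm]

lemma tor_one : tor (1 : Fin g → Fˣ) = 1 := by
  apply Subtype.ext
  show diagonal _ = 1
  rw [← diagonal_one]
  congr 1
  ext b
  rcases b with b | b <;> simp

lemma tor_mono (z : Fin g → Fˣ) : Mono 1 (tor z) := by
  intro a b
  simp only [tor, diagonal_apply]
  split_ifs with h
  · rcases a with a | a <;> simp [← h]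
  · simp [h]

lemma exists_tor {d : Sp g F} (h : Mono 1 d) : ∃ z, d = tor z := by
  refine ⟨fun b => Units.mk0 (d.1 (Sum.inl b) (Sum.inl b)) (h.clean _).1, ?_⟩
  apply Subtype.ext
  ext a b
  by_cases hab : a = b
  · subst hab
    rcases a with a | a
    · simp [tor]; rfl
    · have := diag_swap h (Sum.inl a)
      simp only [Sum.swap_inl] at this
      simp [tor, this]; rfl
  · rw [h.one_app a b hab]; simp [tor, hab]

end torus
end SpB


namespace SpB
open Matrix

section weights
variable {g : ℕ} {F : Type} [Field F] [Fintype F] {k : Type} [Field k] (cc : F →+* k)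
  {V : Type} [AddCommGroup V] [Module k V] (ρ : Representation k (Sp g F) V)

def chi (a : Fin g → ℕ) (d : Sp g F) : F := ∏ b, d.1 (Sum.inl b) (Sum.inl b) ^ a b

open Classical in
noncomputable def PP (a : Fin g → ℕ) (v : V) : V :=
  ∑ z : Fin g → Fˣ, cc (∏ b, (((z b)⁻¹ : Fˣ) : F) ^ a b) • ρ (tor z) v

lemma PP_wt (a : Fin g → ℕ) (v : V) (d : Sp g F) (hd : Mono 1 d) :
    ρ d (PP cc ρ a v) = cc (chi a d) • PP cc ρ a v := by
  classical
  obtain ⟨w, rfl⟩ := exists_tor hd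
  unfold PP chi
  rw [map_sum, Finset.smul_sum]
  have := Equiv.sum_comp (Equiv.mulLeft w) (fun z : Fin g → Fˣ =>
    cc (∏ b, (tor w).1 (Sum.inl b) (Sum.inl b) ^ a b) •
      cc (∏ b, (((z b)⁻¹ : Fˣ) : F) ^ a b) • ρ (tor z) v)
  refine Eq.trans ?_ this
  refine Finset.sum_congr rfl fun z _ => ?_
  rw [Equiv.coe_mulLeft, tor_mul, map_smul, smul_smul, ← map_mul, ← Finset.prod_mul_distrib,
    map_mul ρ, Module.End.mul_apply]
  congr 2
  refine Finset.prod_congr rfl fun b _ => ?_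
  rw [tor_app, ← mul_pow]
  simp [mul_comm (z b) (w b)]
  rw [← inv_pow]
  congr 1
  have := (w b).ne_zero
  have := (z b).ne_zero
  field_simp


lemma PP_eig {χ : Sp g F → k} {v : V} (h : ∀ d, Mono 1 d → ρ d v = χ d • v) (a : Fin g → ℕ) :
    ∃ m : k, PP cc ρ a v = m • v := by
  classical
  unfold PP
  refine ⟨∑ z : Fin g → Fˣ, cc (∏ b, (((z b)⁻¹ : Fˣ) : F) ^ a b) * χ (tor z), ?_⟩
  rw [Finset.sum_smul]
  refine Finset.sum_congr rfl fun z _ => ?_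
  rw [h _ (tor_mono z), smul_smul]

lemma PP_U {v : V} (h : ∀ u ∈ UU g F 1, ρ u v = v) (a : Fin g → ℕ) :
    ∀ u ∈ UU g F 1, ρ u (PP cc ρ a v) = PP cc ρ a v := by
  classical
  intro u hu
  unfold PP
  rw [map_sum]
  refine Finset.sum_congr rfl fun z _ => ?_
  rw [map_smul]
  congr 1
  have e : u * tor z = tor z * ((tor z)⁻¹ * u * (tor z)⁻¹⁻¹) := by group
  rw [← Module.End.mul_apply, ← map_mul, e, map_mul, Module.End.mul_apply, h]
  exact torus_U (by simpa using (tor_mono z).inv) hu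

lemma card_sub_one_ne (cc : F →+* k) : ((Fintype.card F - 1 : ℕ) : k) ≠ 0 := by
  have h1 : 1 < Fintype.card F := Fintype.one_lt_card
  rw [Nat.cast_sub h1.le]
  have : ((Fintype.card F : ℕ) : F) = 0 := FiniteField.cast_card_eq_zero F
  have h2 := congrArg cc this
  rw [map_natCast, map_zero] at h2
  rw [h2]; simp

lemma exists_PP (v : V) (hv : v ≠ 0) : ∃ a : Fin g → ℕ, PP cc ρ a v ≠ 0 := by
  classical
  by_contra hcon
  push Not at hcon
  have hs : ∑ a : Fin g → Fin (Fintype.card F - 1), PP cc ρ (fun b => (a b : ℕ)) v = 0 :=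
    Finset.sum_eq_zero fun a _ => hcon _
  unfold PP at hs
  rw [Finset.sum_comm] at hs
  have hz : ∀ z : Fin g → Fˣ, ∑ a : Fin g → Fin (Fintype.card F - 1),
      cc (∏ b, (((z b)⁻¹ : Fˣ) : F) ^ (a b : ℕ)) = if z = 1 then
        ((Fintype.card F - 1 : ℕ) : k) ^ g else 0 := by
    intro z
    have e : ∑ a : Fin g → Fin (Fintype.card F - 1), ∏ b, (((z b)⁻¹ : Fˣ) : F) ^ (a b : ℕ) =
        ∏ b, ∑ j : Fin (Fintype.card F - 1), (((z b)⁻¹ : Fˣ) : F) ^ (j : ℕ) := by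
      rw [Finset.prod_univ_sum, Fintype.piFinset_univ]
    rw [← map_sum, e]
    split_ifs with h
    · subst h; simp
    · obtain ⟨b, hb⟩ := Function.ne_iff.mp h
      rw [Finset.prod_eq_zero (Finset.mem_univ b), map_zero]
      rw [Fin.sum_univ_eq_sum_range (fun j => (((z b)⁻¹ : Fˣ) : F) ^ j), geom_sum_eq]
      · rw [FiniteField.pow_card_sub_one_eq_one _ (Units.ne_zero _)]; simp
      · intro h'
        apply hb
        have : (z b)⁻¹ = 1 := Units.ext h'
        simpa using this
  simp_rw [← Finset.sum_smul, hz] at hs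
  simp only [ite_smul, zero_smul, Finset.sum_ite_eq', Finset.mem_univ, if_true, tor_one, map_one,
    Module.End.one_apply] at hs
  rcases smul_eq_zero.mp hs with h | h
  · exact card_sub_one_ne cc (eq_zero_of_pow_eq_zero h)
  · exact hv h

end weights
end SpB


namespace SpB
open Matrix

section hecke
variable {g : ℕ} {F : Type} [Field F] [Fintype F] {k : Type} [Field k] (cc : F →+* k)
  {V : Type} [AddCommGroup V] [Module k V] (ρ : Representation k (Sp g F) V)

noncomputable def RR (i : Fin g) (v : V) : V := ∑ t : F, ρ (xr i t * sr F i) v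

lemma RR_U (i : Fin g) {v : V} (h : ∀ u ∈ UU g F 1, ρ u v = v) :
    ∀ u ∈ UU g F 1, ρ u (RR ρ i v) = RR ρ i v := by
  intro u hu
  unfold RR
  rw [map_sum]
  refine Eq.trans ?_ (Equiv.sum_comp (Equiv.addRight (u.1 (pp i) (qq i)))
    (fun t => ρ (xr i t * sr F i) v))
  refine Finset.sum_congr rfl fun t _ => ?_
  rw [Equiv.coe_addRight]
  have e : u * (xr i t * sr F i) = xr i (t + u.1 (pp i) (qq i)) * sr F i *
      ((sr F i)⁻¹ * (xr i (-(t + u.1 (pp i) (qq i))) * u * xr i t) * sr F i) := by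
    have : xr i (-(t + u.1 (pp i) (qq i))) = (xr i (t + u.1 (pp i) (qq i)))⁻¹ := by
      rw [eq_inv_iff_mul_eq_one, xr_mul, neg_add_cancel, xr_zero]
    rw [this]; group
  rw [← Module.End.mul_apply, ← map_mul, e, map_mul, Module.End.mul_apply, h _ (hecke_mem i hu t)]

lemma RR_T (i : Fin g) {v : V} {χ : Sp g F → k} (h : ∀ d, Mono 1 d → ρ d v = χ d • v)
    (d : Sp g F) (hd : Mono 1 d) : ρ d (RR ρ i v) = χ ((sr F i)⁻¹ * d * sr F i) • RR ρ i v := by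
  unfold RR
  rw [map_sum, Finset.smul_sum]
  have hc : d.1 (pp i) (pp i) * (d.1 (qq i) (qq i))⁻¹ ≠ 0 :=
    mul_ne_zero (hd.clean _).1 (inv_ne_zero (hd.clean _).1)
  refine Eq.trans ?_ (Equiv.sum_comp (Equiv.mulLeft₀ _ hc)
    (fun t => χ ((sr F i)⁻¹ * d * sr F i) • ρ (xr i t * sr F i) v))
  refine Finset.sum_congr rfl fun t _ => ?_
  show _ = χ ((sr F i)⁻¹ * d * sr F i) •
    ρ (xr i (d.1 (pp i) (pp i) * (d.1 (qq i) (qq i))⁻¹ * t) * sr F i) v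
  have e : d * (xr i t * sr F i) = xr i (d.1 (pp i) (pp i) * (d.1 (qq i) (qq i))⁻¹ * t) * sr F i *
      ((sr F i)⁻¹ * d * sr F i) := by
    rw [← mul_assoc, torus_x i hd]; group
  rw [← Module.End.mul_apply, ← map_mul, e, map_mul, Module.End.mul_apply, h _ (torus_s i hd), map_smul]

variable (φ : V →ₗ[k] k) 

lemma card_zero (cc : F →+* k) : ((Fintype.card F : ℕ) : k) = 0 := by
  have : ((Fintype.card F : ℕ) : F) = 0 := FiniteField.cast_card_eq_zero F
  have h2 := congrArg cc this
  rwa [map_natCast, map_zero] at h2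

lemma RR_not_pos (cc : F →+* k) (hφ : ∀ u ∈ UU g F (-1), ∀ x, φ (ρ u x) = φ x) (i : Fin g) (v : V)
    {σ : Equiv.Perm (Ix g)} {n : Sp g F} (hn : Mono σ n) (hp : ¬ Pos σ i) :
    φ (ρ n (RR ρ i v)) = 0 := by
  unfold RR
  rw [map_sum, map_sum]
  have : ∀ t : F, φ (ρ n (ρ (xr i t * sr F i) v)) = φ (ρ (n * sr F i) v) := by
    intro t
    have e : n * (xr i t * sr F i) = (n * xr i t * n⁻¹) * (n * sr F i) := by group
    rw [← Module.End.mul_apply, ← map_mul, e, map_mul, Module.End.mul_apply,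
      hφ _ (hn.conj_x i t hp)]
  simp_rw [this]
  rw [Finset.sum_const, Finset.card_univ, ← Nat.cast_smul_eq_nsmul k, card_zero cc, zero_smul]

open Classical in
lemma RR_pos (hφ : ∀ u ∈ UU g F (-1), ∀ x, φ (ρ u x) = φ x) (i : Fin g) {v : V}
    (hU : ∀ u ∈ UU g F 1, ρ u v = v)
    {χ : Sp g F → k} (h : ∀ d, Mono 1 d → ρ d v = χ d • v)
    {σ : Equiv.Perm (Ix g)} {n : Sp g F} (hn : Mono σ n) (hp : Pos σ i) :
    φ (ρ n (RR ρ i v)) = φ (ρ (n * sr F i) v) + (∑ t : Fˣ, χ (hr i (-t : F))) * φ (ρ n v) := by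
  unfold RR
  rw [map_sum, map_sum, Fintype.sum_eq_add_sum_subtype_ne _ (0 : F)]
  congr 1
  · rw [xr_zero, one_mul, ← Module.End.mul_apply, ← map_mul]
  · rw [Finset.sum_mul]
    symm
    apply Fintype.sum_equiv (unitsEquivNeZero (G₀ := F))
    intro t
    have e : n * (xr i (t : F) * sr F i) = (n * yr i (t : F)⁻¹ * n⁻¹) * (n * (hr i (-t : F) *
      xr i (-(t : F)⁻¹))) := by rw [rank_one]; group
    show _ = φ (ρ n (ρ (xr i (t : F) * sr F i) v))
    rw [← Module.End.mul_apply, ← map_mul, e, map_mul, Module.End.mul_apply,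
      hφ _ (hn.conj_y i _ hp), map_mul, map_mul, Module.End.mul_apply, Module.End.mul_apply,
      hU _ (xr_mem _ _), h _ (hr_mono _ _ (by simp)), map_smul, map_smul, smul_eq_mul]

end hecke

section energy
variable {g : ℕ} {F : Type} [Field F]

open Classical in
noncomputable def ph (A : Sp g F) : ℤ := ∑ b, ∑ a, if A.1 a b ≠ 0 then wt b * wt a else 0

lemma ph_mono {σ : Equiv.Perm (Ix g)} {A : Sp g F} (h : Mono σ A) : ph A = Phi σ := by
  classical
  unfold ph Phi
  refine Finset.sum_congr rfl fun b _ => ?_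
  simp [h _ b]

noncomputable def en (A : Sp g F) : ℕ := ((∑ b : Ix g, ∑ a : Ix g, |wt b * wt a|) - ph A).toNat

lemma en_lt {σ : Equiv.Perm (Ix g)} {A : Sp g F} (h : Mono σ A) (i : Fin g) (hp : Pos σ i) :
    en A < en (A * sr F i) := by
  have h1 := Phi_lt h i hp
  have h2 := ph_mono h
  have h3 := ph_mono (h.mul (sr_mono i))
  have h4 : ∀ B : Sp g F, ph B ≤ ∑ b : Ix g, ∑ a : Ix g, |wt b * wt a| := by
    intro B
    unfold ph
    refine Finset.sum_le_sum fun b _ => Finset.sum_le_sum fun a _ => ?_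
    split_ifs
    · exact le_abs_self _
    · exact abs_nonneg _
  have := h4 A
  have := h4 (A * sr F i)
  unfold en
  omega

end energy
end SpB


namespace SpB
open Matrix

section minim
variable {g : ℕ} {F : Type} [Field F] [Fintype F] {k : Type} [Field k] 
  {V : Type} [AddCommGroup V] [Module k V] (ρ : Representation k (Sp g F) V) (φ : V →ₗ[k] k) 

lemma Mono.unique {σ τ : Equiv.Perm (Ix g)} {A : Sp g F} (h : Mono σ A) (h' : Mono τ A) : σ = τ := by
  ext b : 1
  exact (h' _ _).1 (h.clean b).1

lemma Mono.down {σ : Equiv.Perm (Ix g)} {A : Sp g F} (h : Mono σ A) (i : Fin g)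
    (hp : ¬ Pos σ i) : Mono (σ * pie i) (A * (sr F i)⁻¹) ∧ Pos (σ * pie i) i ∧
      en (A * (sr F i)⁻¹) < en A := by
  have hpi : (pie i)⁻¹ = pie i := by
    ext b; rw [Equiv.Perm.inv_eq_iff_eq, pie_pie]
  have h1 : Mono (σ * pie i) (A * (sr F i)⁻¹) := by
    have := h.mul (sr_mono (F := F) i).inv
    rwa [hpi] at this
  have h2 := (Pos_pie σ i).2 hp
  refine ⟨h1, h2, ?_⟩
  have := en_lt h1 i h2
  simpa using this

def Good (v : V) : Prop := v ≠ 0 ∧ (∀ u ∈ UU g F 1, ρ u v = v) ∧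
  ∃ χ : Sp g F → k, ∀ d, Mono 1 d → ρ d v = χ d • v

open Classical in
noncomputable def supp (v : V) : Finset (Sp g F) :=
  Finset.univ.filter fun A => (∃ σ, Mono σ A) ∧ φ (ρ A v) ≠ 0

lemma mem_supp {v : V} {A : Sp g F} : A ∈ supp ρ φ v ↔ (∃ σ, Mono σ A) ∧ φ (ρ A v) ≠ 0 := by
  simp [supp]

noncomputable def EE (v : V) : ℕ := ∑ A ∈ supp ρ φ v, en A

lemma exists_min (h : ∃ v, Good ρ v) : ∃ v, Good ρ v ∧ ∀ v', Good ρ v' → EE ρ φ v ≤ EE ρ φ v' := by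
  classical
  have hex : ∃ m, ∃ v, Good ρ v ∧ EE ρ φ v = m := by
    obtain ⟨v, hv⟩ := h; exact ⟨_, v, hv, rfl⟩
  obtain ⟨v, hv, hm⟩ := Nat.find_spec hex
  refine ⟨v, hv, fun v' hv' => ?_⟩
  rw [hm]
  exact Nat.find_min' hex ⟨v', hv', rfl⟩

lemma dichotomy (cc : F →+* k) (hφ : ∀ u ∈ UU g F (-1), ∀ x, φ (ρ u x) = φ x) {v : V}
    (hv : Good ρ v) (hmin : ∀ v', Good ρ v' → EE ρ φ v ≤ EE ρ φ v') (i : Fin g) :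
    (∀ σ n, Mono σ n → φ (ρ n v) ≠ 0 → Pos σ i) ∨ RR ρ i v = 0 := by
  classical
  by_contra hcon
  push Not at hcon
  obtain ⟨⟨σ0, n0, hm0, hf0, hp0⟩, hR⟩ := hcon
  obtain ⟨hv0, hU, χ, hχ⟩ := hv
  have hle := hmin (RR ρ i v) ⟨hR, RR_U ρ i hU, _, RR_T ρ i hχ⟩
  let P : Sp g F → Prop := fun A => ∃ σ, Mono σ A ∧ Pos σ i
  have hsub : supp ρ φ (RR ρ i v) ⊆ (supp ρ φ v).filter P ∪
      ((supp ρ φ v).filter (¬ P ·)).image (· * (sr F i)⁻¹) := by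
    intro n hn
    obtain ⟨⟨σ, hσ⟩, hf⟩ := (mem_supp ρ φ).1 hn
    have hp : Pos σ i := by
      by_contra hp
      exact hf (RR_not_pos ρ φ cc hφ i v hσ hp)
    rw [RR_pos ρ φ hφ i hU hχ hσ hp] at hf
    by_cases hfn : φ (ρ n v) = 0
    · rw [hfn, mul_zero, add_zero] at hf
      apply Finset.mem_union_right
      rw [Finset.mem_image]
      have hm := hσ.mul (sr_mono (F := F) i)
      refine ⟨n * sr F i, ?_, by simp⟩
      rw [Finset.mem_filter, mem_supp]
      refine ⟨⟨⟨_, hm⟩, hf⟩, ?_⟩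
      rintro ⟨τ, hτ, hpτ⟩
      rw [hτ.unique hm, Pos_pie] at hpτ
      exact hpτ hp
    · apply Finset.mem_union_left
      rw [Finset.mem_filter, mem_supp]
      exact ⟨⟨⟨σ, hσ⟩, hfn⟩, σ, hσ, hp⟩
  have h1 : EE ρ φ (RR ρ i v) ≤ ∑ A ∈ (supp ρ φ v).filter P, en A +
      ∑ A ∈ (supp ρ φ v).filter (¬ P ·), en (A * (sr F i)⁻¹) := by
    refine (Finset.sum_le_sum_of_subset hsub).trans ?_
    rw [← Finset.sum_image (s := (supp ρ φ v).filter (¬ P ·)) (g := (· * (sr F i)⁻¹)) (f := en)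
      (fun a _ b _ h => mul_right_cancel h), ← Finset.sum_union_inter]
    exact Nat.le_add_right _ _
  have h2 : ∑ A ∈ (supp ρ φ v).filter (¬ P ·), en (A * (sr F i)⁻¹) <
      ∑ A ∈ (supp ρ φ v).filter (¬ P ·), en A := by
    apply Finset.sum_lt_sum_of_nonempty
    · refine ⟨n0, ?_⟩
      rw [Finset.mem_filter, mem_supp]
      refine ⟨⟨⟨_, hm0⟩, hf0⟩, ?_⟩
      rintro ⟨τ, hτ, hpτ⟩
      rw [hτ.unique hm0] at hpτ
      exact hp0 hpτ
    · intro A hA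
      rw [Finset.mem_filter, mem_supp] at hA
      obtain ⟨⟨⟨σ, hσ⟩, -⟩, hP⟩ := hA
      exact (hσ.down i fun hp => hP ⟨σ, hσ, hp⟩).2.2
  have h3 : EE ρ φ v = ∑ A ∈ (supp ρ φ v).filter P, en A +
      ∑ A ∈ (supp ρ φ v).filter (¬ P ·), en A :=
    (Finset.sum_filter_add_sum_filter_not _ _ _).symm
  omega

end minim
end SpB


namespace SpB
open Matrix

section mainfn
variable {g : ℕ} {F : Type} [Field F] [Fintype F] {k : Type} [Field k] 
  {V : Type} [AddCommGroup V] [Module k V] (ρ : Representation k (Sp g F) V)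

def nx (a : Fin g → ℕ) (i : Fin g) : ℕ := if h : (i : ℕ) + 1 < g then a ⟨i + 1, h⟩ else 0

lemma chi_hr (a : Fin g → ℕ) (i : Fin g) (t : F) (ht : t ≠ 0) :
    chi a (hr i t) = t ^ a i * t⁻¹ ^ nx a i := by
  unfold chi nx
  simp_rw [hr_app i t ht, if_true]
  by_cases h : (i : ℕ) + 1 < g
  · have hq : qq i = Sum.inl ⟨i + 1, h⟩ := by unfold qq; rw [dif_pos h]
    have e : ∀ b : Fin g, (if (Sum.inl b : Ix g) = pp i then t else if (Sum.inl b : Ix g) = qq i then t⁻¹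
      else if (Sum.inl b : Ix g) = (qq i).swap then t else
        if (Sum.inl b : Ix g) = (pp i).swap then t⁻¹ else 1) ^ a b =
        (if b = i then t ^ a b else 1) * (if b = ⟨i + 1, h⟩ then t⁻¹ ^ a b else 1) := by
      intro b
      rw [hq]
      unfold pp
      have hne : i ≠ ⟨i + 1, h⟩ := by intro h'; have := congrArg Fin.val h'; simp at this
      by_cases h1 : b = i
      · subst h1; simp [hne]
      · by_cases h2 : b = ⟨i + 1, h⟩ <;> simp [h1, h2, hne.symm]
    simp_rw [e]
    rw [Finset.prod_mul_distrib, dif_pos h]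
    simp
  · have hq : qq i = Sum.inr i := by unfold qq; rw [dif_neg h]
    have e : ∀ b : Fin g, (if (Sum.inl b : Ix g) = pp i then t else if (Sum.inl b : Ix g) = qq i then t⁻¹
      else if (Sum.inl b : Ix g) = (qq i).swap then t else
        if (Sum.inl b : Ix g) = (pp i).swap then t⁻¹ else 1) ^ a b =
        (if b = i then t ^ a b else 1) := by
      intro b
      rw [hq]
      unfold pp
      by_cases h1 : b = i
      · subst h1; simp
      · simp [h1]
    simp_rw [e]
    rw [dif_neg h]
    simp

lemma inv_eq_pow (t : F) (ht : t ≠ 0) : t⁻¹ = t ^ (Fintype.card F - 2) := by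
  have h1 : 1 < Fintype.card F := Fintype.one_lt_card
  have h2 := FiniteField.pow_card_sub_one_eq_one t ht
  rw [show Fintype.card F - 1 = (Fintype.card F - 2) + 1 by omega, pow_succ] at h2
  exact (eq_inv_of_mul_eq_one_left h2).symm

def mm (F : Type) [Fintype F] (a : Fin g → ℕ) (i : Fin g) : ℕ := a i + (Fintype.card F - 2) * nx a i

lemma chi_hr' (a : Fin g → ℕ) (i : Fin g) (t : F) (ht : t ≠ 0) :
    chi a (hr i t) = t ^ mm F a i := by
  rw [chi_hr a i t ht, inv_eq_pow t ht, ← pow_mul, ← pow_add]; rfl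

lemma sum_chi [DecidableEq F] (a : Fin g → ℕ) (i : Fin g) :
    ∑ t : Fˣ, chi a (hr i (-t : F)) = if Fintype.card F - 1 ∣ mm F a i then -1 else 0 := by
  rw [← FiniteField.sum_pow_units F (mm F a i)]
  refine Fintype.sum_equiv (Equiv.neg _) _ _ fun t => ?_
  rw [chi_hr' _ _ _ (by simp)]; simp

lemma tele (a lam : Fin g → ℕ) (h : ∀ i, ∀ t : F, t ≠ 0 → t ^ lam i = t ^ mm F a i) (t : F)
    (ht : t ≠ 0) : ∀ (m : ℕ) (b : Fin g), (b : ℕ) + m + 1 = g →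
      t ^ (∑ i ∈ Finset.univ.filter (b ≤ ·), lam i) = t ^ a b := by
  have h' : ∀ i, t ^ lam i = t ^ a i * t⁻¹ ^ nx a i := fun i => by
    rw [h i t ht, ← chi_hr' a i t ht, chi_hr a i t ht]
  intro m
  induction m with
  | zero =>
    intro b hb
    have : Finset.univ.filter (b ≤ ·) = {b} := by
      ext c
      simp only [Finset.mem_filter, Finset.mem_univ, true_and, Finset.mem_singleton, Fin.le_def,
        Fin.ext_iff]
      have := c.2; omega
    rw [this, Finset.sum_singleton, h', nx, dif_neg (by omega)]; simp
  | succ m ih =>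
    intro b hb
    have hlt : (b : ℕ) + 1 < g := by omega
    have : Finset.univ.filter (b ≤ ·) =
        insert b (Finset.univ.filter ((⟨b + 1, hlt⟩ : Fin g) ≤ ·)) := by
      ext c
      simp only [Finset.mem_filter, Finset.mem_univ, true_and, Finset.mem_insert, Fin.le_def,
        Fin.ext_iff]
      omega
    rw [this, Finset.sum_insert (by simp [Fin.le_def]), pow_add, ih ⟨b + 1, hlt⟩ (by simp; omega),
      h', nx, dif_pos hlt, mul_assoc, ← mul_pow, inv_mul_cancel₀ ht, one_pow, mul_one]

lemma exists_lam (m : ℕ) : ∃ l, l ≠ 0 ∧ l ≤ Fintype.card F - 1 ∧ ∀ t : F, t ≠ 0 → t ^ l = t ^ m := by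
  have h1 : 1 < Fintype.card F := Fintype.one_lt_card
  set q := Fintype.card F - 1 with hq
  refine ⟨(m + (q - 1)) % q + 1, by omega, ?_, fun t ht => ?_⟩
  · have := Nat.mod_lt (m + (q - 1)) (show 0 < q by omega); omega
  · have h2 : t ^ q = 1 := FiniteField.pow_card_sub_one_eq_one t ht
    have h3 : t ^ ((m + (q - 1)) % q) = t ^ (m + (q - 1)) := (pow_eq_pow_mod _ h2).symm
    rw [pow_succ, h3, ← pow_succ, add_assoc, Nat.sub_add_cancel (by omega), pow_add, h2, mul_one]

theorem main_fn (p : ℕ) [Fact p.Prime] [CharP F p] [CharP k p] (cc : F →+* k) [Nontrivial V] :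
    ∃ (v : V) (φ : V →ₗ[k] k) (lam : Fin g → ℕ), v ≠ 0 ∧ φ ≠ 0 ∧
      (∀ i, lam i ≤ Fintype.card F - 1) ∧ ∀ A, φ (ρ A v) = φ v * cc (fl lam A) := by
  classical
  -- dual vector
  obtain ⟨φ, hφ0, hφ'⟩ : ∃ φ : Module.Dual k V, φ ≠ 0 ∧
      ∀ u : UU g F (-1), ρ.dual u φ = φ := by
    have := fixed_vec (p := p) (UU_isPGroup (g := g) (F := F) p (-1))
      (V := Module.Dual k V) (ρ.dual.comp (UU g F (-1)).subtype)
    exact this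
  have hφ : ∀ u ∈ UU g F (-1), ∀ x, φ (ρ u x) = φ x := by
    intro u hu x
    have := congrArg (fun f : Module.Dual k V => f x) (hφ' ⟨u⁻¹, inv_mem hu⟩)
    simpa [Representation.dual_apply, Module.Dual.transpose_apply] using this
  obtain ⟨v0, hv00, hv0⟩ := fixed_vec (p := p) (UU_isPGroup (g := g) (F := F) p 1)
      (V := V) (ρ.comp (UU g F 1).subtype)
  have hv0' : ∀ u ∈ UU g F 1, ρ u v0 = v0 := fun u hu => hv0 ⟨u, hu⟩
  obtain ⟨a0, ha0⟩ := exists_PP cc ρ v0 hv00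
  obtain ⟨v, hgood, hmin⟩ := exists_min ρ φ ⟨_, ha0, PP_U cc ρ hv0' a0, _, PP_wt cc ρ a0 v0⟩
  have hdi := dichotomy ρ φ cc hφ hgood hmin
  obtain ⟨hv, hU, χ, hχ⟩ := hgood
  obtain ⟨a, ha⟩ := exists_PP cc ρ v hv
  have hw : ∀ d, Mono 1 d → ρ d v = cc (chi a d) • v := by
    obtain ⟨m, hm⟩ := PP_eig cc ρ hχ a
    intro d hd
    have h1 := PP_wt cc ρ a v d hd
    rw [hm] at ha h1
    have hm0 : m ≠ 0 := fun h => ha (by rw [h, zero_smul])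
    rw [map_smul, smul_comm] at h1
    exact smul_right_injective V hm0 h1
  have key : ∀ i : Fin g, ∃ l, l ≤ Fintype.card F - 1 ∧ (∀ t : F, t ≠ 0 → t ^ l = t ^ mm F a i) ∧
      ((l ≠ 0 ∧ ∀ σ n, Mono σ n → φ (ρ n v) ≠ 0 → Pos σ i) ∨
       (l = 0 ∧ ∀ σ n, Mono σ n → Pos σ i → φ (ρ (n * sr F i) v) = φ (ρ n v))) := by
    intro i
    by_cases hA : ∀ σ n, Mono σ n → φ (ρ n v) ≠ 0 → Pos σ i
    · obtain ⟨l, hl0, hl, hl'⟩ := exists_lam (F := F) (mm F a i)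
      exact ⟨l, hl, hl', Or.inl ⟨hl0, hA⟩⟩
    · have hR := (hdi i).resolve_left hA
      have hrel : ∀ σ n, Mono σ n → Pos σ i → φ (ρ (n * sr F i) v) +
          cc (if Fintype.card F - 1 ∣ mm F a i then -1 else 0) * φ (ρ n v) = 0 := by
        intro σ n hn hp
        have := RR_pos ρ φ hφ i hU hw hn hp
        rw [hR, ← map_sum, sum_chi] at this
        rw [← this]; simp
      push Not at hA
      obtain ⟨σ, n, hn, hf, hp⟩ := hA
      have hd := hn.down i hp
      have hdvd : Fintype.card F - 1 ∣ mm F a i := by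
        by_contra hnd
        have := hrel _ _ hd.1 hd.2.1
        rw [if_neg hnd] at this
        simp at this
        exact hf this
      refine ⟨0, by omega, fun t ht => ?_, Or.inr ⟨rfl, fun σ n hn hp => ?_⟩⟩
      · obtain ⟨c, hc⟩ := hdvd
        rw [hc, pow_mul, FiniteField.pow_card_sub_one_eq_one t ht]; simp
      · have := hrel σ n hn hp
        rw [if_pos hdvd] at this
        simp only [map_neg, map_one] at this
        linear_combination this
  choose lam hl hl' hcase using key
  refine ⟨v, φ, lam, hv, hφ0, hl, ?_⟩
  have hN : ∀ (N : ℕ) σ n, Mono σ n → en n ≤ N → φ (ρ n v) = φ v * cc (fl lam n) := by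
    intro N
    induction N with
    | zero => 
      intro σ n hn hN
      by_cases hall : ∀ i, Pos σ i
      · have := all_pos hn hall
        subst this
        rw [hw n hn, map_smul, smul_eq_mul, mul_comm, fl_diag _ hn]
        congr 2
        unfold chi
        refine Finset.prod_congr rfl fun b _ => ?_
        exact (tele a lam hl' _ (hn.clean _).1 (g - 1 - b) b (by have := b.2; omega)).symm
      · push Not at hall
        obtain ⟨i, hi⟩ := hall
        have := (hn.down i hi).2.2
        omega
    | succ N ih =>
      intro σ n hn hN
      by_cases hall : ∀ i, Pos σ i
      · have := all_pos hn hall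
        subst this
        rw [hw n hn, map_smul, smul_eq_mul, mul_comm, fl_diag _ hn]
        congr 2
        unfold chi
        refine Finset.prod_congr rfl fun b _ => ?_
        exact (tele a lam hl' _ (hn.clean _).1 (g - 1 - b) b (by have := b.2; omega)).symm
      · push Not at hall
        obtain ⟨i, hi⟩ := hall
        have hd := hn.down i hi
        rcases hcase i with ⟨h0, hs⟩ | ⟨h0, hs⟩
        · rw [fl_zero lam hn i hi h0, map_zero, mul_zero]
          by_contra h'
          exact hi (hs σ n hn h')
        · have h1 := hs _ _ hd.1 hd.2.1
          have h2 := fl_s lam (n * (sr F i)⁻¹) i h0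
          rw [inv_mul_cancel_right] at h1 h2
          rw [h1, h2]
          exact ih _ _ hd.1 (by omega)
  intro A
  obtain ⟨u, hu, w, hw', n, ⟨σ, hn⟩, rfl⟩ := bruhat A
  rw [fl_U lam n hu hw', map_mul, Module.End.mul_apply, hU w hw', map_mul, Module.End.mul_apply,
    hφ u hu]
  exact hN _ σ n hn le_rfl

end mainfn
end SpB


namespace SpB
open Matrix

section concl
variable {k G T V : Type} [Field k] [Group G] [AddCommGroup T] [Module k T]
  [AddCommGroup V] [Module k V]

noncomputable def Th (τ : Representation k G T) (v : T) : (G →₀ k) →ₗ[k] T :=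
  Finsupp.linearCombination k (fun γ => τ γ v)

lemma Th_act (τ : Representation k G T) (v : T) (h : G) (a : G →₀ k) :
    τ h (Th τ v a) = Th τ v (a.mapDomain (h * ·)) := by
  unfold Th
  rw [Finsupp.linearCombination_mapDomain, Finsupp.linearCombination_apply,
    Finsupp.linearCombination_apply, map_finsuppSum]
  refine Finsupp.sum_congr fun γ _ => ?_
  simp

theorem concl (τ : Representation k G T) (v' : T) (ψ : T →ₗ[k] k) (f : G → k)
    (hψ : ∀ γ, ψ (τ γ v') = f γ) (ρ : Representation k G V) (v : V) (hv : v ≠ 0) (φ : V →ₗ[k] k)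
    (hφ0 : φ ≠ 0) (c : k) (hφ : ∀ γ, φ (ρ γ v) = c * f γ)
    (hirr : ∀ W : Submodule k V, (∀ γ x, x ∈ W → ρ γ x ∈ W) → W = ⊥ ∨ W = ⊤) :
    ∃ (W' W : Submodule k T) (hW : ∀ γ x, x ∈ W → τ γ x ∈ W)
        (_ : ∀ γ x, x ∈ W' → τ γ x ∈ W') (_ : W' ≤ W)
        (e : (W ⧸ Submodule.comap W.subtype W') ≃ₗ[k] V),
        ∀ (γ) (x : W), e (Submodule.Quotient.mk (⟨τ γ x, hW γ x x.2⟩ : W)) =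
            ρ γ (e (Submodule.Quotient.mk x)) := by
  have hker : LinearMap.ker (Th τ v') ≤ LinearMap.ker (Th ρ v) := by
    intro a ha
    rw [LinearMap.mem_ker] at ha ⊢
    let K : Submodule k V := ⨅ h, LinearMap.ker (φ ∘ₗ ρ h)
    have hmem : ∀ u, u ∈ K ↔ ∀ h, φ (ρ h u) = 0 := by
      intro u; simp [K, Submodule.mem_iInf]
    have hK : K = ⊥ := by
      rcases hirr K (fun γ x hx => by
        rw [hmem] at hx ⊢
        intro h
        have := hx (h * γ)
        rwa [map_mul, Module.End.mul_apply] at this) with h | h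
      · exact h
      · exfalso; apply hφ0; ext x
        have : x ∈ K := by rw [h]; trivial
        simpa using (hmem x).1 this 1
    have : Th ρ v a ∈ K := by
      rw [hmem]
      intro h
      have h1 : ψ (τ h (Th τ v' a)) = 0 := by rw [ha]; simp
      rw [Th_act] at h1 ⊢
      unfold Th at h1 ⊢
      rw [Finsupp.linearCombination_apply, map_finsuppSum] at h1 ⊢
      simp only [map_smul, hψ, hφ, smul_eq_mul] at h1 ⊢
      have : ∀ (b : G →₀ k), (b.sum fun γ r => r * (c * f γ)) = c * b.sum fun γ r => r * f γ := by
        intro b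
        rw [Finsupp.mul_sum]
        refine Finsupp.sum_congr fun γ _ => ?_
        ring
      rw [this, h1, mul_zero]
    rw [hK] at this
    simpa using this
  have hsurj : Function.Surjective (Th ρ v) := by
    rw [← LinearMap.range_eq_top]
    refine (hirr (LinearMap.range (Th ρ v)) ?_).resolve_left ?_
    · rintro γ _ ⟨a, rfl⟩
      rw [Th_act]; exact ⟨_, rfl⟩
    · intro h
      apply hv
      have : Th ρ v (Finsupp.single 1 1) ∈ LinearMap.range (Th ρ v) := ⟨_, rfl⟩
      rw [h] at this
      simpa [Th] using this
  let W := LinearMap.range (Th τ v')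
  let π : W →ₗ[k] V := ((LinearMap.ker (Th τ v')).liftQ (Th ρ v) hker) ∘ₗ
    ((Th τ v').quotKerEquivRange.symm : W →ₗ[k] _)
  have hπ : ∀ a (h : Th τ v' a ∈ W), π ⟨Th τ v' a, h⟩ = Th ρ v a := by
    intro a h
    show (LinearMap.ker (Th τ v')).liftQ (Th ρ v) hker ((Th τ v').quotKerEquivRange.symm
      ⟨Th τ v' a, h⟩) = _
    rw [LinearMap.quotKerEquivRange_symm_apply_image]
    simp
  have hW : ∀ γ x, x ∈ W → τ γ x ∈ W := by
    rintro γ _ ⟨a, rfl⟩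
    rw [Th_act]; exact ⟨_, rfl⟩
  have hπe : ∀ γ (x : W), π ⟨τ γ x, hW γ x x.2⟩ = ρ γ (π x) := by
    intro γ x
    obtain ⟨a, ha⟩ := x.2
    have hx : x = ⟨Th τ v' a, ⟨a, rfl⟩⟩ := Subtype.ext ha.symm
    have h3 : τ γ (x : T) = Th τ v' (a.mapDomain (γ * ·)) := by rw [← Th_act, ha]
    have h2 : (⟨τ γ x, hW γ x x.2⟩ : W) = ⟨Th τ v' (a.mapDomain (γ * ·)), ⟨_, rfl⟩⟩ :=
      Subtype.ext h3
    have e1 : π x = Th ρ v a := (congrArg π hx).trans (hπ a ⟨a, rfl⟩)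
    have e2 := (congrArg π h2).trans (hπ _ ⟨_, rfl⟩)
    rw [e2, e1, Th_act]
  have hπs : Function.Surjective π := by
    intro y
    obtain ⟨a, rfl⟩ := hsurj y
    exact ⟨⟨Th τ v' a, ⟨_, rfl⟩⟩, hπ _ _⟩
  have hcm : Submodule.comap W.subtype (Submodule.map W.subtype (LinearMap.ker π)) =
    LinearMap.ker π := Submodule.comap_map_eq_of_injective W.injective_subtype _
  refine ⟨Submodule.map W.subtype (LinearMap.ker π), W, hW, ?_, ?_,
    (Submodule.quotEquivOfEq _ _ hcm).trans (π.quotKerEquivOfSurjective hπs), ?_⟩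
  · rintro γ _ ⟨x, hx, rfl⟩
    refine ⟨⟨τ γ x, hW γ x x.2⟩, ?_, rfl⟩
    have hx : π x = 0 := hx
    show π _ = 0
    rw [hπe, hx, map_zero]
  · rintro _ ⟨x, _, rfl⟩; exact x.2
  · intro γ x
    exact hπe γ x

end concl

section tens
variable {ℓ g : ℕ} {k : Type} [Fact ℓ.Prime] [Field k] [CharP k ℓ]

def DD (M : ℕ) (v : (tensorPow (Rep.of (stdSp ℓ g k)) M : Type)) (f : Sp g (ZMod ℓ) → k) : Prop :=
  ∃ ψ : (tensorPow (Rep.of (stdSp ℓ g k)) M : Type) →ₗ[k] k,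
    ∀ γ, ψ ((tensorPow (Rep.of (stdSp ℓ g k)) M).ρ γ v) = f γ

lemma DD_sum {M : ℕ} {v : (tensorPow (Rep.of (stdSp ℓ g k)) M : Type)} {ι : Type} (s : Finset ι)
    (c : ι → k) (f : ι → Sp g (ZMod ℓ) → k) (h : ∀ i ∈ s, DD M v (f i)) :
    DD M v (fun γ => ∑ i ∈ s, c i * f i γ) := by
  classical
  choose! ψ hψ using h
  refine ⟨∑ i ∈ s, c i • ψ i, fun γ => ?_⟩
  rw [LinearMap.sum_apply]
  refine Finset.sum_congr rfl fun i hi => ?_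
  rw [LinearMap.smul_apply, hψ i hi, smul_eq_mul]

lemma std_app (γ : Sp g (ZMod ℓ)) (a b : Ix g) :
    stdSp ℓ g k γ (Pi.single b 1) a = ZMod.castHom (dvd_refl ℓ) k (γ.1 a b) := by
  have : stdSp ℓ g k γ (Pi.single b 1) =
    (γ.1.map (ZMod.castHom (dvd_refl ℓ) k)) *ᵥ (Pi.single b 1) := rfl
  rw [this, mulVec_single_one]
  rfl

lemma DD_step (M : ℕ) (v : (tensorPow (Rep.of (stdSp ℓ g k)) M : Type)) (b : Ix g) :
    ∃ v' : (tensorPow (Rep.of (stdSp ℓ g k)) (M + 1) : Type), ∀ (a : Ix g) f, DD M v f →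
      DD (M + 1) v' (fun γ => f γ * ZMod.castHom (dvd_refl ℓ) k (γ.1 a b)) := by
  refine ⟨(TensorProduct.tmul k v (Pi.single b 1 : Ix g → k) :
    TensorProduct k (tensorPow (Rep.of (stdSp ℓ g k)) M : Type) (Ix g → k)), ?_⟩
  rintro a f ⟨ψ, hψ⟩
  refine ⟨(LinearMap.mul' k k ∘ₗ TensorProduct.map ψ (LinearMap.proj a) :
    TensorProduct k (tensorPow (Rep.of (stdSp ℓ g k)) M : Type) (Ix g → k) →ₗ[k] k), fun γ => ?_⟩
  show (LinearMap.mul' k k ∘ₗ TensorProduct.map ψ (LinearMap.proj a))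
    (TensorProduct.map ((tensorPow (Rep.of (stdSp ℓ g k)) M).ρ γ) (stdSp ℓ g k γ)
      (TensorProduct.tmul k v (Pi.single b 1 : Ix g → k))) = _
  rw [TensorProduct.map_tmul, LinearMap.comp_apply, TensorProduct.map_tmul, LinearMap.mul'_apply,
    hψ, LinearMap.proj_apply, std_app]

lemma DD_prod (M : ℕ) (v : (tensorPow (Rep.of (stdSp ℓ g k)) M : Type)) (j : ℕ) (col : Fin j → Ix g) :
    ∃ v' : (tensorPow (Rep.of (stdSp ℓ g k)) (M + j) : Type), ∀ (row : Fin j → Ix g) f, DD M v f →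
      DD (M + j) v' (fun γ => f γ * ZMod.castHom (dvd_refl ℓ) k (∏ b, γ.1 (row b) (col b))) := by
  induction j with
  | zero => exact ⟨v, fun row f hf => by simpa using hf⟩
  | succ j ih =>
    obtain ⟨v1, h1⟩ := ih (fun b => col b.castSucc)
    obtain ⟨v2, h2⟩ := DD_step (M + j) v1 (col (Fin.last j))
    refine ⟨v2, fun row f hf => ?_⟩
    have := h2 (row (Fin.last j)) _ (h1 (fun b => row b.castSucc) f hf)
    simp_rw [Fin.prod_univ_castSucc, map_mul (ZMod.castHom (dvd_refl ℓ) k), ← mul_assoc]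
    exact this

def Ex (M : ℕ) (f : Sp g (ZMod ℓ) → k) : Prop := ∃ v, DD M v f

lemma Ex_mn {M : ℕ} {f : Sp g (ZMod ℓ) → k} (h : Ex M f) (j : ℕ) (hj : j ≤ g) :
    Ex (M + j) (fun γ => f γ * ZMod.castHom (dvd_refl ℓ) k (mn j hj γ)) := by
  obtain ⟨v, hv⟩ := h
  obtain ⟨v', hv'⟩ := DD_prod M v j (ii j hj)
  refine ⟨v', ?_⟩
  have := DD_sum (M := M + j) (v := v') Finset.univ
    (fun σ : Equiv.Perm (Fin j) => ((Equiv.Perm.sign σ : ℤ) : k))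
    (fun σ γ => f γ * ZMod.castHom (dvd_refl ℓ) k (∏ b, γ.1 (ii j hj (σ b)) (ii j hj b)))
    (fun σ _ => hv' _ f hv)
  convert this using 2 with γ
  unfold mn
  rw [det_apply', map_sum, Finset.mul_sum]
  refine Finset.sum_congr rfl fun σ _ => ?_
  simp only [map_mul, map_intCast, submatrix_apply]
  ring

lemma Ex_pow {M : ℕ} {f : Sp g (ZMod ℓ) → k} (h : Ex M f) (j : ℕ) (hj : j ≤ g) (m : ℕ) :
    Ex (M + j * m) (fun γ => f γ * ZMod.castHom (dvd_refl ℓ) k (mn j hj γ ^ m)) := by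
  induction m with
  | zero => simpa using h
  | succ m ih =>
    have := Ex_mn ih j hj
    simpa [pow_succ, mul_assoc, mul_add, add_assoc] using this

lemma Ex_one : Ex 0 (fun _ : Sp g (ZMod ℓ) => (1 : k)) :=
  ⟨(1 : k), (LinearMap.id : k →ₗ[k] k), fun _ => rfl⟩

lemma Ex_fl (lam : Fin g → ℕ) :
    Ex (∑ i : Fin g, ((i : ℕ) + 1) * lam i)
      (fun γ : Sp g (ZMod ℓ) => ZMod.castHom (dvd_refl ℓ) k (fl lam γ)) := by
  classical
  have : ∀ s : Finset (Fin g), Ex (∑ i ∈ s, ((i : ℕ) + 1) * lam i)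
      (fun γ : Sp g (ZMod ℓ) => ZMod.castHom (dvd_refl ℓ) k (∏ i ∈ s, mn (i + 1) i.2 γ ^ lam i)) := by
    intro s
    induction s using Finset.induction_on with
    | empty => simpa using Ex_one
    | insert i s hi ih =>
      have := Ex_pow ih (i + 1) i.2 (lam i)
      rw [Finset.sum_insert hi, add_comm]
      simp_rw [Finset.prod_insert hi, mul_comm (mn _ _ _ ^ _), map_mul (ZMod.castHom (dvd_refl ℓ) k)]
      exact this
  exact this Finset.univ

end tens
end SpB


/-- modular Burnside for `Sp_{2g}`: every finite-dimensional
irreducible `k`-linear representation of `G = Sp_{2g}(𝔽_ℓ)` (with `char k = ℓ`)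
is a composition factor of `Std^{⊗M}` for some `0 ≤ M ≤ ℓ·g(g+1)/2`: there are
`k[G]`-submodules `W' ⊆ W` of `(k^{2g})^{⊗M}` (i.e. `k`-submodules stable under
the diagonal `G`-action) with `W/W'` isomorphic to `V` as a `k[G]`-module. -/
theorem modular_burnside_Sp (ℓ : ℕ) (hℓ : ℓ.Prime) (k : Type) [Field k] [CharP k ℓ]
    (g : ℕ) (hg : 1 ≤ g)
    (V : Type) [AddCommGroup V] [Module k V] [FiniteDimensional k V] [Nontrivial V]
    (ρ : Representation k (Matrix.symplecticGroup (Fin g) (ZMod ℓ)) V)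
    (hirr : ∀ W : Submodule k V, (∀ γ x, x ∈ W → ρ γ x ∈ W) → W = ⊥ ∨ W = ⊤) :
    ∃ M, M ≤ ℓ * (g * (g + 1) / 2) ∧
      ∃ (W' W : Submodule k ((tensorPow (Rep.of (stdSp ℓ g k)) M) : Type))
        (hW : ∀ γ x, x ∈ W → (tensorPow (Rep.of (stdSp ℓ g k)) M).ρ γ x ∈ W)
        (_ : ∀ γ x, x ∈ W' → (tensorPow (Rep.of (stdSp ℓ g k)) M).ρ γ x ∈ W')
        (_ : W' ≤ W)
        (e : (W ⧸ Submodule.comap W.subtype W') ≃ₗ[k] V),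
        ∀ (γ) (x : W),
          e (Submodule.Quotient.mk
              (⟨(tensorPow (Rep.of (stdSp ℓ g k)) M).ρ γ x, hW γ x x.2⟩ : W)) =
            ρ γ (e (Submodule.Quotient.mk x)) := by
  have : Fact ℓ.Prime := ⟨hℓ⟩
  obtain ⟨v, φ, lam, hv, hφ0, hlam, hf⟩ := SpB.main_fn ρ ℓ (ZMod.castHom (dvd_refl ℓ) k)
  obtain ⟨v', ψ, hψ⟩ := SpB.Ex_fl (ℓ := ℓ) (g := g) (k := k) lam
  refine ⟨_, ?_, SpB.concl _ v' ψ _ hψ ρ v hv φ hφ0 _ hf hirr⟩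
  have h1 : ∑ i : Fin g, ((i : ℕ) + 1) * lam i ≤ ∑ i : Fin g, ((i : ℕ) + 1) * ℓ := by
    refine Finset.sum_le_sum fun i _ => Nat.mul_le_mul_left _ ?_
    have := hlam i
    rw [ZMod.card] at this
    omega
  have h2 : ∑ i : Fin g, ((i : ℕ) + 1) = g * (g + 1) / 2 := by
    rw [Fin.sum_univ_eq_sum_range (fun i => i + 1) g]
    have := Finset.sum_range_id (g + 1)
    rw [Finset.sum_range_succ'] at this
    simp only [add_zero, Nat.add_sub_cancel] at this
    rw [this, mul_comm]
  rw [← Finset.sum_mul, h2, mul_comm] at h1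
  exact h1
end

section
/- Let E ⊆ ℂ be a number field, t ≥ 1 an integer, r ≥ 4 an even integer, and P_1, …, P_t ∈ E[X] polynomials of degree r with pairwise disjoint root sets M_1, …, M_t ⊆ ℂ, where each M_i consists of r distinct numbers of modulus 1, none equal to ±1, closed under α ↦ α^{−1}. Write the roots of P_i as e(θ_{i,j}) and e(−θ_{i,j}) for 1 ≤ j ≤ r/2 with θ_{i,j} ∈ (0, 1/2). Let K ⊆ ℂ be the splitting field of P_1⋯P_t over E, and assume that the image of the permutation action of Gal(K/E) on M_1 ∪ ⋯ ∪ M_t is the full product of the centralizers in Sym(M_i) of the involutions α ↦ α^{−1}, a group of order (2^{r/2}(r/2)!)^t. Then the real numbers 1 and θ_{i,j} for 1 ≤ i ≤ t and 1 ≤ j ≤ r/2 are ℚ-linearly independent. -/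
/-- `e(x) = exp(2πix)`. -/
noncomputable def eReal (x : ℝ) : ℂ := Complex.exp (2 * Real.pi * Complex.I * x)


theorem eReal_add (x y : ℝ) : eReal (x + y) = eReal x * eReal y := by
  unfold eReal; rw [← Complex.exp_add]; push_cast; ring_nf

theorem eReal_ne (x : ℝ) : eReal x ≠ 0 := Complex.exp_ne_zero _

theorem eReal_zero : eReal 0 = 1 := by simp [eReal]

theorem eReal_neg (x : ℝ) : eReal (-x) = (eReal x)⁻¹ := by
  unfold eReal; rw [← Complex.exp_neg]; push_cast; ring_nf

theorem eReal_int_mul (n : ℤ) (x : ℝ) : eReal (n * x) = eReal x ^ n := by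
  unfold eReal; rw [← Complex.exp_int_mul]; push_cast; ring_nf

theorem eReal_int (n : ℤ) : eReal n = 1 := by
  unfold eReal
  rw [Complex.exp_eq_one_iff]
  exact ⟨n, by push_cast; ring⟩

theorem eReal_sum {ι : Type*} (s : Finset ι) (f : ι → ℝ) :
    eReal (∑ i ∈ s, f i) = ∏ i ∈ s, eReal (f i) := by
  classical
  induction s using Finset.induction_on with
  | empty => simp [eReal_zero]
  | insert a s ha ih => rw [Finset.sum_insert ha, Finset.prod_insert ha, eReal_add, ih]

theorem inv_ne_self_of {α : ℂ} (h0 : α ≠ 0) (h1 : α ≠ 1) (hm : α ≠ -1) : α⁻¹ ≠ α := by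
  intro h
  have h2 : α * α = 1 := by
    nth_rewrite 2 [← h]
    exact mul_inv_cancel₀ h0
  rcases mul_self_eq_one_iff.mp h2 with h | h
  · exact h1 h
  · exact hm h

/-- for `t` degree-`r` polynomials (`r ≥ 4` even) over a number
field `E ⊆ ℂ` with pairwise disjoint root sets, each consisting of `r` distinct
numbers of modulus `1` of the form `e(±θ_{i,j})` with `θ_{i,j} ∈ (0,1/2)`
(hence avoiding `±1`, and closed under inversion), if the Galois action on the
roots is the full product of hyperoctahedral groups of order `(2^{r/2}(r/2)!)^t`,
then `1` and the `θ_{i,j}` are ℚ-linearly independent. -/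
theorem angles_linear_independence_hyperoctahedral
    (E : IntermediateField ℚ ℂ) [FiniteDimensional ℚ E]
    (t r : ℕ) (ht : 1 ≤ t) (hr : 4 ≤ r) (hre : Even r)
    (P : Fin t → Polynomial E) (hdeg : ∀ i, (P i).natDegree = r)
    (θ : Fin t → Fin (r / 2) → ℝ) (hθ : ∀ i j, θ i j ∈ Set.Ioo (0 : ℝ) (1 / 2))
    (roots : Fin t → Finset ℂ)
    (hroots : ∀ i, ∀ α : ℂ, α ∈ roots i ↔ Polynomial.aeval α (P i) = 0)
    (hcard : ∀ i, (roots i).card = r)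
    (hparam : ∀ i, ∀ α : ℂ, α ∈ roots i ↔ ∃ j, α = eReal (θ i j) ∨ α = eReal (-θ i j))
    (h1 : ∀ i, (1 : ℂ) ∉ roots i) (hm1 : ∀ i, (-1 : ℂ) ∉ roots i)
    (hinv : ∀ i, ∀ α ∈ roots i, α⁻¹ ∈ roots i)
    (hdisj : ∀ i j, i ≠ j → Disjoint (roots i) (roots j))
    (hGal : ∀ τ : Equiv.Perm ℂ, (∀ i, ∀ α ∈ roots i, τ α ∈ roots i) →
      (∀ i, ∀ α ∈ roots i, τ α⁻¹ = (τ α)⁻¹) →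
      ∃ g : ℂ ≃ₐ[E] ℂ, ∀ i, ∀ α ∈ roots i, g α = τ α) :
    LinearIndependent ℚ (fun x : Option (Fin t × Fin (r / 2)) =>
      x.elim (1 : ℝ) (fun p => θ p.1 p.2)) := by
  classical
  set A : Fin t × Fin (r / 2) → ℂ := fun p => eReal (θ p.1 p.2) with hA
  have hA0 : ∀ p, A p ≠ 0 := fun p => eReal_ne _
  have hAm : ∀ p, A p ∈ roots p.1 := fun p => (hparam _ _).2 ⟨p.2, Or.inl rfl⟩
  have hAi : ∀ p, (A p)⁻¹ ∈ roots p.1 := fun p => hinv _ _ (hAm p)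
  have hne : ∀ p, (A p)⁻¹ ≠ A p := fun p =>
    inv_ne_self_of (hA0 p) (fun h => h1 p.1 (h ▸ hAm p)) (fun h => hm1 p.1 (h ▸ hAm p))
  have hdis : ∀ p q, p ≠ q → A p ≠ A q ∧ A p ≠ (A q)⁻¹ := by
    rintro ⟨i, j⟩ ⟨a, b⟩ hpq
    by_cases hia : i = a
    · subst hia
      have hjb : j ≠ b := fun h => hpq (by rw [h])
      let F : Fin (r / 2) × Bool → ℂ := fun x => if x.2 then A (i, x.1) else (A (i, x.1))⁻¹
      have himg : Finset.univ.image F = roots i := by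
        ext α
        rw [hparam]
        simp only [Finset.mem_image, Finset.mem_univ, true_and, Prod.exists, Bool.exists_bool, F, hA,
          eReal_neg]
        constructor
        · rintro ⟨k, h | h⟩
          · exact ⟨k, Or.inr (by simpa using h.symm)⟩
          · exact ⟨k, Or.inl (by simpa using h.symm)⟩
        · rintro ⟨k, h | h⟩
          · exact ⟨k, Or.inr (by simpa using h.symm)⟩
          · exact ⟨k, Or.inl (by simpa using h.symm)⟩
      have hinj : Function.Injective F := by
        have : Set.InjOn F (Finset.univ : Finset (Fin (r / 2) × Bool)) := by
          rw [← Finset.card_image_iff, himg, hcard]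
          simp
          obtain ⟨k, hk⟩ := hre
          omega
        intro x y h
        exact this (by simp) (by simp) h
      constructor
      · intro h
        have := @hinj (j, true) (b, true) (by simpa [F] using h)
        exact hjb (congrArg Prod.fst this)
      · intro h
        have := @hinj (j, true) (b, false) (by simpa [F] using h)
        exact hjb (congrArg Prod.fst this)
    · have hd := Finset.disjoint_left.1 (hdisj i a hia)
      exact ⟨fun h => hd (hAm (i, j)) (h ▸ hAm (a, b)), fun h => hd (hAm (i, j)) (h ▸ hAi (a, b))⟩
  have hsame : ∀ i k α, α ∈ roots i → α ∈ roots k → i = k := by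
    intro i k α h h'
    by_contra hik
    exact Finset.disjoint_left.1 (hdisj i k hik) h h'
  -- flips
  have flip : ∀ q, ∃ g : ℂ ≃ₐ[E] ℂ, g (A q) = (A q)⁻¹ ∧ ∀ p, p ≠ q → g (A p) = A p := by
    intro q
    obtain ⟨g, hg⟩ := hGal (Equiv.swap (A q) (A q)⁻¹) (by
        intro i α hα
        by_cases e1 : α = A q
        · rw [e1, Equiv.swap_apply_left, ← e1]; exact hinv _ _ hα
        by_cases e2 : α = (A q)⁻¹
        · have := hinv _ _ hα
          rw [e2, inv_inv] at this
          rw [e2, Equiv.swap_apply_right]; exact this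
        rwa [Equiv.swap_apply_of_ne_of_ne e1 e2]) (by
        intro i α hα
        by_cases e1 : α = A q
        · rw [e1, Equiv.swap_apply_left, Equiv.swap_apply_right, inv_inv]
        by_cases e2 : α = (A q)⁻¹
        · rw [e2, inv_inv, Equiv.swap_apply_left, Equiv.swap_apply_right]
        rw [Equiv.swap_apply_of_ne_of_ne e1 e2, Equiv.swap_apply_of_ne_of_ne]
        · intro h; exact e2 (by rw [← h, inv_inv])
        · intro h; exact e1 (inv_injective h))
    refine ⟨g, ?_, fun p hp => ?_⟩
    · rw [hg _ _ (hAm q), Equiv.swap_apply_left]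
    · rw [hg _ _ (hAm p), Equiv.swap_apply_of_ne_of_ne (hdis p q hp).1 (hdis p q hp).2]
  -- transpositions
  have trans : ∀ a b c, b ≠ c → ∃ g : ℂ ≃ₐ[E] ℂ, g (A (a, b)) = A (a, c) := by
    intro a b c hbc
    have hd := hdis (a, b) (a, c) (fun h => hbc (congrArg Prod.snd h))
    have hx := hne (a, b)
    have hy := hne (a, c)
    have mx := hAm (a, b)
    have my := hAm (a, c)
    have mx' := hAi (a, b)
    have my' := hAi (a, c)
    generalize A (a, b) = x at *
    generalize A (a, c) = y at *
    simp only at mx my mx' my'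
    obtain ⟨hd1, hd2⟩ := hd
    have hd3 : x⁻¹ ≠ y := fun h => hd2 (by rw [← h, inv_inv])
    have hd4 : x⁻¹ ≠ y⁻¹ := fun h => hd1 (inv_injective h)
    have ex : (Equiv.swap x y * Equiv.swap x⁻¹ y⁻¹) x = y := by
      rw [Equiv.Perm.mul_apply, Equiv.swap_apply_of_ne_of_ne hx.symm hd2, Equiv.swap_apply_left]
    have ey : (Equiv.swap x y * Equiv.swap x⁻¹ y⁻¹) y = x := by
      rw [Equiv.Perm.mul_apply, Equiv.swap_apply_of_ne_of_ne hd3.symm hy.symm, Equiv.swap_apply_right]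
    have ex' : (Equiv.swap x y * Equiv.swap x⁻¹ y⁻¹) x⁻¹ = y⁻¹ := by
      rw [Equiv.Perm.mul_apply, Equiv.swap_apply_left, Equiv.swap_apply_of_ne_of_ne hd2.symm hy]
    have ey' : (Equiv.swap x y * Equiv.swap x⁻¹ y⁻¹) y⁻¹ = x⁻¹ := by
      rw [Equiv.Perm.mul_apply, Equiv.swap_apply_right, Equiv.swap_apply_of_ne_of_ne hx hd3]
    have ez : ∀ z, z ≠ x → z ≠ y → z ≠ x⁻¹ → z ≠ y⁻¹ →
        (Equiv.swap x y * Equiv.swap x⁻¹ y⁻¹) z = z := by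
      intro z h1 h2 h3 h4
      rw [Equiv.Perm.mul_apply, Equiv.swap_apply_of_ne_of_ne h3 h4, Equiv.swap_apply_of_ne_of_ne h1 h2]
    generalize Equiv.swap x y * Equiv.swap x⁻¹ y⁻¹ = τ at *
    obtain ⟨g, hg⟩ := hGal τ (by
        intro i α hα
        by_cases e1 : α = x
        · subst e1; rw [ex, hsame _ _ _ hα mx]; exact my
        by_cases e2 : α = y
        · subst e2; rw [ey, hsame _ _ _ hα my]; exact mx
        by_cases e3 : α = x⁻¹
        · subst e3; rw [ex', hsame _ _ _ hα mx']; exact my'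
        by_cases e4 : α = y⁻¹
        · subst e4; rw [ey', hsame _ _ _ hα my']; exact mx'
        rwa [ez _ e1 e2 e3 e4]) (by
        intro i α hα
        by_cases e1 : α = x
        · subst e1; rw [ex, ex']
        by_cases e2 : α = y
        · subst e2; rw [ey, ey']
        by_cases e3 : α = x⁻¹
        · subst e3; rw [ex', inv_inv, inv_inv, ex]
        by_cases e4 : α = y⁻¹
        · subst e4; rw [ey', inv_inv, inv_inv, ey]
        rw [ez _ e1 e2 e3 e4, ez]
        · intro h; exact e3 (by rw [← h, inv_inv])
        · intro h; exact e4 (by rw [← h, inv_inv])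
        · intro h; exact e1 (inv_injective h)
        · intro h; exact e2 (inv_injective h))
    exact ⟨g, by rw [hg _ _ mx, ex]⟩
  -- no root is a root of unity
  have noru : ∀ q (k : ℕ), 0 < k → A q ^ k ≠ 1 := by
    rintro ⟨a, b⟩ k hk hpow
    obtain ⟨c, hc⟩ : ∃ c : Fin (r / 2), b ≠ c := by
      haveI : Nontrivial (Fin (r / 2)) := Fin.nontrivial_iff_two_le.2 (by omega)
      obtain ⟨c, hc⟩ := exists_ne b
      exact ⟨c, hc.symm⟩
    obtain ⟨g, hg⟩ := trans a b c hc
    have hprim := IsPrimitiveRoot.orderOf (A (a, b))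
    have hpos : 0 < orderOf (A (a, b)) := orderOf_pos_iff.2 (isOfFinOrder_iff_pow_eq_one.2 ⟨k, hk, hpow⟩)
    haveI : NeZero (orderOf (A (a, b))) := ⟨hpos.ne'⟩
    have hprim2 : IsPrimitiveRoot (A (a, c)) (orderOf (A (a, b))) := by
      have := hprim.map_of_injective (f := g) g.injective
      rwa [hg] at this
    obtain ⟨m, -, hm⟩ := hprim2.eq_pow_of_pow_eq_one hprim.pow_eq_one
    obtain ⟨f, hf1, hf2⟩ := flip (a, b)
    have := hf2 (a, c) (fun h => hc (congrArg Prod.snd h).symm)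
    apply hne (a, b)
    rw [← hf1, ← hm, map_pow, this]
  rw [← LinearIndependent.iff_fractionRing ℤ ℚ, Fintype.linearIndependent_iff]
  intro n hn
  rw [Fintype.sum_option] at hn
  simp only [Option.elim_none, Option.elim_some, zsmul_eq_mul, mul_one] at hn
  have hprod : ∏ p, A p ^ n (some p) = 1 := by
    have := eReal_add (n none) (∑ p : Fin t × Fin (r / 2), (n (some p) : ℝ) * θ p.1 p.2)
    rw [hn, eReal_zero, eReal_int, one_mul, eReal_sum] at this
    rw [this]
    exact Finset.prod_congr rfl fun p _ => (eReal_int_mul _ _).symm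
  have hall : ∀ q, n (some q) = 0 := by
    intro q
    by_contra hq
    obtain ⟨f, hf1, hf2⟩ := flip q
    have h2 := congrArg f hprod
    rw [map_prod, map_one, ← Finset.mul_prod_erase _ _ (Finset.mem_univ q)] at h2
    rw [← Finset.mul_prod_erase _ _ (Finset.mem_univ q)] at hprod
    rw [Finset.prod_congr rfl (g := fun p => A p ^ n (some p)) (fun p hp => by
      rw [map_zpow₀, hf2 p (Finset.ne_of_mem_erase hp)]), map_zpow₀, hf1] at h2
    have hR : ∏ p ∈ Finset.univ.erase q, A p ^ n (some p) ≠ 0 := right_ne_zero_of_mul_eq_one h2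
    have h3 := mul_right_cancel₀ hR (hprod.trans h2.symm)
    have h4 : A q ^ (2 * n (some q)) = 1 := by
      rw [two_mul, zpow_add₀ (hA0 q)]
      nth_rewrite 1 [h3]
      rw [inv_zpow, inv_mul_cancel₀ (zpow_ne_zero _ (hA0 q))]
    have h5 : A q ^ (2 * n (some q)).natAbs = 1 := by
      rcases Int.natAbs_eq (2 * n (some q)) with h | h
      · rw [h, zpow_natCast] at h4; exact h4
      · rw [h, zpow_neg, zpow_natCast, inv_eq_one] at h4; exact h4
    exact noru q _ (by omega) h5
  rintro (_ | q)
  · simp only [hall, Int.cast_zero, zero_mul, Finset.sum_const_zero, add_zero] at hn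
    exact_mod_cast hn
  · exact hall q
end

section
/- Let s ≥ 1 and let θ_1, …, θ_s, φ_1, …, φ_s be real numbers such that the 2s+1 numbers 1, θ_1, …, θ_s, φ_1, …, φ_s are ℚ-linearly independent. For n ≥ 1 set a_n = ∑_{j=1}^{s} 2cos(2πnθ_j) and b_n = ∑_{j=1}^{s} 2cos(2πnφ_j). Then (1/N)·|{1 ≤ n ≤ N : a_n < b_n}| → 1/2 as N → ∞. -/
open Filter

namespace NoBias
open MeasureTheory UnitAddTorus

noncomputable def mu (d : Type) [Fintype d] : Measure (UnitAddTorus d) :=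
  Measure.pi (fun _ : d => (AddCircle.haarAddCircle : Measure UnitAddCircle))

instance (d : Type) [Fintype d] : IsProbabilityMeasure (mu d) := by
  unfold mu; infer_instance

instance (d : Type) [Fintype d] : (mu d).IsAddLeftInvariant := by
  unfold mu; infer_instance

lemma haar_singleton (t : UnitAddCircle) :
    (AddCircle.haarAddCircle : Measure UnitAddCircle) {t} = 0 := by
  have h := AddCircle.volume_closedBall (T := (1:ℝ)) (x := t) 0
  rw [AddCircle.volume_eq_smul_haarAddCircle] at h
  simpa using h

lemma haar_re (c : ℝ) :
    (AddCircle.haarAddCircle : Measure UnitAddCircle)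
      {t | (fourier 1 t : ℂ).re = c} = 0 := by
  have hfin : ({t : UnitAddCircle | (fourier 1 t : ℂ).re = c}).Finite := by
    have hinj : Function.Injective (fun t : UnitAddCircle => (fourier 1 t : ℂ)) := by
      intro a b hab
      simp only [fourier_one] at hab
      exact AddCircle.injective_toCircle one_ne_zero (Subtype.coe_injective hab)
    refine Set.Finite.subset (Set.Finite.preimage hinj.injOn
      (Set.toFinite ({⟨c, √(1 - c^2)⟩, ⟨c, -√(1 - c^2)⟩} : Set ℂ))) ?_
    intro t ht
    have hn : ‖(fourier 1 t : ℂ)‖ = 1 := by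
      rw [fourier_apply]; exact Circle.norm_coe _
    have h2 : (fourier 1 t : ℂ).re ^ 2 + (fourier 1 t : ℂ).im ^ 2 = 1 := by
      have := Complex.sq_norm (fourier 1 t : ℂ)
      rw [hn, Complex.normSq_apply] at this
      nlinarith
    have ht' : (fourier 1 t : ℂ).re = c := ht
    rw [ht'] at h2
    have h3 : √(1 - c^2) ^ 2 = (fourier 1 t : ℂ).im ^ 2 := by
      rw [Real.sq_sqrt] <;> nlinarith [sq_nonneg (fourier 1 t : ℂ).im]
    rcases sq_eq_sq_iff_eq_or_eq_neg.1 h3 with h | h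
    · left; exact Complex.ext ht' h.symm
    · right; exact Complex.ext ht' (by simp [h])
  have : NullSingletonClass (AddCircle.haarAddCircle : Measure UnitAddCircle) := ⟨haar_singleton⟩
  exact hfin.measure_zero _

lemma mFourier_coe {d : Type} [Fintype d] (k : d → ℤ) (α : d → ℝ) :
    mFourier k (fun i => (α i : UnitAddCircle))
      = Complex.exp (2 * Real.pi * Complex.I * ((∑ i, k i * α i : ℝ) : ℂ)) := by
  simp only [mFourier, ContinuousMap.coe_mk, fourier_coe_apply]
  rw [← Complex.exp_sum]
  congr 1
  push_cast
  rw [Finset.mul_sum]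
  refine Finset.sum_congr rfl fun i _ => ?_
  ring_nf

lemma mFourier_add' {d : Type} [Fintype d] (k : d → ℤ) (x y : UnitAddTorus d) :
    mFourier k (x + y) = mFourier k x * mFourier k y := by
  simp only [mFourier, ContinuousMap.coe_mk, fourier_apply, Pi.add_apply, smul_add,
    AddCircle.toCircle_add, Circle.coe_mul, Finset.prod_mul_distrib]

lemma mFourier_nsmul {d : Type} [Fintype d] (k : d → ℤ) (x : UnitAddTorus d) (n : ℕ) :
    mFourier k (n • x) = mFourier k x ^ n := by
  induction n with
  | zero => simp [mFourier]
  | succ n ih => rw [succ_nsmul, mFourier_add', ih, pow_succ]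

noncomputable def nu {d : Type} (x : UnitAddTorus d) (N : ℕ) : Measure (UnitAddTorus d) :=
  ((N + 1 : ℕ) : ENNReal)⁻¹ • ∑ n ∈ Finset.Icc 1 (N + 1), Measure.dirac (n • x)

instance {d : Type} (x : UnitAddTorus d) (N : ℕ) : IsProbabilityMeasure (nu x N) := by
  constructor
  simp only [nu, Measure.smul_apply, Measure.finsetSum_apply, measure_univ, Finset.sum_const,
    Nat.card_Icc, smul_eq_mul, nsmul_eq_mul, mul_one, Nat.add_sub_cancel]
  exact ENNReal.inv_mul_cancel (by simp) (ENNReal.natCast_ne_top _)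

lemma integral_nu {d : Type} [Fintype d] (x : UnitAddTorus d) (N : ℕ) (f : C(UnitAddTorus d, ℂ)) :
    ∫ y, f y ∂(nu x N) = ((N + 1 : ℕ) : ℂ)⁻¹ * ∑ n ∈ Finset.Icc 1 (N + 1), f (n • x) := by
  rw [nu, integral_smul_measure, integral_finsetSum_measure]
  · rw [ENNReal.toReal_inv, ENNReal.toReal_natCast]
    simp [integral_dirac]
  · intro i _
    exact f.continuous.integrable_of_hasCompactSupport (HasCompactSupport.of_compactSpace _)

lemma norm_int_le {d : Type} [Fintype d] (m : Measure (UnitAddTorus d)) [IsProbabilityMeasure m]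
    (f g : C(UnitAddTorus d, ℂ)) : ‖∫ y, f y ∂m - ∫ y, g y ∂m‖ ≤ ‖f - g‖ := by
  have hi : ∀ f : C(UnitAddTorus d, ℂ), Integrable f m := fun f =>
    f.continuous.integrable_of_hasCompactSupport (HasCompactSupport.of_compactSpace _)
  rw [← integral_sub (hi f) (hi g)]
  refine (norm_integral_le_of_norm_le_const (C := ‖f - g‖)
    (Eventually.of_forall fun y => ?_)).trans (by simp)
  exact (f - g).norm_coe_le_norm y

lemma tendsto_char {d : Type} [Fintype d] (x : UnitAddTorus d)
    (hx : ∀ k : d → ℤ, k ≠ 0 → mFourier k x ≠ 1) (k : d → ℤ) :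
    Tendsto (fun N => ∫ y, mFourier k y ∂(nu x N)) atTop (nhds (∫ y, mFourier k y ∂(mu d))) := by
  by_cases hk : k = 0
  · subst hk
    simp [mFourier_zero]
  have hz := hx k hk
  have h0 : ∫ y, mFourier k y ∂(mu d) = 0 := by
    have h := integral_add_left_eq_self (μ := mu d) (fun y => mFourier k y) x
    simp only [mFourier_add'] at h
    rw [integral_const_mul] at h
    have : (mFourier k x - 1) * ∫ y, mFourier k y ∂(mu d) = 0 := by rw [sub_mul, h]; ring
    exact (mul_eq_zero.1 this).resolve_left (sub_ne_zero.2 hz)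
  rw [h0]
  simp only [integral_nu, mFourier_nsmul]
  set z := mFourier k x with hzdef
  have hzn : ‖z‖ = 1 := by
    simp only [hzdef, mFourier, ContinuousMap.coe_mk, fourier_apply, norm_prod]
    exact Finset.prod_eq_one fun i _ => Circle.norm_coe _
  have hb : ∀ N : ℕ, ‖((N + 1 : ℕ) : ℂ)⁻¹ * ∑ n ∈ Finset.Icc 1 (N + 1), z ^ n‖
      ≤ (2 / ‖z - 1‖) * (1 / ((N : ℝ) + 1)) := by
    intro N
    have hs : ∑ n ∈ Finset.Icc 1 (N + 1), z ^ n = z * ((z ^ (N + 1) - 1) / (z - 1)) := by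
      rw [← geom_sum_eq hz, Finset.mul_sum, Finset.range_eq_Ico,
        ← Finset.Ico_add_one_right_eq_Icc, Finset.sum_Ico_eq_sum_range, Finset.range_eq_Ico]
      simp [pow_add]
    rw [hs, norm_mul, norm_mul, norm_div, hzn, norm_inv, Complex.norm_natCast, one_mul]
    have : ‖z ^ (N + 1) - 1‖ ≤ 2 := by
      refine (norm_sub_le _ _).trans ?_
      rw [norm_pow, hzn]; norm_num
    push_cast
    rw [mul_comm, one_div]
    gcongr
  refine squeeze_zero_norm hb ?_
  simpa using tendsto_one_div_add_atTop_nhds_zero_nat.const_mul (2 / ‖z - 1‖)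

lemma tendsto_cont {d : Type} [Fintype d] (x : UnitAddTorus d)
    (hx : ∀ k : d → ℤ, k ≠ 0 → mFourier k x ≠ 1) (f : C(UnitAddTorus d, ℂ)) :
    Tendsto (fun N => ∫ y, f y ∂(nu x N)) atTop (nhds (∫ y, f y ∂(mu d))) := by
  have hi : ∀ (m : Measure (UnitAddTorus d)) [IsProbabilityMeasure m]
      (f : C(UnitAddTorus d, ℂ)), Integrable f m := fun m _ f =>
    f.continuous.integrable_of_hasCompactSupport (HasCompactSupport.of_compactSpace _)
  have hspan : ∀ g ∈ Submodule.span ℂ (Set.range (mFourier (d := d))),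
      Tendsto (fun N => ∫ y, g y ∂(nu x N)) atTop (nhds (∫ y, g y ∂(mu d))) := by
    intro g hg
    induction hg using Submodule.span_induction with
    | mem g hg => obtain ⟨k, rfl⟩ := hg; exact tendsto_char x hx k
    | zero => simp
    | add g h _ _ hg hh =>
      simp only [ContinuousMap.add_apply]
      rw [integral_add (hi _ g) (hi _ h)]
      refine (hg.add hh).congr fun N => ?_
      rw [integral_add (hi _ g) (hi _ h)]
    | smul c g _ hg =>
      simp only [ContinuousMap.smul_apply, integral_smul]
      exact hg.const_smul c
  have hf : f ∈ closure (Submodule.span ℂ (Set.range (mFourier (d := d))) : Set _) := by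
    rw [← Submodule.topologicalClosure_coe, span_mFourier_closure_eq_top]; trivial
  rw [Metric.tendsto_atTop]
  intro ε hε
  obtain ⟨g, hg, hfg⟩ := Metric.mem_closure_iff.1 hf (ε / 3) (by positivity)
  obtain ⟨N₀, hN⟩ := Metric.tendsto_atTop.1 (hspan g hg) (ε / 3) (by positivity)
  refine ⟨N₀, fun N hN' => ?_⟩
  have h1 := norm_int_le (nu x N) f g
  have h2 := norm_int_le (mu d) f g
  have h3 := hN N hN'
  rw [dist_eq_norm] at hfg
  rw [← dist_eq_norm] at h1 h2
  have h4 := dist_triangle4_right (∫ y, f y ∂(nu x N)) (∫ y, f y ∂(mu d))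
    (∫ y, g y ∂(nu x N)) (∫ y, g y ∂(mu d))
  linarith

noncomputable def F (s : ℕ) (x : UnitAddTorus (Fin s ⊕ Fin s)) : ℝ :=
  ∑ j, (fourier 1 (x (Sum.inl j)) : ℂ).re - ∑ j, (fourier 1 (x (Sum.inr j)) : ℂ).re

lemma F_cont (s : ℕ) : Continuous (F s) := by
  unfold F
  fun_prop

lemma F_zero_null (s : ℕ) (hs : 1 ≤ s) : mu (Fin s ⊕ Fin s) {x | F s x = 0} = 0 := by
  classical
  have hm : MeasurableSet {x | F s x = 0} := (isClosed_eq (F_cont s) continuous_const).measurableSet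
  let i : Fin s ⊕ Fin s := Sum.inl ⟨0, hs⟩
  rw [← lintegral_indicator_one hm, mu,
    lintegral_eq_lmarginal_univ (0 : UnitAddTorus (Fin s ⊕ Fin s)),
    lmarginal_erase' _ (measurable_one.indicator hm) (Finset.mem_univ i)]
  have : ∀ x : UnitAddTorus (Fin s ⊕ Fin s),
      ∫⁻ t, ({x | F s x = 0}.indicator (1 : UnitAddTorus (Fin s ⊕ Fin s) → ENNReal) (Function.update x i t))
        ∂(AddCircle.haarAddCircle : Measure UnitAddCircle) = 0 := by
    intro x
    have hF : ∀ t, F s (Function.update x i t) = (fourier 1 t : ℂ).re +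
        (F s x - (fourier 1 (x i) : ℂ).re) := by
      intro t
      unfold F
      rw [← Finset.add_sum_erase _ _ (Finset.mem_univ (⟨0, hs⟩ : Fin s)),
        ← Finset.add_sum_erase _ (fun j => (fourier 1 (x (Sum.inl j)) : ℂ).re)
          (Finset.mem_univ (⟨0, hs⟩ : Fin s))]
      have h1 : ∀ j, Function.update x i t (Sum.inr j) = x (Sum.inr j) := fun j => by simp [i]
      have h2 : ∑ j ∈ Finset.univ.erase (⟨0, hs⟩ : Fin s),
          (fourier 1 (Function.update x i t (Sum.inl j)) : ℂ).re
          = ∑ j ∈ Finset.univ.erase (⟨0, hs⟩ : Fin s), (fourier 1 (x (Sum.inl j)) : ℂ).re := by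
        refine Finset.sum_congr rfl fun j hj => ?_
        rw [Function.update_of_ne]
        intro h
        exact (Finset.ne_of_mem_erase hj) (Sum.inl_injective h)
      have h3 : Function.update x i t (Sum.inl ⟨0, hs⟩) = t := Function.update_self i t x
      rw [h2, h3]
      simp only [h1, i]
      ring
    have hnull := haar_re (-(F s x - (fourier 1 (x i) : ℂ).re))
    rw [lintegral_eq_zero_of_ae_eq_zero]
    have : ∀ᵐ t ∂(AddCircle.haarAddCircle : Measure UnitAddCircle),
        t ∉ {t | (fourier 1 t : ℂ).re = -(F s x - (fourier 1 (x i) : ℂ).re)} :=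
      measure_eq_zero_iff_ae_notMem.1 hnull
    filter_upwards [this] with t ht
    simp only [Pi.zero_apply]
    apply Set.indicator_of_notMem
    intro h
    apply ht
    have h' : F s (Function.update x i t) = 0 := h
    rw [hF] at h'
    change (fourier 1 t : ℂ).re = _
    linarith
  simp only [this]
  simp [lmarginal]

lemma F_half (s : ℕ) (hs : 1 ≤ s) : mu (Fin s ⊕ Fin s) {x | F s x < 0} = 1 / 2 := by
  have hsym : mu (Fin s ⊕ Fin s) {x | 0 < F s x} = mu (Fin s ⊕ Fin s) {x | F s x < 0} := by
    let c : UnitAddTorus (Fin s ⊕ Fin s) := fun _ => ((1 / 2 : ℝ) : UnitAddCircle)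
    rw [← measure_preimage_add (mu (Fin s ⊕ Fin s)) c {x | F s x < 0}]
    congr 1
    ext x
    have hf : ∀ t : UnitAddCircle, fourier 1 (((1 / 2 : ℝ) : UnitAddCircle) + t)
        = - fourier 1 t := by
      intro t
      have := fourier_add_half_inv_index (T := (1:ℝ)) (n := 1) one_ne_zero one_pos t
      rw [add_comm]
      simpa using this
    have : F s (c + x) = - F s x := by
      simp only [F, Pi.add_apply, c, hf, Complex.neg_re, Finset.sum_neg_distrib]
      ring
    simp only [Set.mem_ofPred_eq, Set.mem_preimage, this]
    constructor <;> intro h <;> linarith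
  have h1 : MeasurableSet {x | F s x < 0} :=
    (isOpen_lt (F_cont s) continuous_const).measurableSet
  have h2 : MeasurableSet {x | 0 < F s x} :=
    (isOpen_lt continuous_const (F_cont s)).measurableSet
  have hu : mu (Fin s ⊕ Fin s) ({x | F s x < 0} ∪ {x | 0 < F s x}) = 1 := by
    rw [prob_compl_eq_zero_iff (h1.union h2) |>.symm]
    convert F_zero_null s hs using 2
    ext x
    simp only [Set.mem_compl_iff, Set.mem_union, Set.mem_ofPred_eq]
    constructor
    · intro h; push Not at h; linarith
    · intro h; simp [h]
  rw [measure_union _ h2, hsym] at hu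
  · rw [ENNReal.eq_div_iff (by simp) (by simp), two_mul, hu]
  · rw [Set.disjoint_left]
    intro x hx hx'
    have h3 : F s x < 0 := hx
    have h4 : 0 < F s x := hx'
    linarith

lemma nu_apply (s : ℕ) (θ φ : Fin s → ℝ) (N : ℕ) :
    (nu (fun i => ((Sum.elim θ φ i : ℝ) : UnitAddCircle)) N).real {x | F s x < 0} =
    ((Finset.Icc 1 (N + 1)).filter (fun n : ℕ =>
          (∑ j, 2 * Real.cos (2 * Real.pi * n * θ j)) <
            ∑ j, 2 * Real.cos (2 * Real.pi * n * φ j))).card / ((N + 1 : ℕ) : ℝ) := by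
  have h1 : MeasurableSet {x | F s x < 0} :=
    (isOpen_lt (F_cont s) continuous_const).measurableSet
  have hc : ∀ (n : ℕ) (a : ℝ), (fourier 1 (n • (a : UnitAddCircle)) : ℂ).re
      = Real.cos (2 * Real.pi * n * a) := by
    intro n a
    rw [← AddCircle.coe_nsmul, fourier_coe_apply]
    rw [← Complex.exp_ofReal_mul_I_re]
    congr 2
    simp
    ring
  have hF : ∀ n : ℕ, n • (fun i => ((Sum.elim θ φ i : ℝ) : UnitAddCircle)) ∈ {x | F s x < 0} ↔
      (∑ j, 2 * Real.cos (2 * Real.pi * n * θ j)) <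
            ∑ j, 2 * Real.cos (2 * Real.pi * n * φ j) := by
    intro n
    simp only [F, Set.mem_ofPred_eq, Pi.smul_apply, Sum.elim_inl, Sum.elim_inr, hc,
      ← Finset.mul_sum]
    constructor <;> intro h <;> linarith
  rw [measureReal_def, nu, Measure.smul_apply, Measure.finsetSum_apply]
  simp only [Measure.dirac_apply' _ h1, Set.indicator_apply, hF, Pi.one_apply]
  rw [Finset.sum_boole, smul_eq_mul, ENNReal.toReal_mul, ENNReal.toReal_inv,
    ENNReal.toReal_natCast, ENNReal.toReal_natCast]
  simp [div_eq_inv_mul]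

lemma char_ne (s : ℕ) (θ φ : Fin s → ℝ)
    (hLI : LinearIndependent ℚ (fun x : Option (Fin s ⊕ Fin s) =>
      x.elim (1 : ℝ) (Sum.elim θ φ))) (k : Fin s ⊕ Fin s → ℤ) (hk : k ≠ 0) :
    mFourier k (fun i => ((Sum.elim θ φ i : ℝ) : UnitAddCircle)) ≠ 1 := by
  rw [mFourier_coe]
  intro h
  obtain ⟨m, hm⟩ := Complex.exp_eq_one_iff.1 h
  have hm' : (∑ i, k i * Sum.elim θ φ i : ℝ) = m := by
    have : (2 * Real.pi * Complex.I) * ((∑ i, k i * Sum.elim θ φ i : ℝ) : ℂ)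
        = (2 * Real.pi * Complex.I) * (m : ℂ) := by rw [hm]; ring
    have := mul_left_cancel₀ Complex.two_pi_I_ne_zero this
    exact_mod_cast this
  rw [Fintype.linearIndependent_iff] at hLI
  have := hLI (fun x => x.elim (-(m : ℚ)) (fun i => (k i : ℚ))) (by
    rw [Fintype.sum_option]
    simp only [Option.elim, Rat.smul_def]
    push_cast
    rw [hm']; ring)
  apply hk
  ext i
  simpa using this (some i)

end NoBias

/-- absence of bias: under ℚ-linear independence of
`1, θ_1, …, θ_s, φ_1, …, φ_s`, the proportion of `n ≤ N` with `a_n < b_n`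
tends to `1/2`. -/
theorem no_bias_cos_sums (s : ℕ) (hs : 1 ≤ s) (θ φ : Fin s → ℝ)
    (hLI : LinearIndependent ℚ (fun x : Option (Fin s ⊕ Fin s) =>
      x.elim (1 : ℝ) (Sum.elim θ φ))) :
    Tendsto (fun N : ℕ =>
        ((Finset.Icc 1 N).filter (fun n : ℕ =>
          (∑ j, 2 * Real.cos (2 * Real.pi * n * θ j)) <
            ∑ j, 2 * Real.cos (2 * Real.pi * n * φ j))).card / (N : ℝ))
      atTop (nhds (1 / 2)) := by
  rw [← tendsto_add_atTop_iff_nat 1]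
  simp only [← NoBias.nu_apply]
  set x : UnitAddTorus (Fin s ⊕ Fin s) := fun i => ((Sum.elim θ φ i : ℝ) : UnitAddCircle) with hx
  let P : MeasureTheory.ProbabilityMeasure (UnitAddTorus (Fin s ⊕ Fin s)) :=
    ⟨NoBias.mu (Fin s ⊕ Fin s), inferInstance⟩
  let Q : ℕ → MeasureTheory.ProbabilityMeasure (UnitAddTorus (Fin s ⊕ Fin s)) :=
    fun N => ⟨NoBias.nu x N, inferInstance⟩
  have hQ : Tendsto Q atTop (nhds P) := by
    rw [MeasureTheory.ProbabilityMeasure.tendsto_iff_forall_integral_rclike_tendsto ℂ]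
    intro f
    exact NoBias.tendsto_cont x (fun k hk => NoBias.char_ne s θ φ hLI k hk) f.toContinuousMap
  have hfr : (P : MeasureTheory.Measure _) (frontier {x | NoBias.F s x < 0}) = 0 := by
    refine MeasureTheory.measure_mono_null ?_ (NoBias.F_zero_null s hs)
    exact frontier_lt_subset_eq (NoBias.F_cont s) continuous_const
  have h := MeasureTheory.ProbabilityMeasure.tendsto_measure_of_null_frontier_of_tendsto' hQ hfr
  have h2 := (ENNReal.tendsto_toReal (MeasureTheory.measure_ne_top _ _)).comp h
  have h3 : ((P : MeasureTheory.Measure _) {x | NoBias.F s x < 0}).toReal = 1 / 2 := by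
    change (NoBias.mu (Fin s ⊕ Fin s) {x | NoBias.F s x < 0}).toReal = 1 / 2
    rw [NoBias.F_half s hs]; simp
  rw [h3] at h2
  exact h2
end
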